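/- Let f : 𝕋 → ℝ be a piecewise smooth function. Then for Haar-almost every α ∈ 𝕋 and for every x₀ ∈ 𝕋, the Birkhoff sums S_N(f,α,x₀) do not satisfy a temporal distributional limit theorem: there do not exist a real sequence (A_M), a positive sequence (B_M) with B_M → ∞, and a non-constant real random variable Y such that for every a ∈ ℝ, (1/M)·#{1 ≤ N ≤ M : (S_N(f,α,x₀) − A_M)/B_M ≤ a} → P[Y ≤ a] as M → ∞. -/

import Mathlib

open MeasureTheory Filter Set Topology

noncomputable def toCircle (x : ℝ) : UnitAddCircle := x

/-- The canonical embedding `ι : 𝕋 → [0,1) ⊆ ℝ`. -/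
noncomputable def iota (x : UnitAddCircle) : ℝ := (AddCircle.equivIco 1 0 x : ℝ)

/-- The Birkhoff sum `S_N(f, α, x₀) = ∑_{k=0}^{N-1} f(x₀ + kα)`. -/
noncomputable def birkhoff (f : UnitAddCircle → ℝ) (α x₀ : UnitAddCircle) (N : ℕ) : ℝ :=
  ∑ k ∈ Finset.range N, f (x₀ + k • α)

/-- `f : 𝕋 → ℝ` is piecewise smooth with (ordered) discontinuity points `γ i` and
jumps `H i`: it has zero mean, it is differentiable away from the `γ i` with derivative
extending to a function of bounded variation on `𝕋`, and at least one jump is nonzero. -/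
structure IsPiecewiseSmooth {ν : ℕ} (f : UnitAddCircle → ℝ) (γ : Fin ν → UnitAddCircle)
    (H : Fin ν → ℝ) : Prop where
  integral_zero : ∫ x, f x = 0
  nu_pos : 0 < ν
  strictMono : StrictMono fun i => iota (γ i)
  differentiableAt : ∀ x : ℝ, toCircle x ∉ Set.range γ →
    DifferentiableAt ℝ (fun y : ℝ => f (toCircle y)) x
  exists_deriv_bv : ∃ φ : UnitAddCircle → ℝ,
    BoundedVariationOn (fun y : ℝ => φ (toCircle y)) (Set.Icc 0 1) ∧
    ∀ x : ℝ, toCircle x ∉ Set.range γ →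
      HasDerivAt (fun y : ℝ => f (toCircle y)) (φ (toCircle x)) x
  jump : ∀ i, Filter.Tendsto
    (fun δ : ℝ => f (toCircle (iota (γ i) - δ)) - f (toCircle (iota (γ i) + δ)))
    (nhdsWithin 0 (Set.Ioi 0)) (nhds (H i))
  exists_jump_ne : ∃ i, H i ≠ 0

open scoped Classical in
/-- `S_N(f, α, x₀)` satisfies a temporal distributional limit theorem: there are
centering constants `A M`, scaling constants `B M > 0` with `B M → ∞`, and a
non-(a.s.-)constant real random variable `Y` such that, with `N` uniform on
`{1, …, M}`, `(S_N - A_M)/B_M` converges in distribution to `Y` as `M → ∞`. -/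
def SatisfiesTDLT (f : UnitAddCircle → ℝ) (α x₀ : UnitAddCircle) : Prop :=
  ∃ (A B : ℕ → ℝ) (Ω : Type) (_ : MeasurableSpace Ω) (P : Measure Ω) (Y : Ω → ℝ),
    (∀ M, 0 < B M) ∧ Filter.Tendsto B Filter.atTop Filter.atTop ∧
    IsProbabilityMeasure P ∧ Measurable Y ∧
    (¬ ∃ c : ℝ, ∀ᵐ ω ∂P, Y ω = c) ∧
    ∀ a : ℝ, Filter.Tendsto
      (fun M : ℕ => (((Finset.Icc 1 M).filter
        (fun N => (birkhoff f α x₀ N - A M) / B M ≤ a)).card : ℝ) / M)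
      Filter.atTop (nhds (P {ω | Y ω ≤ a}).toReal)

/-- Time spent by `Z` below level `z` during `[0, t]`. -/
noncomputable def occ (Z : ℝ → ℝ) (t z : ℝ) : ℝ := volume.real {s | s ∈ Icc 0 t ∧ Z s ≤ z}

lemma volume_Icc_inter_ne_top (t : ℝ) (p : ℝ → Prop) :
    volume {s | s ∈ Icc 0 t ∧ p s} ≠ ⊤ :=
  ne_top_of_le_ne_top (by simp) (measure_mono (t := Icc 0 t) fun _ h => h.1)

lemma volume_real_Icc_inter_pos {Z : ℝ → ℝ} {t : ℝ} (ht : 0 < t) {O : Set ℝ}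
    (hO : IsOpen (Z ⁻¹' O)) (h : ∃ s ∈ Icc 0 t, Z s ∈ O) :
    0 < volume.real {s | s ∈ Icc 0 t ∧ Z s ∈ O} := by
  obtain ⟨s, hs, hsO⟩ := h
  have h1 : s ∈ closure (Ioo 0 t) := by rw [closure_Ioo ht.ne]; exact hs
  have h2 : (Z ⁻¹' O ∩ Ioo 0 t).Nonempty := mem_closure_iff.1 h1 _ hO hsO
  have h3 : 0 < volume (Z ⁻¹' O ∩ Ioo 0 t) := (hO.inter isOpen_Ioo).measure_pos _ h2
  refine ENNReal.toReal_pos (h3.trans_le (measure_mono ?_)).ne' (volume_Icc_inter_ne_top t _)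
  exact fun x hx => ⟨Ioo_subset_Icc_self hx.2, hx.1⟩

lemma occ_add_compl {Z : ℝ → ℝ} (hZ : Continuous Z) {t : ℝ} (ht : 0 ≤ t) (z : ℝ) :
    occ Z t z + volume.real {s | s ∈ Icc 0 t ∧ z < Z s} = t := by
  have hm : MeasurableSet {s | s ∈ Icc 0 t ∧ z < Z s} :=
    measurableSet_Icc.inter (isOpen_lt continuous_const hZ).measurableSet
  rw [occ, ← measureReal_union _ hm (volume_Icc_inter_ne_top t _) (volume_Icc_inter_ne_top t _)]
  · have : {s | s ∈ Icc 0 t ∧ Z s ≤ z} ∪ {s | s ∈ Icc 0 t ∧ z < Z s} = Icc 0 t := by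
      ext s
      simp only [mem_union, mem_ofPred_eq, ← and_or_left, le_or_gt, and_true]
    rw [this, Real.volume_real_Icc_of_le ht, sub_zero]
  · rw [Set.disjoint_left]
    exact fun s h h' => absurd h.2 (not_le.2 h'.2)

lemma occ_pos {Z : ℝ → ℝ} (hZ : Continuous Z) {t z : ℝ} (ht : 0 < t)
    (h : ∃ s ∈ Icc 0 t, Z s < z) : 0 < occ Z t z := by
  refine (volume_real_Icc_inter_pos ht (O := Iio z) (isOpen_Iio.preimage hZ) h).trans_le ?_
  exact measureReal_mono (fun s hs => ⟨hs.1, le_of_lt hs.2⟩) (volume_Icc_inter_ne_top t _)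

lemma occ_lt {Z : ℝ → ℝ} (hZ : Continuous Z) {t z : ℝ} (ht : 0 < t)
    (h : ∃ s ∈ Icc 0 t, z < Z s) : occ Z t z < t := by
  have h1 := volume_real_Icc_inter_pos ht (O := Ioi z) (isOpen_Ioi.preimage hZ) h
  have h2 := occ_add_compl hZ ht.le z
  simp only [mem_Ioi] at h1
  linarith

lemma occ_eq_zero {Z : ℝ → ℝ} {t z : ℝ} (h : ∀ s ∈ Icc 0 t, z < Z s) : occ Z t z = 0 := by
  have : {s | s ∈ Icc 0 t ∧ Z s ≤ z} = ∅ := by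
    ext s
    simp only [mem_ofPred_eq, mem_empty_iff_false, iff_false, not_and, not_le]
    exact h s
  rw [occ, this, measureReal_empty]

lemma occ_eq_self {Z : ℝ → ℝ} {t z : ℝ} (ht : 0 ≤ t) (h : ∀ s ∈ Icc 0 t, Z s ≤ z) :
    occ Z t z = t := by
  have : {s | s ∈ Icc 0 t ∧ Z s ≤ z} = Icc 0 t := by
    ext s
    simp only [mem_ofPred_eq, and_iff_left_iff_imp]
    exact h s
  rw [occ, this, Real.volume_real_Icc_of_le ht, sub_zero]

lemma occ_extend_above {Z : ℝ → ℝ} {t t' z : ℝ} (htt : t ≤ t') (h : ∀ s ∈ Icc t t', z < Z s) :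
    occ Z t' z = occ Z t z := by
  have : {s | s ∈ Icc 0 t' ∧ Z s ≤ z} = {s | s ∈ Icc 0 t ∧ Z s ≤ z} := by
    ext s
    simp only [mem_ofPred_eq, mem_Icc]
    constructor
    · rintro ⟨⟨h0, h1⟩, h2⟩
      refine ⟨⟨h0, ?_⟩, h2⟩
      by_contra hc
      exact absurd h2 (not_le.2 (h s ⟨(not_le.1 hc).le, h1⟩))
    · rintro ⟨⟨h0, h1⟩, h2⟩
      exact ⟨⟨h0, h1.trans htt⟩, h2⟩
  rw [occ, occ, this]

lemma occ_extend_below {Z : ℝ → ℝ} (hZ : Continuous Z) {t t' z : ℝ} (ht : 0 ≤ t) (htt : t ≤ t')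
    (h : ∀ s ∈ Icc t t', Z s < z) : occ Z t' z = occ Z t z + (t' - t) := by
  have : {s | s ∈ Icc 0 t' ∧ z < Z s} = {s | s ∈ Icc 0 t ∧ z < Z s} := by
    ext s
    simp only [mem_ofPred_eq, mem_Icc]
    constructor
    · rintro ⟨⟨h0, h1⟩, h2⟩
      refine ⟨⟨h0, ?_⟩, h2⟩
      by_contra hc
      exact absurd h2 (not_lt.2 (h s ⟨(not_le.1 hc).le, h1⟩).le)
    · rintro ⟨⟨h0, h1⟩, h2⟩
      exact ⟨⟨h0, h1.trans htt⟩, h2⟩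
  have h1 := occ_add_compl hZ (ht.trans htt) z
  have h2 := occ_add_compl hZ ht z
  rw [this] at h1
  linarith

/-- The occupation measures of `Z` on the intervals `[0, t]` agree up to orientation preserving
affine changes of the space variable. -/
def OccSimilar (Z : ℝ → ℝ) : Prop :=
  ∀ t t', 0 < t → 0 < t' → ∃ l > 0, ∃ k, ∀ z, t * occ Z t' (l * z + k) = t' * occ Z t z

lemma occ_affine_min {Z : ℝ → ℝ} (hZ : Continuous Z) {t t' l k u u' : ℝ} (ht : 0 < t)
    (ht' : 0 < t') (hl : 0 < l) (h : ∀ z, t * occ Z t' (l * z + k) = t' * occ Z t z)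
    (hu : u ∈ Icc 0 t) (hum : ∀ s ∈ Icc 0 t, Z u ≤ Z s)
    (hu' : u' ∈ Icc 0 t') (hum' : ∀ s ∈ Icc 0 t', Z u' ≤ Z s) : l * Z u + k = Z u' := by
  apply le_antisymm
  · by_contra hc
    push Not at hc
    set z := Z u - (l * Z u + k - Z u') / (2 * l) with hz
    have h1 : l * z + k = (l * Z u + k + Z u') / 2 := by rw [hz]; field_simp; ring
    have h2 : z < Z u := by
      have : 0 < (l * Z u + k - Z u') / (2 * l) := by
        apply div_pos <;> linarith
      linarith
    have h3 : occ Z t z = 0 := occ_eq_zero fun s hs => h2.trans_le (hum s hs)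
    have h4 : 0 < occ Z t' (l * z + k) := occ_pos hZ ht' ⟨u', hu', by rw [h1]; linarith⟩
    have := h z
    rw [h3, mul_zero] at this
    exact absurd this (mul_pos ht h4).ne'
  · by_contra hc
    push Not at hc
    set z := Z u + (Z u' - (l * Z u + k)) / (2 * l) with hz
    have h1 : l * z + k = (l * Z u + k + Z u') / 2 := by rw [hz]; field_simp; ring
    have h2 : Z u < z := by
      have : 0 < (Z u' - (l * Z u + k)) / (2 * l) := by
        apply div_pos <;> linarith
      linarith
    have h3 : occ Z t' (l * z + k) = 0 := by
      refine occ_eq_zero fun s hs => lt_of_lt_of_le ?_ (hum' s hs)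
      rw [h1]; linarith
    have h4 : 0 < occ Z t z := occ_pos hZ ht ⟨u, hu, h2⟩
    have := h z
    rw [h3, mul_zero] at this
    exact absurd this (mul_pos ht' h4).ne

lemma occ_affine_max {Z : ℝ → ℝ} (hZ : Continuous Z) {t t' l k u u' : ℝ} (ht : 0 < t)
    (ht' : 0 < t') (hl : 0 < l) (h : ∀ z, t * occ Z t' (l * z + k) = t' * occ Z t z)
    (hu : u ∈ Icc 0 t) (hum : ∀ s ∈ Icc 0 t, Z s ≤ Z u)
    (hu' : u' ∈ Icc 0 t') (hum' : ∀ s ∈ Icc 0 t', Z s ≤ Z u') : l * Z u + k = Z u' := by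
  apply le_antisymm
  · by_contra hc
    push Not at hc
    set z := Z u - (l * Z u + k - Z u') / (2 * l) with hz
    have h1 : l * z + k = (l * Z u + k + Z u') / 2 := by rw [hz]; field_simp; ring
    have h2 : z < Z u := by
      have : 0 < (l * Z u + k - Z u') / (2 * l) := by
        apply div_pos <;> linarith
      linarith
    have h3 : occ Z t z < t := occ_lt hZ ht ⟨u, hu, h2⟩
    have h4 : occ Z t' (l * z + k) = t' := by
      refine occ_eq_self ht'.le fun s hs => (hum' s hs).trans ?_
      rw [h1]; linarith
    have := h z
    rw [h4] at this
    nlinarith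
  · by_contra hc
    push Not at hc
    set z := Z u + (Z u' - (l * Z u + k)) / (2 * l) with hz
    have h1 : l * z + k = (l * Z u + k + Z u') / 2 := by rw [hz]; field_simp; ring
    have h2 : Z u < z := by
      have : 0 < (Z u' - (l * Z u + k)) / (2 * l) := by
        apply div_pos <;> linarith
      linarith
    have h3 : occ Z t' (l * z + k) < t' := occ_lt hZ ht' ⟨u', hu', by rw [h1]; linarith⟩
    have h4 : occ Z t z = t := occ_eq_self ht.le fun s hs => (hum s hs).trans h2.le
    have := h z
    rw [h4] at this
    nlinarith

/-- `Z` leaves the range of its past immediately after each time. -/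
lemma OccSimilar.exists_exit {Z : ℝ → ℝ} (hZ : Continuous Z) (hS : OccSimilar Z) {t t' u v : ℝ}
    (ht : 0 < t) (htt : t < t') (hu : u ∈ Icc 0 t) (hv : v ∈ Icc 0 t)
    (hum : ∀ s ∈ Icc 0 t, Z u ≤ Z s) (hvm : ∀ s ∈ Icc 0 t, Z s ≤ Z v) (huv : Z u < Z v) :
    ∃ s ∈ Icc t t', Z s < Z u ∨ Z v < Z s := by
  by_contra hc
  push Not at hc
  -- it suffices to look at a short time interval
  obtain ⟨d, hd, hdZ⟩ := Metric.continuousAt_iff.1 (hZ.continuousAt (x := t)) ((Z v - Z u) / 4)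
    (by linarith)
  set r := min t' (t + d / 2) with hr
  have htr : t < r := lt_min htt (by linarith)
  have hrt' : r ≤ t' := min_le_left _ _
  have hnear : ∀ s ∈ Icc t r, |Z s - Z t| < (Z v - Z u) / 4 := by
    intro s hs
    have h1 : r ≤ t + d / 2 := min_le_right _ _
    have := hdZ (x := s) (by
      rw [Real.dist_eq, abs_of_nonneg (by linarith [hs.1])]; linarith [hs.2])
    rwa [Real.dist_eq] at this
  have hr0 : 0 < r := ht.trans htr
  obtain ⟨l, hl, k, hlk⟩ := hS t r ht hr0
  have hmem : ∀ x, x ∈ Icc 0 t → x ∈ Icc 0 r := fun x hx => ⟨hx.1, hx.2.trans htr.le⟩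
  have hmin : ∀ s ∈ Icc 0 r, Z u ≤ Z s := by
    intro s hs
    rcases le_total s t with h | h
    · exact hum s ⟨hs.1, h⟩
    · exact (hc s ⟨h, hs.2.trans hrt'⟩).1
  have hmax : ∀ s ∈ Icc 0 r, Z s ≤ Z v := by
    intro s hs
    rcases le_total s t with h | h
    · exact hvm s ⟨hs.1, h⟩
    · exact (hc s ⟨h, hs.2.trans hrt'⟩).2
  have e1 := occ_affine_min hZ ht hr0 hl hlk hu hum (hmem u hu) hmin
  have e2 := occ_affine_max hZ ht hr0 hl hlk hv hvm (hmem v hv) hmax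
  have hl1 : l = 1 := by
    have : (l - 1) * (Z v - Z u) = 0 := by linarith
    rcases mul_eq_zero.1 this with h | h <;> linarith
  have hk0 : k = 0 := by rw [hl1] at e1; linarith
  have key : ∀ z, t * occ Z r z = r * occ Z t z := by
    intro z; have := hlk z; rwa [hl1, hk0, one_mul, add_zero] at this
  rcases le_total ((Z u + Z v) / 2) (Z t) with hm | hm
  · have h1 : occ Z r (Z u + (Z v - Z u) / 4) = occ Z t (Z u + (Z v - Z u) / 4) :=
      occ_extend_above htr.le fun s hs => by
        have := (abs_lt.1 (hnear s hs)).1; linarith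
    have h2 : 0 < occ Z t (Z u + (Z v - Z u) / 4) := occ_pos hZ ht ⟨u, hu, by linarith⟩
    have := key (Z u + (Z v - Z u) / 4)
    rw [h1] at this
    nlinarith
  · have h1 : occ Z r (Z v - (Z v - Z u) / 4) = occ Z t (Z v - (Z v - Z u) / 4) + (r - t) :=
      occ_extend_below hZ ht.le htr.le fun s hs => by
        have := (abs_lt.1 (hnear s hs)).2; linarith
    have h2 : occ Z t (Z v - (Z v - Z u) / 4) < t := occ_lt hZ ht ⟨v, hv, by linarith⟩
    have := key (Z v - (Z v - Z u) / 4)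
    rw [h1] at this
    nlinarith

section Scaling

variable {Z : ℝ → ℝ}

lemma OccSimilar.monotone_of_ne (hZ : Continuous Z) (hZ0 : Z 0 = 0) (hS : OccSimilar Z)
    (hnc : ∀ t, 0 < t → ∃ s ∈ Icc 0 t, Z s ≠ 0) {t : ℝ} (ht : 0 < t) :
    (∀ s ∈ Icc 0 t, Z s ≤ Z t) ∨ (∀ s ∈ Icc 0 t, Z t ≤ Z s) := by
  obtain ⟨u, hu, hum⟩ := isCompact_Icc.exists_isMinOn (nonempty_Icc.2 ht.le) hZ.continuousOn
  obtain ⟨v, hv, hvm⟩ := isCompact_Icc.exists_isMaxOn (nonempty_Icc.2 ht.le) hZ.continuousOn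
  replace hum : ∀ s ∈ Icc 0 t, Z u ≤ Z s := fun s hs => hum hs
  replace hvm : ∀ s ∈ Icc 0 t, Z s ≤ Z v := fun s hs => hvm hs
  have huv : Z u < Z v := by
    obtain ⟨s, hs, hs0⟩ := hnc t ht
    have h0 : (0 : ℝ) ∈ Icc 0 t := ⟨le_rfl, ht.le⟩
    rcases lt_or_gt_of_ne hs0 with h | h
    · exact (hum s hs).trans_lt (h.trans_le (hZ0 ▸ hvm 0 h0))
    · exact ((hZ0 ▸ hum 0 h0 : Z u ≤ 0).trans_lt h).trans_le (hvm s hs)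
  by_contra hc
  push Not at hc
  obtain ⟨⟨a, ha, hat⟩, b, hb, hbt⟩ := hc
  have h1 : Z t ∈ Ioo (Z u) (Z v) := ⟨(hum b hb).trans_lt hbt, hat.trans_le (hvm a ha)⟩
  have h2 : ∀ᶠ s in 𝓝 t, Z s ∈ Ioo (Z u) (Z v) := hZ.continuousAt (isOpen_Ioo.mem_nhds h1)
  obtain ⟨d, hd, hdZ⟩ := Metric.eventually_nhds_iff.1 h2
  obtain ⟨s, hs, hs'⟩ := hS.exists_exit hZ ht (by linarith : t < t + d / 2) hu hv hum hvm huv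
  have := hdZ (y := s) (by
    rw [Real.dist_eq, abs_of_nonneg (by linarith [hs.1])]; linarith [hs.2])
  rcases hs' with h | h
  · exact absurd this.1 h.not_gt
  · exact absurd this.2 h.not_gt

lemma OccSimilar.ne_zero (hZ : Continuous Z) (hZ0 : Z 0 = 0) (hS : OccSimilar Z)
    (hnc : ∀ t, 0 < t → ∃ s ∈ Icc 0 t, Z s ≠ 0) {t : ℝ} (ht : 0 < t) : Z t ≠ 0 := by
  intro h0
  obtain ⟨u, hu, hu0⟩ := hnc t ht
  have hu0' : 0 < u := by
    rcases hu.1.eq_or_lt with h | h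
    · exact absurd hZ0 (h ▸ hu0)
    · exact h
  obtain ⟨w, hw, hwu⟩ : Z u / 2 ∈ Z '' uIcc u t := by
    apply intermediate_value_uIcc hZ.continuousOn
    rw [h0, mem_uIcc]
    rcases le_total (Z u) 0 with h | h
    · left; constructor <;> linarith
    · right; constructor <;> linarith
  rw [uIcc_of_le hu.2] at hw
  have hw0 : 0 < w := hu0'.trans_le hw.1
  have m0 : (0 : ℝ) ∈ Icc 0 w := ⟨le_rfl, hw0.le⟩
  have mu : u ∈ Icc 0 w := ⟨hu0'.le, hw.1⟩
  rcases hS.monotone_of_ne hZ hZ0 hnc hw0 with h | h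
  · have h1 := h 0 m0
    have h2 := h u mu
    rw [hwu] at h1 h2
    exact hu0 (by linarith)
  · have h1 := h 0 m0
    have h2 := h u mu
    rw [hwu] at h1 h2
    exact hu0 (by linarith)

lemma OccSimilar.ne_of_lt (hZ : Continuous Z) (hZ0 : Z 0 = 0) (hS : OccSimilar Z)
    (hnc : ∀ t, 0 < t → ∃ s ∈ Icc 0 t, Z s ≠ 0) {s t : ℝ} (hs : 0 ≤ s) (hst : s < t)
    (hmono : (∀ x y, 0 ≤ x → x ≤ y → Z x ≤ Z y) ∨ (∀ x y, 0 ≤ x → x ≤ y → Z y ≤ Z x)) :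
    Z s ≠ Z t := by
  intro he
  have hzt := hS.ne_zero hZ hZ0 hnc (hs.trans_lt hst)
  have hs0 : 0 < s := by
    rcases hs.eq_or_lt with h | h
    · rw [← h, hZ0] at he; exact absurd he.symm hzt
    · exact h
  have m0 : (0 : ℝ) ∈ Icc 0 s := ⟨le_rfl, hs⟩
  have ms : s ∈ Icc 0 s := ⟨hs, le_rfl⟩
  have hzs := hS.ne_zero hZ hZ0 hnc hs0
  rcases hmono with hm | hm
  · obtain ⟨r, hr, hr'⟩ := hS.exists_exit hZ hs0 hst m0 ms (fun x hx => hm _ _ le_rfl hx.1)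
      (fun x hx => hm _ _ hx.1 hx.2)
      (lt_of_le_of_ne (hm _ _ le_rfl hs) (by rw [hZ0]; exact hzs.symm))
    have h1 := hm _ _ hs hr.1
    have h2 := hm _ _ (hs.trans hr.1) hr.2
    have h3 := hm 0 s le_rfl hs
    rcases hr' with h | h <;> linarith
  · obtain ⟨r, hr, hr'⟩ := hS.exists_exit hZ hs0 hst ms m0 (fun x hx => hm _ _ hx.1 hx.2)
      (fun x hx => hm _ _ le_rfl hx.1)
      (lt_of_le_of_ne (hm _ _ le_rfl hs) (by rw [hZ0]; exact hzs))
    have h1 := hm _ _ hs hr.1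
    have h2 := hm _ _ (hs.trans hr.1) hr.2
    have h3 := hm 0 s le_rfl hs
    rcases hr' with h | h <;> linarith

lemma OccSimilar.monotone_or_antitone (hZ : Continuous Z) (hZ0 : Z 0 = 0) (hS : OccSimilar Z)
    (hnc : ∀ t, 0 < t → ∃ s ∈ Icc 0 t, Z s ≠ 0) :
    (∀ x y, 0 ≤ x → x ≤ y → Z x ≤ Z y) ∨ (∀ x y, 0 ≤ x → x ≤ y → Z y ≤ Z x) := by
  have hsign : (∀ t, 0 < t → 0 < Z t) ∨ (∀ t, 0 < t → Z t < 0) := by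
    by_contra hc
    push Not at hc
    obtain ⟨⟨a, ha, hZa⟩, b, hb, hZb⟩ := hc
    obtain ⟨w, hw, hw0⟩ : (0 : ℝ) ∈ Z '' uIcc a b := by
      apply intermediate_value_uIcc hZ.continuousOn
      rw [mem_uIcc]
      exact Or.inl ⟨hZa, hZb⟩
    refine hS.ne_zero hZ hZ0 hnc ?_ hw0
    exact (lt_min ha hb).trans_le hw.1
  have m0 : ∀ t : ℝ, 0 < t → (0 : ℝ) ∈ Icc 0 t := fun t ht => ⟨le_rfl, ht.le⟩
  rcases hsign with h | h
  · left
    intro x y hx hxy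
    rcases hxy.eq_or_lt with rfl | hlt
    · rfl
    have hy := hx.trans_lt hlt
    rcases hS.monotone_of_ne hZ hZ0 hnc hy with h' | h'
    · exact h' x ⟨hx, hxy⟩
    · have := h' 0 (m0 y hy); rw [hZ0] at this; exact absurd (h y hy) this.not_gt
  · right
    intro x y hx hxy
    rcases hxy.eq_or_lt with rfl | hlt
    · rfl
    have hy := hx.trans_lt hlt
    rcases hS.monotone_of_ne hZ hZ0 hnc hy with h' | h'
    · have := h' 0 (m0 y hy); rw [hZ0] at this; exact absurd (h y hy) this.not_gt
    · exact h' x ⟨hx, hxy⟩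

lemma OccSimilar.mul_eq_mul (hZ : Continuous Z) (hZ0 : Z 0 = 0) (hS : OccSimilar Z)
    (hnc : ∀ t, 0 < t → ∃ s ∈ Icc 0 t, Z s ≠ 0) {s t t' : ℝ} (ht : 0 < t) (ht' : 0 < t')
    (hs : s ∈ Icc 0 t) : Z (s * t' / t) * Z t = Z t' * Z s := by
  have hmono := hS.monotone_or_antitone hZ hZ0 hnc
  have hne := fun {a b : ℝ} (ha : 0 ≤ a) (hab : a < b) => hS.ne_of_lt hZ hZ0 hnc ha hab hmono
  have hzt := hS.ne_zero hZ hZ0 hnc ht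
  have hzt' := hS.ne_zero hZ hZ0 hnc ht'
  obtain ⟨l, hl, k, hlk⟩ := hS t t' ht ht'
  have m0 : (0 : ℝ) ∈ Icc 0 t := ⟨le_rfl, ht.le⟩
  have mt : t ∈ Icc 0 t := ⟨ht.le, le_rfl⟩
  have m0' : (0 : ℝ) ∈ Icc 0 t' := ⟨le_rfl, ht'.le⟩
  have mt' : t' ∈ Icc 0 t' := ⟨ht'.le, le_rfl⟩
  have hends : l * Z 0 + k = Z 0 ∧ l * Z t + k = Z t' := by
    rcases hmono with hm | hm
    · exact ⟨occ_affine_min hZ ht ht' hl hlk m0 (fun x hx => hm _ _ le_rfl hx.1) m0'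
        (fun x hx => hm _ _ le_rfl hx.1), occ_affine_max hZ ht ht' hl hlk mt
        (fun x hx => hm _ _ hx.1 hx.2) mt' (fun x hx => hm _ _ hx.1 hx.2)⟩
    · exact ⟨occ_affine_max hZ ht ht' hl hlk m0 (fun x hx => hm _ _ le_rfl hx.1) m0'
        (fun x hx => hm _ _ le_rfl hx.1), occ_affine_min hZ ht ht' hl hlk mt
        (fun x hx => hm _ _ hx.1 hx.2) mt' (fun x hx => hm _ _ hx.1 hx.2)⟩
  rw [hZ0] at hends
  have hk : k = 0 := by linarith [hends.1]
  rw [hk] at hends hlk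
  simp only [add_zero] at hends hlk
  -- the level `l * Z s` is attained
  obtain ⟨w, hw, hwZ⟩ : l * Z s ∈ Z '' uIcc 0 t' := by
    apply intermediate_value_uIcc hZ.continuousOn
    rw [hZ0, ← hends.2, mem_uIcc]
    rcases hmono with hm | hm
    · left
      have h1 := hm 0 s le_rfl hs.1
      have h2 := hm s t hs.1 hs.2
      rw [hZ0] at h1
      exact ⟨by positivity, by gcongr⟩
    · right
      have h1 := hm 0 s le_rfl hs.1
      have h2 := hm s t hs.1 hs.2
      rw [hZ0] at h1
      exact ⟨by gcongr, by nlinarith⟩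
  rw [uIcc_of_le ht'.le] at hw
  have hocc : (∀ T x, x ∈ Icc 0 T → occ Z T (Z x) = x) ∨
      (∀ T x, x ∈ Icc 0 T → occ Z T (Z x) = T - x) := by
    rcases hmono with hm | hm
    · left
      intro T x hx
      have : {r | r ∈ Icc 0 T ∧ Z r ≤ Z x} = Icc 0 x := by
        ext r
        simp only [mem_ofPred_eq, mem_Icc]
        constructor
        · rintro ⟨⟨h0, _⟩, h2⟩
          refine ⟨h0, ?_⟩
          by_contra hc
          push Not at hc
          exact hne hx.1 hc (le_antisymm (hm _ _ hx.1 hc.le) h2)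
        · rintro ⟨h0, h1⟩
          exact ⟨⟨h0, h1.trans hx.2⟩, hm _ _ h0 h1⟩
      rw [occ, this, Real.volume_real_Icc_of_le hx.1, sub_zero]
    · right
      intro T x hx
      have : {r | r ∈ Icc 0 T ∧ Z r ≤ Z x} = Icc x T := by
        ext r
        simp only [mem_ofPred_eq, mem_Icc]
        constructor
        · rintro ⟨⟨h0, h1⟩, h2⟩
          refine ⟨?_, h1⟩
          by_contra hc
          push Not at hc
          exact hne h0 hc (le_antisymm h2 (hm _ _ h0 hc.le))
        · rintro ⟨h0, h1⟩
          exact ⟨⟨hx.1.trans h0, h1⟩, hm _ _ hx.1 h0⟩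
      rw [occ, this, Real.volume_real_Icc_of_le hx.2]
  have hfin := hlk (Z s)
  rw [← hwZ] at hfin
  have hw' : w = s * t' / t := by
    rw [eq_div_iff ht.ne']
    rcases hocc with h | h
    · rw [h t' w hw, h t s hs] at hfin; linarith
    · rw [h t' w hw, h t s hs] at hfin; linarith
  rw [← hw', hwZ, ← hends.2]
  ring

/-- Differentiability at one positive time propagates to all positive times. -/
lemma OccSimilar.differentiableAt (hZ : Continuous Z) (hZ0 : Z 0 = 0) (hS : OccSimilar Z)
    (hnc : ∀ t, 0 < t → ∃ s ∈ Icc 0 t, Z s ≠ 0) {a b : ℝ} (ha : 0 < a) (hb : 0 < b)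
    (hd : DifferentiableAt ℝ Z a) : DifferentiableAt ℝ Z b := by
  set t := 2 * a with ht
  have ht0 : 0 < t := by positivity
  set t' := t * b / a with ht'
  have ht'0 : 0 < t' := by positivity
  have hev : (fun x => Z t' / Z t * Z (x * (a / b))) =ᶠ[𝓝 b] Z := by
    have : Ioo 0 (2 * b) ∈ 𝓝 b := isOpen_Ioo.mem_nhds ⟨hb, by linarith⟩
    filter_upwards [this] with x hx
    have hs : x * (a / b) ∈ Icc 0 t := by
      constructor
      · have := hx.1; positivity
      · rw [ht, ← mul_div_assoc, div_le_iff₀ hb]; nlinarith [hx.2]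
    have h1 := hS.mul_eq_mul hZ hZ0 hnc ht0 ht'0 hs
    have h2 : x * (a / b) * t' / t = x := by rw [ht']; field_simp
    rw [h2] at h1
    have h3 := hS.ne_zero hZ hZ0 hnc ht0
    rw [div_mul_eq_mul_div, div_eq_iff h3, h1]
  refine DifferentiableAt.congr_of_eventuallyEq ?_ hev.symm
  refine DifferentiableAt.const_mul ?_ _
  have hd' : DifferentiableAt ℝ Z (b * (a / b)) := by
    rwa [mul_div_cancel₀ _ hb.ne']
  exact DifferentiableAt.comp b hd' (by fun_prop)

/-- If the occupation measures on all intervals `[0, t]` on which `Z` is not identically zero are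
of the same type, then `Z` is nonzero immediately after time `0`. -/
lemma exists_ne_zero_of_occ_type {G : ℝ → ℝ} {a₀ : ℝ}
    (hG : 0 < G a₀ ∧ G a₀ < 1)
    (h : ∀ t, 0 < t → (∃ s ∈ Icc 0 t, Z s ≠ 0) →
      ∃ c b, 0 < b ∧ ∀ a, t * G a = occ Z t (c + b * a))
    (hne : ∃ s, 0 ≤ s ∧ Z s ≠ 0) {t : ℝ} (ht : 0 < t) : ∃ s ∈ Icc 0 t, Z s ≠ 0 := by
  by_contra hc
  push Not at hc
  obtain ⟨s, hs, hs0⟩ := hne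
  -- the last time up to which `Z` vanishes
  set S : Set ℝ := {r | 0 ≤ r ∧ Z r ≠ 0} with hSdef
  have hSne : S.Nonempty := ⟨s, hs, hs0⟩
  have hSb : BddBelow S := ⟨0, fun r hr => hr.1⟩
  set t₁ := sInf S with ht₁
  have htt₁ : t ≤ t₁ := le_csInf hSne fun r hr => by
    by_contra hlt
    push Not at hlt
    exact hr.2 (hc r ⟨hr.1, hlt.le⟩)
  have ht₁0 : 0 < t₁ := ht.trans_le htt₁
  have hzero : ∀ r ∈ Ico 0 t₁, Z r = 0 := fun r hr => by
    by_contra hr0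
    exact absurd (csInf_le hSb (show r ∈ S from ⟨hr.1, hr0⟩)) (not_le.2 hr.2)
  set e := min (G a₀) (1 - G a₀) with he
  have he0 : 0 < e := lt_min hG.1 (by linarith [hG.2])
  obtain ⟨r, hrS, hr⟩ := exists_lt_of_csInf_lt hSne
    (show t₁ < t₁ * (1 + e) by nlinarith)
  have hr1 : t₁ ≤ r := csInf_le hSb hrS
  have hr0 : 0 < r := ht₁0.trans_le hr1
  obtain ⟨c, b, hb, hcb⟩ := h r hr0 ⟨r, ⟨hr0.le, le_rfl⟩, hrS.2⟩
  have key := hcb a₀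
  rcases le_or_gt 0 (c + b * a₀) with hz | hz
  · have h1 : t₁ ≤ occ Z r (c + b * a₀) := by
      have : volume.real (Ico 0 t₁) ≤ occ Z r (c + b * a₀) :=
        measureReal_mono (fun x hx => ⟨⟨hx.1, hx.2.le.trans hr1⟩, by rw [hzero x hx]; exact hz⟩)
          (volume_Icc_inter_ne_top r _)
      rwa [Real.volume_real_Ico_of_le ht₁0.le, sub_zero] at this
    have h2 : e ≤ 1 - G a₀ := min_le_right _ _
    nlinarith
  · have h1 : occ Z r (c + b * a₀) ≤ r - t₁ := by
      have : occ Z r (c + b * a₀) ≤ volume.real (Icc t₁ r) := by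
        refine measureReal_mono (fun x hx => ⟨?_, hx.1.2⟩) (by simp)
        by_contra hlt
        push Not at hlt
        have := hx.2
        rw [hzero x ⟨hx.1.1, hlt⟩] at this
        exact absurd hz this.not_gt
      rwa [Real.volume_real_Icc_of_le hr1] at this
    have h2 : e ≤ G a₀ := min_le_left _ _
    nlinarith

/-- A Lipschitz function vanishing at `0` whose occupation measures are all of the same type is
differentiable at all positive times, unless it vanishes identically. -/
lemma differentiableAt_of_occ_type {C : NNReal} (hZ : LipschitzWith C Z) (hZ0 : Z 0 = 0)
    {G : ℝ → ℝ} {a₀ : ℝ} (hG : 0 < G a₀ ∧ G a₀ < 1)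
    (h : ∀ t, 0 < t → (∃ s ∈ Icc 0 t, Z s ≠ 0) →
      ∃ c b, 0 < b ∧ ∀ a, t * G a = occ Z t (c + b * a))
    (hne : ∃ s, 0 ≤ s ∧ Z s ≠ 0) {b : ℝ} (hb : 0 < b) : DifferentiableAt ℝ Z b := by
  have hnc : ∀ t, 0 < t → ∃ s ∈ Icc 0 t, Z s ≠ 0 := fun t ht =>
    exists_ne_zero_of_occ_type hG h hne ht
  have hS : OccSimilar Z := by
    intro t t' ht ht'
    obtain ⟨c, b, hb, hcb⟩ := h t ht (hnc t ht)
    obtain ⟨c', b', hb', hcb'⟩ := h t' ht' (hnc t' ht')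
    refine ⟨b' / b, by positivity, c' - b' * c / b, fun z => ?_⟩
    have h1 := hcb ((z - c) / b)
    have h2 := hcb' ((z - c) / b)
    rw [show c + b * ((z - c) / b) = z by field_simp; ring] at h1
    rw [show c' + b' * ((z - c) / b) = b' / b * z + (c' - b' * c / b) by field_simp; ring] at h2
    rw [← h1, ← h2]
    ring
  have hae := hZ.ae_differentiableAt_real
  obtain ⟨a, ha, had⟩ : ∃ a ∈ Ioi (0 : ℝ), DifferentiableAt ℝ Z a := by
    by_contra hc
    push Not at hc
    have h1 : volume (Ioi (0 : ℝ)) = 0 := measure_mono_null (fun x hx => hc x hx) hae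
    simp at h1
  exact hS.differentiableAt hZ.continuous hZ0 hnc ha hb had

end Scaling

lemma occ_le_of_forall_lt {Z : ℝ → ℝ} {t z x : ℝ} (hZ : Continuous Z) 
    (h : ∀ η > 0, x ≤ occ Z t (z + η)) : x ≤ occ Z t z := by
  let A : ℕ → Set ℝ := fun k => {s | s ∈ Icc 0 t ∧ Z s ≤ z + 1 / ((k : ℝ) + 1)}
  have hA : ∀ k, MeasurableSet (A k) := fun k =>
    measurableSet_Icc.inter (isClosed_le hZ continuous_const).measurableSet
  have hanti : Antitone A := by
    intro i j hij s hs
    refine ⟨hs.1, hs.2.trans ?_⟩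
    have : (1 : ℝ) / ((j : ℝ) + 1) ≤ 1 / ((i : ℝ) + 1) := by
      have : (i : ℝ) ≤ j := by exact_mod_cast hij
      gcongr
    linarith
  have h1 := tendsto_measure_iInter_atTop (μ := volume) (s := A)
    (fun k => (hA k).nullMeasurableSet) hanti ⟨0, volume_Icc_inter_ne_top t _⟩
  have h2 : ⋂ k, A k = {s | s ∈ Icc 0 t ∧ Z s ≤ z} := by
    ext s
    simp only [A, mem_iInter, mem_ofPred_eq]
    constructor
    · intro hs
      refine ⟨(hs 0).1, le_of_forall_pos_le_add fun ε hε => ?_⟩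
      obtain ⟨k, hk⟩ := exists_nat_one_div_lt hε
      exact (hs k).2.trans (by linarith)
    · intro hs k
      refine ⟨hs.1, hs.2.trans ?_⟩
      have : (0 : ℝ) ≤ 1 / ((k : ℝ) + 1) := by positivity
      linarith
  rw [h2] at h1
  have h3 := (ENNReal.tendsto_toReal (volume_Icc_inter_ne_top t (fun s => Z s ≤ z))).comp h1
  refine ge_of_tendsto h3 (Eventually.of_forall fun k => ?_)
  exact h _ (by positivity)

lemma card_filter_Icc_le {L t : ℝ} (hL : 0 < L) (p : ℕ → Prop) [DecidablePred p] :
    (((Finset.Icc 1 ⌊t * L⌋₊).filter p).card : ℝ) ≤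
      L * volume.real {s | s ∈ Icc 0 t ∧ p ⌊s * L⌋₊} + 1 := by
  set M := ⌊t * L⌋₊ with hM
  set F := ((Finset.Icc 1 M).filter p).erase M with hF
  have hcard : ((Finset.Icc 1 M).filter p).card ≤ F.card + 1 := by
    rw [hF]; have := Finset.pred_card_le_card_erase (s := (Finset.Icc 1 M).filter p) (a := M); omega
  have hfl : ∀ N : ℕ, ∀ s ∈ Ico ((N : ℝ) / L) ((N + 1) / L), ⌊s * L⌋₊ = N := by
    intro N s hs
    rw [mem_Ico, div_le_iff₀ hL, lt_div_iff₀ hL] at hs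
    exact (Nat.floor_eq_iff ((Nat.cast_nonneg N).trans hs.1)).2 hs
  have hsub : (⋃ N ∈ F, Ico ((N : ℝ) / L) ((N + 1) / L)) ⊆ {s | s ∈ Icc 0 t ∧ p ⌊s * L⌋₊} := by
    intro s hs
    simp only [mem_iUnion] at hs
    obtain ⟨N, hN, hs⟩ := hs
    have h1 := hfl N s hs
    rw [hF, Finset.mem_erase, Finset.mem_filter, Finset.mem_Icc] at hN
    obtain ⟨hNM, ⟨hN1, hN2⟩, hp⟩ := hN
    refine ⟨⟨(by positivity : (0 : ℝ) ≤ N / L).trans hs.1, ?_⟩, by rw [h1]; exact hp⟩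
    have h2 : N + 1 ≤ M := lt_of_le_of_ne hN2 hNM
    have h3 : ((N + 1 : ℕ) : ℝ) ≤ t * L := (Nat.le_floor_iff' (by omega)).1 h2
    push_cast at h3
    exact hs.2.le.trans ((div_le_iff₀ hL).2 h3)
  have hvol : volume.real (⋃ N ∈ F, Ico ((N : ℝ) / L) ((N + 1) / L)) = F.card / L := by
    rw [measureReal_biUnion_finset (h := fun _ _ => by rw [Real.volume_Ico]; exact ENNReal.ofReal_ne_top)]
    · have : ∀ N ∈ F, volume.real (Ico ((N : ℝ) / L) ((N + 1) / L)) = 1 / L := by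
        intro N _
        rw [Real.volume_real_Ico_of_le (by gcongr; linarith)]
        ring
      rw [Finset.sum_congr rfl this, Finset.sum_const, nsmul_eq_mul]
      ring
    · intro i _ j _ hij
      refine Set.disjoint_left.2 fun s hi hj => hij ?_
      rw [← hfl i s hi, ← hfl j s hj]
    · intro _ _; exact measurableSet_Ico
  have h4 := measureReal_mono hsub (volume_Icc_inter_ne_top t _)
  rw [hvol, div_le_iff₀ hL] at h4
  have h5 : (((Finset.Icc 1 M).filter p).card : ℝ) ≤ F.card + 1 := by exact_mod_cast hcard
  linarith [mul_comm L (volume.real {s | s ∈ Icc 0 t ∧ p ⌊s * L⌋₊})]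

section Limit

variable {U : Ultrafilter ℕ} {S : ℕ → ℝ} {T L e : ℕ → ℝ} {C : NNReal} {Z : ℝ → ℝ}

lemma lipschitzWith_of_limit (he : Tendsto e U (𝓝 0))
    (hS : ∀ n s s', s ≤ s' → |S ⌊s' * L n⌋₊ / T n - S ⌊s * L n⌋₊ / T n| ≤ C * (s' - s) + e n)
    (hZ : ∀ s, Tendsto (fun n => S ⌊s * L n⌋₊ / T n) U (𝓝 (Z s))) : LipschitzWith C Z := by
  refine LipschitzWith.of_dist_le_mul fun s' s => ?_
  wlog h : s ≤ s' generalizing s s'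
  · rw [dist_comm, dist_comm s' s]
    exact this s s' (le_of_not_ge h)
  rw [Real.dist_eq, Real.dist_eq, abs_of_nonneg (sub_nonneg.2 h)]
  have h1 : Tendsto (fun n => |S ⌊s' * L n⌋₊ / T n - S ⌊s * L n⌋₊ / T n|) U (𝓝 |Z s' - Z s|) :=
    ((hZ s').sub (hZ s)).abs
  have h2 : Tendsto (fun n => C * (s' - s) + e n) U (𝓝 (C * (s' - s) + 0)) := he.const_add _
  rw [add_zero] at h2
  exact le_of_tendsto_of_tendsto' h1 h2 fun n => hS n s s' h

lemma eventually_abs_sub_limit_le (he : Tendsto e U (𝓝 0))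
    (hS : ∀ n s s', s ≤ s' → |S ⌊s' * L n⌋₊ / T n - S ⌊s * L n⌋₊ / T n| ≤ C * (s' - s) + e n)
    (hZ : ∀ s, Tendsto (fun n => S ⌊s * L n⌋₊ / T n) U (𝓝 (Z s))) (R : ℝ) {η : ℝ} (hη : 0 < η) :
    ∀ᶠ n in U, ∀ s ∈ Icc 0 R, |S ⌊s * L n⌋₊ / T n - Z s| ≤ η := by
  have hL := lipschitzWith_of_limit he hS hZ
  set δ : ℝ := η / (4 * (C + 1)) with hδ
  have hC : (0 : ℝ) ≤ C := C.2
  have hδ0 : 0 < δ := by positivity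
  have hCδ : C * δ ≤ η / 4 := by
    rw [hδ, mul_div_assoc', div_le_div_iff₀ (by positivity) (by norm_num)]
    nlinarith
  have h1 : ∀ᶠ n in U, ∀ k ∈ Finset.range (⌊R / δ⌋₊ + 1),
      |S ⌊(k * δ) * L n⌋₊ / T n - Z (k * δ)| ≤ η / 4 := by
    rw [Filter.eventually_all_finset]
    intro k _
    have := (tendsto_iff_norm_sub_tendsto_zero.1 (hZ (k * δ))).eventually
      (ge_mem_nhds (show (0 : ℝ) < η / 4 by positivity))
    simpa only [Real.norm_eq_abs] using this
  have h2 : ∀ᶠ n in U, e n ≤ η / 4 :=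
    he.eventually (ge_mem_nhds (show (0 : ℝ) < η / 4 by positivity))
  filter_upwards [h1, h2] with n h1 h2 s hs
  set k := ⌊s / δ⌋₊ with hk
  have hk1 : (k : ℝ) * δ ≤ s := (le_div_iff₀ hδ0).1 (Nat.floor_le (by have := hs.1; positivity))
  have hk2 : s < (k + 1) * δ := (div_lt_iff₀ hδ0).1 (Nat.lt_floor_add_one _)
  have hkm : k ∈ Finset.range (⌊R / δ⌋₊ + 1) := by
    rw [Finset.mem_range, Nat.lt_succ_iff]
    exact Nat.floor_le_floor (by have := hs.2; gcongr)
  have a1 := h1 k hkm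
  have a2 := hS n _ _ hk1
  have a3 := hL.dist_le_mul s (k * δ)
  rw [Real.dist_eq, Real.dist_eq, abs_of_nonneg (sub_nonneg.2 hk1)] at a3
  have a4 : (C : ℝ) * (s - k * δ) ≤ C * δ := by
    apply mul_le_mul_of_nonneg_left _ hC; linarith
  rw [abs_le] at *
  constructor <;> linarith [a1.1, a1.2, a2.1, a2.2, a3.1, a3.2]

lemma tendsto_card_occ_bounds (hLpos : ∀ n, 0 < L n)
    (hL : Tendsto L U atTop) (he : Tendsto e U (𝓝 0))
    (hS : ∀ n s s', s ≤ s' → |S ⌊s' * L n⌋₊ / T n - S ⌊s * L n⌋₊ / T n| ≤ C * (s' - s) + e n)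
    (hZ : ∀ s, Tendsto (fun n => S ⌊s * L n⌋₊ / T n) U (𝓝 (Z s)))
    {t : ℝ} (ht : 0 < t) {g : ℝ} (p : ℕ → ℕ → Prop) [∀ n, DecidablePred (p n)]
    (hg : Tendsto (fun n => (((Finset.Icc 1 ⌊t * L n⌋₊).filter (p n)).card : ℝ) / ⌊t * L n⌋₊)
      U (𝓝 g)) {zn : ℕ → ℝ} (hp : ∀ n N, p n N ↔ S N / T n ≤ zn n) :
    (∀ z, (∀ᶠ n in U, zn n ≤ z) → t * g ≤ occ Z t z) ∧
    (∀ z, (∀ᶠ n in U, z ≤ zn n) → ∀ η > 0, occ Z t (z - η) ≤ t * g) := by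
  have hZc : Continuous Z := (lipschitzWith_of_limit he hS hZ).continuous
  have htL : Tendsto (fun n => t * L n) U atTop := hL.const_mul_atTop ht
  have hfl : Tendsto (fun n => (⌊t * L n⌋₊ : ℝ) / L n) U (𝓝 t) :=
    (tendsto_nat_floor_mul_div_atTop ht.le).comp hL
  have hcard : Tendsto (fun n => (((Finset.Icc 1 ⌊t * L n⌋₊).filter (p n)).card : ℝ) / L n)
      U (𝓝 (g * t)) := by
    refine (hg.mul hfl).congr' ?_
    filter_upwards [htL.eventually_ge_atTop 1] with n hn
    have h1 : 1 ≤ ⌊t * L n⌋₊ := Nat.le_floor (by simpa using hn)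
    have h2 : (⌊t * L n⌋₊ : ℝ) ≠ 0 := by positivity
    field_simp
  have hinv : Tendsto (fun n => 1 / L n) U (𝓝 0) := by
    simpa [Function.comp_def] using tendsto_inv_atTop_zero.comp hL
  constructor
  · intro z hz
    refine occ_le_of_forall_lt hZc fun η hη => ?_
    have h1 : Tendsto (fun n => occ Z t (z + η) + 1 / L n) U (𝓝 (occ Z t (z + η) + 0)) :=
      hinv.const_add _
    rw [add_zero] at h1
    rw [mul_comm]
    refine le_of_tendsto_of_tendsto hcard h1 ?_
    filter_upwards [hz, eventually_abs_sub_limit_le he hS hZ t hη] with n hn hu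
    rw [div_le_iff₀ (hLpos n), add_mul, one_div_mul_cancel (hLpos n).ne']
    refine (card_filter_Icc_le (hLpos n) (p n)).trans ?_
    rw [mul_comm]
    gcongr
    · exact (hLpos n).le
    · refine measureReal_mono (fun s hs => ⟨hs.1, ?_⟩) (volume_Icc_inter_ne_top t _)
      have h2 := (hp n _).1 hs.2
      have h3 := abs_le.1 (hu s hs.1)
      linarith [h3.1]
  · intro z hz η hη
    have h1 : Tendsto (fun n => (⌊t * L n⌋₊ : ℝ) / L n - t + occ Z t (z - η) - 1 / L n) U
        (𝓝 (t - t + occ Z t (z - η) - 0)) := ((hfl.sub_const t).add_const _).sub hinv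
    rw [sub_self, zero_add, sub_zero] at h1
    rw [mul_comm]
    refine le_of_tendsto_of_tendsto h1 hcard ?_
    filter_upwards [hz, eventually_abs_sub_limit_le he hS hZ t hη] with n hn hu
    have h2 := card_filter_Icc_le (t := t) (hLpos n) (fun N => ¬ p n N)
    have h3 := Finset.card_filter_add_card_filter_not (s := Finset.Icc 1 ⌊t * L n⌋₊) (p n)
    rw [Nat.card_Icc, Nat.add_sub_cancel] at h3
    have h3' : (((Finset.Icc 1 ⌊t * L n⌋₊).filter (p n)).card : ℝ) +
      ((Finset.Icc 1 ⌊t * L n⌋₊).filter (fun N => ¬ p n N)).card = ⌊t * L n⌋₊ := by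
      exact_mod_cast h3
    have h4 : volume.real {s | s ∈ Icc 0 t ∧ ¬ p n ⌊s * L n⌋₊} ≤
        volume.real {s | s ∈ Icc 0 t ∧ z - η < Z s} := by
      refine measureReal_mono (fun s hs => ⟨hs.1, ?_⟩) (volume_Icc_inter_ne_top t _)
      have h2 := not_le.1 (mt (hp n _).2 hs.2)
      have h3 := abs_le.1 (hu s hs.1)
      linarith [h3.2]
    have h5 := occ_add_compl hZc ht.le (z - η)
    have h6 : volume.real {s | s ∈ Icc 0 t ∧ ¬ p n ⌊s * L n⌋₊} ≤ t - occ Z t (z - η) := by linarith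
    have h7 := mul_le_mul_of_nonneg_left h6 (hLpos n).le
    have hl := hLpos n
    rw [le_div_iff₀ hl, sub_mul, add_mul, sub_mul, div_mul_cancel₀ _ hl.ne',
      one_div_mul_cancel hl.ne']
    nlinarith

end Limit

/-- `G` has the monotonicity and limit properties of a distribution function. -/
structure IsDistribution (G : ℝ → ℝ) : Prop where
  mono : Monotone G
  atBot : Tendsto G atBot (𝓝 0)
  atTop : Tendsto G atTop (𝓝 1)
  right_continuous : ∀ a, ContinuousWithinAt G (Ioi a) a

lemma Ultrafilter.exists_tendsto_of_bounded {ι : Type*} {U : Ultrafilter ι} {z : ι → ℝ} {a b : ℝ}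
    (h : ∀ᶠ n in U, z n ∈ Icc a b) : ∃ x, Tendsto z U (𝓝 x) := by
  obtain ⟨x, -, hx⟩ := (isCompact_Icc (a := a) (b := b)).ultrafilter_le_nhds' (U.map z) h
  exact ⟨x, hx⟩

section Limit

variable {U : Ultrafilter ℕ} {S : ℕ → ℝ} {T L e : ℕ → ℝ} {C : NNReal} {Z : ℝ → ℝ}

lemma exists_occ_type (hT : ∀ n, 0 < T n) (hLpos : ∀ n, 0 < L n)
    (hL : Tendsto L U atTop) (he : Tendsto e U (𝓝 0))
    (hS : ∀ n s s', s ≤ s' → |S ⌊s' * L n⌋₊ / T n - S ⌊s * L n⌋₊ / T n| ≤ C * (s' - s) + e n)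
    (hZ : ∀ s, Tendsto (fun n => S ⌊s * L n⌋₊ / T n) U (𝓝 (Z s))) (hZ0 : Z 0 = 0)
    {G : ℝ → ℝ} (hG : IsDistribution G) {a₀ : ℝ} (ha₀ : 0 < G a₀ ∧ G a₀ < 1)
    {A B : ℕ → ℝ} (hB : ∀ M, 0 < B M) (p : ℝ → ℕ → ℕ → Prop) [∀ a M, DecidablePred (p a M)]
    (hp : ∀ a M N, p a M N ↔ (S N - A M) / B M ≤ a)
    (hlim : ∀ a, Tendsto (fun M : ℕ => (((Finset.Icc 1 M).filter (p a M)).card : ℝ) / M)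
      atTop (𝓝 (G a)))
    {t : ℝ} (ht : 0 < t) (hne : ∃ s ∈ Icc 0 t, Z s ≠ 0) :
    ∃ c b, 0 < b ∧ ∀ a, t * G a = occ Z t (c + b * a) := by
  have hlip := lipschitzWith_of_limit he hS hZ
  have hZc := hlip.continuous
  have hM : Tendsto (fun n => ⌊t * L n⌋₊) U atTop :=
    tendsto_nat_floor_atTop.comp (hL.const_mul_atTop ht)
  set α : ℕ → ℝ := fun n => A ⌊t * L n⌋₊ / T n with hα
  set β : ℕ → ℝ := fun n => B ⌊t * L n⌋₊ / T n with hβ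
  have hβpos : ∀ n, 0 < β n := fun n => div_pos (hB _) (hT n)
  have key : ∀ a, (∀ z, (∀ᶠ n in U, α n + β n * a ≤ z) → t * G a ≤ occ Z t z) ∧
      (∀ z, (∀ᶠ n in U, z ≤ α n + β n * a) → ∀ η > 0, occ Z t (z - η) ≤ t * G a) := by
    intro a
    refine tendsto_card_occ_bounds hLpos hL he hS hZ ht (fun n => p a ⌊t * L n⌋₊)
      ((hlim a).comp hM) (zn := fun n => α n + β n * a) fun n N => ?_
    rw [hp, div_le_iff₀ (hB _), div_le_iff₀ (hT n), hα, hβ]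
    have : (A ⌊t * L n⌋₊ / T n + B ⌊t * L n⌋₊ / T n * a) * T n =
        A ⌊t * L n⌋₊ + a * B ⌊t * L n⌋₊ := by
      have := (hT n).ne'
      field_simp
    rw [this, sub_le_iff_le_add, add_comm]
  have hbd : ∀ s ∈ Icc 0 t, |Z s| ≤ C * t := by
    intro s hs
    have := hlip.dist_le_mul s 0
    rw [Real.dist_eq, Real.dist_eq, hZ0, sub_zero, sub_zero, abs_of_nonneg hs.1] at this
    exact this.trans (mul_le_mul_of_nonneg_left hs.2 C.2)
  have hconv : ∀ a, 0 < G a → G a < 1 → ∃ x, Tendsto (fun n => α n + β n * a) U (𝓝 x) := by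
    intro a h0 h1
    refine Ultrafilter.exists_tendsto_of_bounded (a := -(C * t) - 1) (b := C * t + 2) ?_
    have e1 : ∀ᶠ n in U, -(C * t) - 1 ≤ α n + β n * a := by
      by_contra hc
      rw [← Ultrafilter.eventually_not] at hc
      have h2 := (key a).1 (-(C * t) - 1) (hc.mono fun n hn => (not_le.1 hn).le)
      rw [occ_eq_zero] at h2
      · nlinarith
      · intro s hs
        linarith [(abs_le.1 (hbd s hs)).1]
    have e2 : ∀ᶠ n in U, α n + β n * a ≤ C * t + 2 := by
      by_contra hc
      rw [← Ultrafilter.eventually_not] at hc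
      have h2 := (key a).2 (C * t + 2) (hc.mono fun n hn => (not_le.1 hn).le) 1 one_pos
      rw [occ_eq_self ht.le] at h2
      · nlinarith
      · intro s hs
        linarith [(abs_le.1 (hbd s hs)).2]
    filter_upwards [e1, e2] with n h1 h2 using ⟨h1, h2⟩
  obtain ⟨a₁, ha₁, hGa₁⟩ : ∃ a₁, a₀ < a₁ ∧ G a₁ < 1 := by
    have := (hG.right_continuous a₀).eventually (gt_mem_nhds ha₀.2)
    obtain ⟨a, h1, h2⟩ := (this.and self_mem_nhdsWithin).exists
    exact ⟨a, h2, h1⟩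
  obtain ⟨x₀, hx₀⟩ := hconv a₀ ha₀.1 ha₀.2
  obtain ⟨x₁, hx₁⟩ := hconv a₁ (ha₀.1.trans_le (hG.mono ha₁.le)) hGa₁
  have hd : a₁ - a₀ ≠ 0 := (sub_pos.2 ha₁).ne'
  obtain ⟨b, hb⟩ : ∃ b, Tendsto β U (𝓝 b) := by
    refine ⟨(x₁ - x₀) / (a₁ - a₀), ((hx₁.sub hx₀).div_const (a₁ - a₀)).congr fun n => ?_⟩
    field_simp
    ring
  obtain ⟨c, hc⟩ : ∃ c, Tendsto α U (𝓝 c) := by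
    refine ⟨x₀ - b * a₀, (hx₀.sub (hb.mul_const a₀)).congr fun n => ?_⟩
    ring
  have hb0 : 0 ≤ b := ge_of_tendsto' hb fun n => (hβpos n).le
  have hconv' : ∀ a, Tendsto (fun n => α n + β n * a) U (𝓝 (c + b * a)) := fun a =>
    hc.add (hb.mul_const a)
  have up : ∀ a, t * G a ≤ occ Z t (c + b * a) := by
    intro a
    refine occ_le_of_forall_lt hZc fun η hη => (key a).1 _ ?_
    exact (hconv' a).eventually (ge_mem_nhds (by linarith))
  have low : ∀ a, ∀ η > 0, occ Z t (c + b * a - η) ≤ t * G a := by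
    intro a η hη
    have := (key a).2 (c + b * a - η / 2)
      ((hconv' a).eventually (le_mem_nhds (by linarith))) (η / 2) (by linarith)
    rwa [sub_sub, add_halves] at this
  rcases hb0.eq_or_lt with h0 | hbpos
  · exfalso
    have h1 : t ≤ occ Z t c := by
      have : Tendsto (fun a => t * G a) Filter.atTop (𝓝 (t * 1)) := hG.atTop.const_mul t
      rw [mul_one] at this
      refine le_of_tendsto' this fun a => ?_
      simpa [← h0] using up a
    have h2 : ∀ η > 0, occ Z t (c - η) ≤ 0 := by
      intro η hη
      have : Tendsto (fun a => t * G a) Filter.atBot (𝓝 (t * 0)) := hG.atBot.const_mul t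
      rw [mul_zero] at this
      refine ge_of_tendsto' this fun a => ?_
      simpa [← h0] using low a η hη
    have h3 : ∀ s ∈ Icc 0 t, Z s = c := by
      intro s hs
      refine le_antisymm ?_ ?_
      · by_contra hlt
        exact absurd h1 (not_le.2 (occ_lt hZc ht ⟨s, hs, not_le.1 hlt⟩))
      · by_contra hlt
        have := occ_pos hZc ht (z := c - (c - Z s) / 2) ⟨s, hs, by linarith [not_le.1 hlt]⟩
        exact absurd (h2 ((c - Z s) / 2) (by linarith [not_le.1 hlt])) (not_le.2 this)
    obtain ⟨s, hs, hs0⟩ := hne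
    exact hs0 (by rw [h3 s hs, ← h3 0 ⟨le_rfl, ht.le⟩, hZ0])
  · refine ⟨c, b, hbpos, fun a => le_antisymm (up a) ?_⟩
    have h1 : Tendsto (fun a' => t * G a') (𝓝[>] a) (𝓝 (t * G a)) :=
      (hG.right_continuous a).const_mul t
    refine ge_of_tendsto h1 ?_
    filter_upwards [self_mem_nhdsWithin] with a' ha'
    have := low a' (b * (a' - a)) (mul_pos hbpos (sub_pos.2 ha'))
    have e : c + b * a' - b * (a' - a) = c + b * a := by ring
    rwa [e] at this

end Limit

lemma isDistribution_of_measurable {Ω : Type*} [MeasurableSpace Ω] {P : Measure Ω}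
    [IsProbabilityMeasure P] {Y : Ω → ℝ} (hY : Measurable Y) :
    IsDistribution fun a => (P {ω | Y ω ≤ a}).toReal := by
  have := Measure.isProbabilityMeasure_map (μ := P) hY.aemeasurable
  have h : (fun a => (P {ω | Y ω ≤ a}).toReal) = ProbabilityTheory.cdf (P.map Y) := by
    ext a
    rw [ProbabilityTheory.cdf_eq_real, map_measureReal_apply hY measurableSet_Iic]
    rfl
  rw [h]
  exact ⟨ProbabilityTheory.monotone_cdf _, ProbabilityTheory.tendsto_cdf_atBot _,
    ProbabilityTheory.tendsto_cdf_atTop _,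
    fun a => ((ProbabilityTheory.cdf (P.map Y)).right_continuous a).mono Ioi_subset_Ici_self⟩

lemma exists_cdf_mem_Ioo {Ω : Type*} [MeasurableSpace Ω] {P : Measure Ω}
    [IsProbabilityMeasure P] {Y : Ω → ℝ} (hY : Measurable Y)
    (hne : ¬ ∃ c : ℝ, ∀ᵐ ω ∂P, Y ω = c) :
    ∃ a, 0 < (P {ω | Y ω ≤ a}).toReal ∧ (P {ω | Y ω ≤ a}).toReal < 1 := by
  by_contra hcon
  push Not at hcon
  set G : ℝ → ℝ := fun a => (P {ω | Y ω ≤ a}).toReal with hGdef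
  have hG : IsDistribution G := isDistribution_of_measurable hY
  have h01 : ∀ a, G a = 0 ∨ G a = 1 := by
    intro a
    have h0 : 0 ≤ G a := ENNReal.toReal_nonneg
    have h1 : G a ≤ 1 := ENNReal.toReal_le_of_le_ofReal zero_le_one (by simpa using prob_le_one)
    rcases h0.eq_or_lt with h | h
    · exact Or.inl h.symm
    · exact Or.inr (le_antisymm h1 (hcon a h))
  set E : Set ℝ := {a | G a = 1} with hE
  have hne' : E.Nonempty := by
    obtain ⟨a, ha⟩ := (hG.atTop.eventually (lt_mem_nhds zero_lt_one)).exists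
    exact ⟨a, (h01 a).resolve_left ha.ne'⟩
  have hbd : BddBelow E := by
    obtain ⟨a, ha⟩ := (hG.atBot.eventually (gt_mem_nhds zero_lt_one)).exists
    refine ⟨a, fun x hx => ?_⟩
    by_contra hlt
    have := hG.mono (not_le.1 hlt).le
    rw [show G x = 1 from hx] at this
    linarith
  set c := sInf E with hc
  have h1 : ∀ a, c < a → G a = 1 := by
    intro a ha
    obtain ⟨x, hx, hxa⟩ := exists_lt_of_csInf_lt hne' ha
    refine (h01 a).resolve_left fun h => ?_
    have := hG.mono hxa.le
    rw [show G x = 1 from hx, h] at this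
    linarith
  have hGc : G c = 1 := by
    refine tendsto_nhds_unique (hG.right_continuous c) (tendsto_const_nhds.congr' ?_)
    filter_upwards [self_mem_nhdsWithin] with a ha using (h1 a ha).symm
  have h2 : ∀ a, a < c → G a = 0 := by
    intro a ha
    refine (h01 a).resolve_right fun h => ?_
    exact absurd (csInf_le hbd h) (not_le.2 ha)
  refine hne ⟨c, ?_⟩
  have e1 : ∀ᵐ ω ∂P, Y ω ≤ c :=
    (mem_ae_iff_prob_eq_one (measurableSet_le hY measurable_const)).2
      ((ENNReal.toReal_eq_one_iff _).1 hGc)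
  have e2 : ∀ᵐ ω ∂P, ∀ n : ℕ, c - 1 / ((n : ℝ) + 1) < Y ω := by
    rw [ae_all_iff]
    intro n
    have h3 := h2 (c - 1 / ((n : ℝ) + 1)) (by have : (0 : ℝ) < 1 / ((n : ℝ) + 1) := by positivity
                                              linarith)
    rw [hGdef] at h3
    simp only [ENNReal.toReal_eq_zero_iff, measure_ne_top, or_false] at h3
    rw [ae_iff]
    simpa only [not_lt] using h3
  filter_upwards [e1, e2] with ω h3 h4
  refine le_antisymm h3 (le_of_forall_pos_lt_add fun ε hε => ?_)
  obtain ⟨n, hn⟩ := exists_nat_one_div_lt hε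
  linarith [h4 n]

/-- A bounded function on the circle which is Lipschitz away from the finite set `γ`, with one-sided
jumps `H` at `γ`, all with the same constant `Λ`. -/
structure JumpRegular {ν : ℕ} (f : UnitAddCircle → ℝ) (γ : Fin ν → UnitAddCircle)
    (H : Fin ν → ℝ) (Λ : ℝ) : Prop where
  injective : Function.Injective γ
  nonneg : 0 ≤ Λ
  bound : ∀ x, |f x| ≤ Λ
  lip : ∀ (x : UnitAddCircle) (s : ℝ),
    (∀ r : ℝ, |r| ≤ |s| → x + (r : UnitAddCircle) ∉ range γ) →
    |f (x + (s : UnitAddCircle)) - f x| ≤ Λ * |s|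
  jump : ∀ (i : Fin ν) (u v ℓ : ℝ), 0 < u → 0 < v → u ≤ ℓ → v ≤ ℓ →
    (∀ r : ℝ, |r| ≤ ℓ → r ≠ 0 → γ i + (r : UnitAddCircle) ∉ range γ) →
    |f (γ i + ((-u : ℝ) : UnitAddCircle)) - f (γ i + (v : UnitAddCircle)) - H i| ≤ Λ * (u + v)
  integrable : Integrable f
  integral_zero : ∫ x, f x = 0

lemma toCircle_eq (x : ℝ) : toCircle x = (x : UnitAddCircle) := rfl

lemma coe_iota (x : UnitAddCircle) : ((iota x : ℝ) : UnitAddCircle) = x :=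
  (AddCircle.equivIco 1 0).symm_apply_apply x

lemma exists_coe_mem_Ico (x : UnitAddCircle) : ∃ y ∈ Ico (0 : ℝ) 1, (y : UnitAddCircle) = x := by
  refine ⟨iota x, ?_, coe_iota x⟩
  have := (AddCircle.equivIco 1 0 x).2
  exact ⟨this.1, this.2.trans_eq (zero_add 1)⟩

lemma isOpenMap_coe_circle : IsOpenMap (fun y : ℝ => (y : UnitAddCircle)) :=
  QuotientAddGroup.isOpenMap_coe

lemma continuous_coe_circle : Continuous (fun y : ℝ => (y : UnitAddCircle)) :=
  AddCircle.continuous_mk' 1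

lemma coe_eq_zero_imp {r : ℝ} (h : (r : UnitAddCircle) = 0) : ∃ n : ℤ, (n : ℝ) = r := by
  obtain ⟨n, hn⟩ := (AddCircle.coe_eq_zero_iff (1 : ℝ)).1 h
  exact ⟨n, by simpa using hn⟩

lemma exists_punctured_notMem {ν : ℕ} (γ : Fin ν → UnitAddCircle) (x : UnitAddCircle) :
    ∃ ε > 0, ∀ r : ℝ, |r| < ε → r ≠ 0 → x + (r : UnitAddCircle) ∉ range γ := by
  have h1 : (range γ \ {x})ᶜ ∈ 𝓝 x :=
    ((finite_range γ).subset sdiff_subset).isClosed.isOpen_compl.mem_nhds (by simp)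
  have h2 : Continuous fun r : ℝ => x + (r : UnitAddCircle) := by
    have := continuous_coe_circle
    fun_prop
  have h3 : ∀ᶠ r : ℝ in 𝓝 0, x + (r : UnitAddCircle) ∈ (range γ \ {x})ᶜ := by
    apply h2.continuousAt.eventually_mem
    simpa using h1
  obtain ⟨ε, hε, h⟩ := Metric.eventually_nhds_iff.1 h3
  refine ⟨min ε 1, lt_min hε one_pos, fun r hr hr0 hmem => ?_⟩
  have h4 := h (y := r) (by rw [Real.dist_eq, sub_zero]; exact hr.trans_le (min_le_left _ _))
  apply h4
  refine ⟨hmem, fun hx => hr0 ?_⟩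
  rw [mem_singleton_iff, add_eq_left] at hx
  obtain ⟨n, rfl⟩ := coe_eq_zero_imp hx
  have h5 : |(n : ℝ)| < 1 := hr.trans_le (min_le_right _ _)
  have h6 : |n| < 1 := by exact_mod_cast h5
  rw [Int.abs_lt_one_iff] at h6
  simp [h6]

section

variable {ν : ℕ} {f : UnitAddCircle → ℝ} {γ : Fin ν → UnitAddCircle} {H : Fin ν → ℝ}

lemma exists_deriv_bound (h : IsPiecewiseSmooth f γ H) : ∃ Λ : ℝ, 0 ≤ Λ ∧
    ∀ a b : ℝ, a ≤ b → (∀ y ∈ Icc a b, (y : UnitAddCircle) ∉ range γ) →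
      |f (b : UnitAddCircle) - f (a : UnitAddCircle)| ≤ Λ * (b - a) := by
  obtain ⟨φ, hbv, hφ⟩ := h.exists_deriv_bv
  obtain ⟨Λ, hΛ⟩ : ∃ Λ : ℝ, ∀ x, |φ x| ≤ Λ := by
    refine ⟨|φ (toCircle 0)| + (eVariationOn (fun y : ℝ => φ (toCircle y)) (Icc 0 1)).toReal,
      fun x => ?_⟩
    obtain ⟨y, hy, rfl⟩ := exists_coe_mem_Ico x
    have h1 := hbv.dist_le (x := y) (y := 0) (Ico_subset_Icc_self hy) (by simp)
    rw [Real.dist_eq] at h1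
    have h2 := abs_sub_abs_le_abs_sub (φ (toCircle y)) (φ (toCircle 0))
    rw [toCircle_eq y] at *
    linarith
  refine ⟨Λ, (abs_nonneg _).trans (hΛ 0), fun a b hab hy => ?_⟩
  have := norm_image_sub_le_of_norm_deriv_le_segment' (f := fun y : ℝ => f (toCircle y))
    (f' := fun y => φ (toCircle y)) (C := Λ) (a := a) (b := b)
    (fun y hy' => (hφ y (hy y hy')).hasDerivWithinAt) (fun y _ => hΛ _) b ⟨hab, le_rfl⟩
  exact this

lemma exists_lip_bound (h : IsPiecewiseSmooth f γ H) : ∃ Λ : ℝ, 0 ≤ Λ ∧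
    ∀ (x : UnitAddCircle) (a b : ℝ), a ≤ b →
      (∀ r ∈ Icc a b, x + (r : UnitAddCircle) ∉ range γ) →
      |f (x + (b : UnitAddCircle)) - f (x + (a : UnitAddCircle))| ≤ Λ * (b - a) := by
  obtain ⟨Λ, h0, hΛ⟩ := exists_deriv_bound h
  refine ⟨Λ, h0, fun x a b hab hr => ?_⟩
  obtain ⟨y, -, rfl⟩ := exists_coe_mem_Ico x
  have := hΛ (y + a) (y + b) (by linarith) fun z hz => by
    have := hr (z - y) ⟨by linarith [hz.1], by linarith [hz.2]⟩
    rwa [← AddCircle.coe_add, add_sub_cancel] at this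
  rw [AddCircle.coe_add, AddCircle.coe_add] at this
  linarith

lemma exists_bound (h : IsPiecewiseSmooth f γ H) : ∃ M : ℝ, ∀ x, |f x| ≤ M := by
  obtain ⟨Λ, h0, hΛ⟩ := exists_lip_bound h
  have hloc : ∀ x ∈ (univ : Set UnitAddCircle), ∃ t ∈ 𝓝[univ] x, ∃ M : ℝ, ∀ y ∈ t, |f y| ≤ M := by
    intro x _
    obtain ⟨ε, hε, hp⟩ := exists_punctured_notMem γ x
    refine ⟨(fun r : ℝ => x + (r : UnitAddCircle)) '' Metric.ball 0 (ε / 2), ?_,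
      |f x| + |f (x + ((ε / 2 : ℝ) : UnitAddCircle))| + |f (x + ((-(ε / 2) : ℝ) : UnitAddCircle))|
        + Λ * ε, ?_⟩
    · rw [nhdsWithin_univ]
      have h1 : IsOpenMap (fun r : ℝ => x + (r : UnitAddCircle)) :=
        (isOpenMap_add_left x).comp isOpenMap_coe_circle
      exact (h1 _ Metric.isOpen_ball).mem_nhds ⟨0, by simpa using by positivity, by simp⟩
    · rintro _ ⟨r, hr, rfl⟩
      rw [Metric.mem_ball, Real.dist_eq, sub_zero, abs_lt] at hr
      have p0 := abs_nonneg (f x)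
      have p1 := abs_nonneg (f (x + ((ε / 2 : ℝ) : UnitAddCircle)))
      have p2 := abs_nonneg (f (x + ((-(ε / 2) : ℝ) : UnitAddCircle)))
      have p3 : 0 ≤ Λ * ε := by positivity
      dsimp only
      rcases lt_trichotomy r 0 with h | h | h
      · have h2 := hΛ x (-(ε / 2)) r hr.1.le fun s hs => by
          refine hp s ?_ ?_
          · rw [abs_lt]; constructor <;> linarith [hs.1, hs.2]
          · linarith [hs.2]
        have h3 := abs_sub_abs_le_abs_sub (f (x + (r : UnitAddCircle)))
          (f (x + ((-(ε / 2) : ℝ) : UnitAddCircle)))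
        have h4 : Λ * (r - -(ε / 2)) ≤ Λ * ε := mul_le_mul_of_nonneg_left (by linarith) h0
        linarith
      · subst h
        simp only [AddCircle.coe_zero, add_zero]
        linarith
      · have h2 := hΛ x r (ε / 2) hr.2.le fun s hs => by
          refine hp s ?_ ?_
          · rw [abs_lt]; constructor <;> linarith [hs.1, hs.2]
          · linarith [hs.1]
        rw [abs_sub_comm] at h2
        have h3 := abs_sub_abs_le_abs_sub (f (x + (r : UnitAddCircle)))
          (f (x + ((ε / 2 : ℝ) : UnitAddCircle)))
        have h4 : Λ * (ε / 2 - r) ≤ Λ * ε := mul_le_mul_of_nonneg_left (by linarith) h0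
        linarith
  have : ∃ M : ℝ, ∀ y ∈ (univ : Set UnitAddCircle), |f y| ≤ M := by
    refine isCompact_univ.induction_on (p := fun s => ∃ M : ℝ, ∀ y ∈ s, |f y| ≤ M) ?_ ?_ ?_ hloc
    · exact ⟨0, by simp⟩
    · rintro s t hst ⟨M, hM⟩
      exact ⟨M, fun y hy => hM y (hst hy)⟩
    · rintro s t ⟨M, hM⟩ ⟨M', hM'⟩
      refine ⟨max M M', fun y hy => ?_⟩
      rcases hy with hy | hy
      · exact (hM y hy).trans (le_max_left _ _)
      · exact (hM' y hy).trans (le_max_right _ _)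
  obtain ⟨M, hM⟩ := this
  exact ⟨M, fun x => hM x (mem_univ x)⟩

lemma IsPiecewiseSmooth.integrable (h : IsPiecewiseSmooth f γ H) : Integrable f := by
  obtain ⟨M, hM⟩ := exists_bound h
  have hfin := finite_range γ
  have hcont : ContinuousOn f (range γ)ᶜ := by
    intro x hx
    obtain ⟨y, -, rfl⟩ := exists_coe_mem_Ico x
    refine ContinuousAt.continuousWithinAt ?_
    have h1 := (h.differentiableAt y hx).continuousAt
    rw [ContinuousAt] at h1 ⊢
    have h2 : map (fun y : ℝ => (y : UnitAddCircle)) (𝓝 y) = 𝓝 (y : UnitAddCircle) :=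
      isOpenMap_coe_circle.map_nhds_eq continuous_coe_circle.continuousAt
    rw [← h2, tendsto_map'_iff]
    exact h1
  have hm := hcont.aestronglyMeasurable (μ := volume) hfin.isClosed.isOpen_compl.measurableSet
  have hna : NullSingletonClass (volume : Measure UnitAddCircle) := ⟨fun x => by
    rw [← Metric.closedBall_zero, AddCircle.volume_closedBall]
    simp⟩
  have hr : (volume : Measure UnitAddCircle).restrict (range γ)ᶜ = volume :=
    Measure.restrict_eq_self_of_ae_mem (hfin.countable.ae_notMem volume)
  rw [hr] at hm
  exact Integrable.of_bound hm M (Eventually.of_forall hM)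

lemma IsPiecewiseSmooth.injective (h : IsPiecewiseSmooth f γ H) : Function.Injective γ :=
  fun i j hij => h.strictMono.injective (by simp [hij])

lemma IsPiecewiseSmooth.exists_jumpRegular (h : IsPiecewiseSmooth f γ H) :
    ∃ Λ, JumpRegular f γ H Λ := by
  obtain ⟨Λ, h0, hΛ⟩ := exists_lip_bound h
  obtain ⟨M, hM⟩ := exists_bound h
  refine ⟨max Λ M, h.injective, h0.trans (le_max_left _ _), fun x => (hM x).trans (le_max_right _ _),
    ?_, ?_, h.integrable, h.integral_zero⟩
  · intro x s hs
    refine le_trans ?_ (mul_le_mul_of_nonneg_right (le_max_left Λ M) (abs_nonneg s))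
    rcases le_total 0 s with h1 | h1
    · have := hΛ x 0 s h1 fun r hr => hs r (by
        rw [abs_of_nonneg hr.1, abs_of_nonneg h1]; exact hr.2)
      simpa [abs_of_nonneg h1] using this
    · have := hΛ x s 0 h1 fun r hr => hs r (by
        rw [abs_of_nonpos hr.2, abs_of_nonpos h1]; exact neg_le_neg hr.1)
      rw [abs_sub_comm]
      simpa [abs_of_nonpos h1] using this
  · intro i u v ℓ hu hv hul hvl hr
    refine le_trans ?_ (mul_le_mul_of_nonneg_right (le_max_left Λ M) (by positivity))
    have hj := h.jump i
    have e1 : ∀ r : ℝ, toCircle (iota (γ i) + r) = γ i + (r : UnitAddCircle) := by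
      intro r
      rw [toCircle_eq, AddCircle.coe_add, coe_iota]
    have e2 : ∀ r : ℝ, toCircle (iota (γ i) - r) = γ i + ((-r : ℝ) : UnitAddCircle) := by
      intro r
      rw [sub_eq_add_neg, e1]
    have hlim := (hj.const_sub (f (γ i + ((-u : ℝ) : UnitAddCircle)) -
      f (γ i + (v : UnitAddCircle)))).abs
    refine le_of_tendsto hlim ?_
    have hev : ∀ᶠ δ : ℝ in 𝓝[>] 0, δ < min u v :=
      nhdsWithin_le_nhds (gt_mem_nhds (lt_min hu hv))
    filter_upwards [hev, self_mem_nhdsWithin] with δ hδ hδ0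
    rw [mem_Ioi] at hδ0
    have hδu := hδ.trans_le (min_le_left _ _)
    have hδv := hδ.trans_le (min_le_right _ _)
    have h1 := hΛ (γ i) (-u) (-δ) (by linarith) fun r hr' => hr r
      (by rw [abs_le]; constructor <;> linarith [hr'.1, hr'.2]) (by linarith [hr'.2])
    have h2 := hΛ (γ i) δ v hδv.le fun r hr' => hr r
      (by rw [abs_le]; constructor <;> linarith [hr'.1, hr'.2]) (by linarith [hr'.1])
    rw [e1, e2]
    have h3 : Λ * (-δ - -u) + Λ * (v - δ) ≤ Λ * (u + v) := by nlinarith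
    rw [abs_le] at *
    constructor <;> linarith [h1.1, h1.2, h2.1, h2.2]

end

lemma coe_natCast_mul (n : ℕ) (a : ℝ) : ((n * a : ℝ) : UnitAddCircle) = n • (a : UnitAddCircle) := by
  rw [← nsmul_eq_mul, AddCircle.coe_nsmul]

lemma coe_eq_coe_iff' {a b : ℝ} : (a : UnitAddCircle) = (b : UnitAddCircle) ↔ ∃ n : ℤ, a - b = n := by
  rw [← sub_eq_zero, ← AddCircle.coe_sub, AddCircle.coe_eq_zero_iff]
  simp [eq_comm]

section Rational

variable {p : ℤ} {q : ℕ}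

lemma nsmul_rational_eq_add (hq : 0 < q) (hpq : IsCoprime p (q : ℤ)) {j j' : ℕ} {s : ℝ}
    (h : j • ((p / q : ℝ) : UnitAddCircle) = j' • ((p / q : ℝ) : UnitAddCircle) + (s : UnitAddCircle))
    (hs : |s| < 1 / q) : s = 0 ∧ (q : ℤ) ∣ (j - j' : ℤ) := by
  have hq' : (0 : ℝ) < q := by exact_mod_cast hq
  rw [← coe_natCast_mul, ← coe_natCast_mul, ← AddCircle.coe_add, coe_eq_coe_iff'] at h
  obtain ⟨n, hn⟩ := h
  have h1 : (((j - j') * p - n * q : ℤ) : ℝ) = s * q := by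
    push_cast
    field_simp at hn
    linarith
  have h2 : |(((j - j') * p - n * q : ℤ) : ℝ)| < 1 := by
    rw [h1, abs_mul, abs_of_pos hq']
    rwa [lt_div_iff₀ hq'] at hs
  have h3 : ((j - j') * p - n * q : ℤ) = 0 := Int.abs_lt_one_iff.1 (by exact_mod_cast h2)
  constructor
  · rw [h3] at h1
    simpa [hq'.ne'] using h1.symm
  · exact hpq.symm.dvd_of_dvd_mul_right ⟨n, by linarith⟩

lemma exists_nsmul_rational_add (hq : 0 < q) (hpq : IsCoprime p (q : ℤ)) (x : UnitAddCircle) :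
    ∃ j < q, ∃ u : ℝ, 0 ≤ u ∧ u < 1 / q ∧
      x = j • ((p / q : ℝ) : UnitAddCircle) + (u : UnitAddCircle) := by
  have hq' : (0 : ℝ) < q := by exact_mod_cast hq
  obtain ⟨y, -, rfl⟩ := exists_coe_mem_Ico x
  set m := ⌊y * q⌋ with hm
  obtain ⟨a, b, hab⟩ := hpq
  have hqz : (q : ℤ) ≠ 0 := by omega
  refine ⟨((a * m) % q).toNat, ?_, y - m / q, ?_, ?_, ?_⟩
  · have := Int.emod_lt_of_pos (a * m) (show (0 : ℤ) < q by omega)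
    have := Int.emod_nonneg (a * m) hqz
    omega
  · rw [sub_nonneg, div_le_iff₀ hq']
    exact Int.floor_le _
  · rw [sub_lt_iff_lt_add, ← add_div, lt_div_iff₀ hq', add_comm]
    exact Int.lt_floor_add_one _
  · rw [← coe_natCast_mul, ← AddCircle.coe_add, coe_eq_coe_iff']
    have h1 : ((((a * m) % q).toNat : ℕ) : ℝ) = (((a * m) % q : ℤ) : ℝ) := by
      have := Int.toNat_of_nonneg (Int.emod_nonneg (a * m) hqz)
      exact_mod_cast this
    have h2 : (a * m) % q = a * m - q * (a * m / q) := by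
      have := Int.emod_add_mul_ediv (a * m) q
      linarith
    refine ⟨m * b + p * (a * m / q), ?_⟩
    rw [h1, h2]
    have h3 : (a * p + b * q : ℝ) = 1 := by exact_mod_cast hab
    push_cast
    field_simp
    linear_combination (-(m : ℝ)) * h3

lemma card_near_le (hq : 0 < q) (hpq : IsCoprime p (q : ℤ)) (z g : UnitAddCircle) :
    ∃ B : Finset ℕ, B.card ≤ 5 ∧ ∀ j < q, ∀ r : ℝ, |r| ≤ 2 / q →
      g = z + j • ((p / q : ℝ) : UnitAddCircle) + (r : UnitAddCircle) → j ∈ B := by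
  classical
  have hq' : (0 : ℝ) < q := by exact_mod_cast hq
  refine ⟨(Finset.range q).filter fun j => ∃ r : ℝ, |r| ≤ 2 / q ∧
    g = z + j • ((p / q : ℝ) : UnitAddCircle) + (r : UnitAddCircle), ?_, ?_⟩
  · set B := (Finset.range q).filter fun j => ∃ r : ℝ, |r| ≤ 2 / q ∧
      g = z + j • ((p / q : ℝ) : UnitAddCircle) + (r : UnitAddCircle) with hB
    have hex : ∀ j : ℕ, ∃ r : ℝ, j ∈ B → |r| ≤ 2 / q ∧
        g = z + j • ((p / q : ℝ) : UnitAddCircle) + (r : UnitAddCircle) := by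
      intro j
      by_cases hj : j ∈ B
      · obtain ⟨r, hr⟩ := (Finset.mem_filter.1 hj).2
        exact ⟨r, fun _ => hr⟩
      · exact ⟨0, fun h => absurd h hj⟩
    choose r hr using hex
    have : B.card ≤ (Finset.Icc (-2 : ℤ) 2).card := by
      refine Finset.card_le_card_of_injOn (fun j => ⌊r j * q⌋) ?_ ?_
      · intro j hj
        have h1 := (hr j hj).1
        rw [le_div_iff₀ hq', ← abs_of_pos hq', ← abs_mul, abs_le] at h1
        rw [Finset.coe_Icc, mem_Icc]
        constructor
        · rw [Int.le_floor]; push_cast; exact h1.1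
        · have : ((⌊r j * q⌋ : ℤ) : ℝ) ≤ (2 : ℤ) := (Int.floor_le _).trans (by push_cast; exact h1.2)
          exact_mod_cast this
      · intro j hj j' hj' hjj
        have h1 : |r j * q - r j' * q| < 1 := Int.abs_sub_lt_one_of_floor_eq_floor hjj
        have h2 : |r j' - r j| < 1 / q := by
          rw [lt_div_iff₀ hq', ← abs_of_pos hq', ← abs_mul, sub_mul, abs_sub_comm]
          exact h1
        have h3 : j • ((p / q : ℝ) : UnitAddCircle) =
            j' • ((p / q : ℝ) : UnitAddCircle) + ((r j' - r j : ℝ) : UnitAddCircle) := by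
          have e := (hr j hj).2.symm.trans (hr j' hj').2
          rw [AddCircle.coe_sub]
          rw [add_assoc, add_assoc, add_right_inj] at e
          rw [← add_sub_assoc, eq_sub_iff_add_eq, e]
        obtain ⟨k, hk⟩ := (nsmul_rational_eq_add hq hpq h3 h2).2
        have l1 := Finset.mem_range.1 (Finset.mem_filter.1 hj).1
        have l2 := Finset.mem_range.1 (Finset.mem_filter.1 hj').1
        have : k = 0 := by
          by_contra hk0
          rcases lt_or_gt_of_ne hk0 with h | h
          · nlinarith
          · nlinarith
        subst this
        omega
    simpa using this
  · intro j hj r hr hg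
    exact Finset.mem_filter.2 ⟨Finset.mem_range.2 hj, r, hr, hg⟩

lemma sum_range_add_of_periodic {g : ℕ → ℝ} (hg : ∀ n, g (n + q) = g n) (i : ℕ) :
    ∑ j ∈ Finset.range q, g (i + j) = ∑ j ∈ Finset.range q, g j := by
  induction i with
  | zero => simp
  | succ i ih =>
    rw [← ih]
    have h1 := Finset.sum_range_succ (fun j => g (i + j)) q
    have h2 := Finset.sum_range_succ' (fun j => g (i + j)) q
    rw [h1] at h2
    simp only [add_zero, hg, add_left_inj] at h2
    rw [h2]
    exact Finset.sum_congr rfl fun j _ => by ring_nf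

end Rational

section DenjoyKoksma

variable {ν : ℕ} {f : UnitAddCircle → ℝ} {γ : Fin ν → UnitAddCircle} {H : Fin ν → ℝ} {Λ : ℝ}
  {p : ℤ} {q : ℕ}

lemma JumpRegular.abs_sum_sub_le (hf : JumpRegular f γ H Λ) (hq : 0 < q)
    (hpq : IsCoprime p (q : ℤ)) (z : UnitAddCircle) (s : ℕ → ℝ) (hs : ∀ j < q, |s j| ≤ 2 / q) :
    |∑ j ∈ Finset.range q, f (z + j • ((p / q : ℝ) : UnitAddCircle) + (s j : UnitAddCircle)) -
      ∑ j ∈ Finset.range q, f (z + j • ((p / q : ℝ) : UnitAddCircle))| ≤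
      2 * Λ + 10 * ν * Λ := by
  classical
  have hq' : (0 : ℝ) < q := by exact_mod_cast hq
  have hΛ := hf.nonneg
  choose B hB hmem using fun i => card_near_le hq hpq z (γ i)
  set D := Finset.univ.biUnion B with hD
  have hDc : D.card ≤ ν * 5 := by
    have := Finset.card_biUnion_le_card_mul Finset.univ B 5 fun i _ => hB i
    simpa using this
  rw [← Finset.sum_sub_distrib]
  refine (Finset.abs_sum_le_sum_abs _ _).trans ?_
  have hterm : ∀ j ∈ Finset.range q,
      |f (z + j • ((p / q : ℝ) : UnitAddCircle) + (s j : UnitAddCircle)) -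
        f (z + j • ((p / q : ℝ) : UnitAddCircle))| ≤
      Λ * (2 / q) + if j ∈ D then 2 * Λ else 0 := by
    intro j hj
    rw [Finset.mem_range] at hj
    split_ifs with h
    · have h1 := abs_sub (f (z + j • ((p / q : ℝ) : UnitAddCircle) + (s j : UnitAddCircle)))
        (f (z + j • ((p / q : ℝ) : UnitAddCircle)))
      have h2 := hf.bound (z + j • ((p / q : ℝ) : UnitAddCircle) + (s j : UnitAddCircle))
      have h3 := hf.bound (z + j • ((p / q : ℝ) : UnitAddCircle))
      have h4 : 0 ≤ Λ * (2 / q) := by positivity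
      linarith
    · rw [add_zero]
      refine (hf.lip _ (s j) fun r hr hmem' => h ?_).trans
        (mul_le_mul_of_nonneg_left (hs j hj) hΛ)
      obtain ⟨i, hi⟩ := hmem'
      exact Finset.mem_biUnion.2 ⟨i, Finset.mem_univ i, hmem i j hj r (hr.trans (hs j hj)) hi⟩
  refine (Finset.sum_le_sum hterm).trans ?_
  rw [Finset.sum_add_distrib, Finset.sum_const, Finset.card_range, nsmul_eq_mul,
    ← Finset.sum_filter, Finset.sum_const, nsmul_eq_mul]
  have h1 : (((Finset.range q).filter (· ∈ D)).card : ℝ) ≤ ν * 5 := by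
    have : ((Finset.range q).filter (· ∈ D)).card ≤ D.card :=
      Finset.card_le_card fun x hx => (Finset.mem_filter.1 hx).2
    exact_mod_cast this.trans hDc
  have h2 := mul_le_mul_of_nonneg_right h1 (show 0 ≤ 2 * Λ by positivity)
  have h3 : (q : ℝ) * (Λ * (2 / q)) = 2 * Λ := by field_simp
  rw [h3]
  linarith

lemma JumpRegular.abs_birkhoff_le (hf : JumpRegular f γ H Λ) (hq : 0 < q)
    (hpq : IsCoprime p (q : ℤ)) {α : ℝ} (hα : |α - p / q| ≤ 1 / (q : ℝ) ^ 2) (x : UnitAddCircle) :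
    |birkhoff f α x q| ≤ 2 * Λ + 10 * ν * Λ := by
  have hq' : (0 : ℝ) < q := by exact_mod_cast hq
  set ρ : UnitAddCircle := ((p / q : ℝ) : UnitAddCircle) with hρ
  set G : UnitAddCircle → ℝ := fun u => ∑ j ∈ Finset.range q, f (u + j • ρ) with hG
  have hper : q • ρ = 0 := by
    rw [hρ, ← coe_natCast_mul, mul_div_cancel₀ _ hq'.ne', AddCircle.coe_eq_zero_iff]
    exact ⟨p, by simp⟩
  have h_int : ∀ j ∈ Finset.range q, Integrable fun u => f (u + j • ρ) := fun j _ =>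
    hf.integrable.comp_add_right (j • ρ)
  have hG0 : ∫ u, G u = 0 := by
    rw [hG, integral_finsetSum _ h_int]
    refine Finset.sum_eq_zero fun j _ => ?_
    rw [integral_add_right_eq_self (fun u => f u) (j • ρ), hf.integral_zero]
  have hGi : Integrable G := integrable_finsetSum _ h_int
  have hclose : ∀ u, |birkhoff f α x q - G u| ≤ 2 * Λ + 10 * ν * Λ := by
    intro u
    obtain ⟨i, -, w, hw0, hw1, hw⟩ := exists_nsmul_rational_add hq hpq (x - u)
    have h1 := hf.abs_sum_sub_le hq hpq (u + i • ρ) (fun j => w + j * (α - p / q)) fun j hj => by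
      have h2 : |(j : ℝ) * (α - p / q)| ≤ 1 / q := by
        rw [abs_mul, Nat.abs_cast]
        calc (j : ℝ) * |α - p / q| ≤ q * (1 / (q : ℝ) ^ 2) := by
              gcongr
          _ = 1 / q := by field_simp
      refine (abs_add_le _ _).trans ?_
      rw [abs_of_nonneg hw0]
      have : (2 : ℝ) / q = 1 / q + 1 / q := by ring
      linarith
    have h3 : ∑ j ∈ Finset.range q, f (u + i • ρ + j • ρ) = G u := by
      rw [hG]
      dsimp only
      have := sum_range_add_of_periodic (q := q) (g := fun n => f (u + n • ρ)) (fun n => by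
        simp only [add_smul, hper, add_zero]) i
      rw [← this]
      refine Finset.sum_congr rfl fun j _ => ?_
      rw [add_smul, add_assoc]
    rw [← hρ] at h1
    rw [h3] at h1
    have h4 : birkhoff f α x q = ∑ j ∈ Finset.range q,
        f (u + i • ρ + j • ρ + ((w + j * (α - p / q) : ℝ) : UnitAddCircle)) := by
      rw [birkhoff]
      refine Finset.sum_congr rfl fun j _ => congrArg f ?_
      have e : x = u + (i • ρ + (w : UnitAddCircle)) := by
        rw [← hw]; abel
      rw [e, AddCircle.coe_add, coe_natCast_mul, AddCircle.coe_sub, smul_sub, ← hρ]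
      abel
    rw [h4]
    exact h1
  have hprob : IsProbabilityMeasure (volume : Measure UnitAddCircle) := ⟨UnitAddCircle.measure_univ⟩
  obtain ⟨u, hu⟩ := exists_le_integral hGi
  obtain ⟨u', hu'⟩ := exists_integral_le hGi
  rw [hG0] at hu hu'
  have h1 := abs_le.1 (hclose u)
  have h2 := abs_le.1 (hclose u')
  rw [abs_le]
  constructor <;> linarith [h1.1, h1.2, h2.1, h2.2]

end DenjoyKoksma

lemma birkhoff_add (f : UnitAddCircle → ℝ) (α x : UnitAddCircle) (a b : ℕ) :
    birkhoff f α x (a + b) = birkhoff f α x a + birkhoff f α (x + a • α) b := by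
  rw [birkhoff, birkhoff, birkhoff, Finset.sum_range_add]
  congr 1
  exact Finset.sum_congr rfl fun k _ => by rw [add_smul, add_assoc]

lemma birkhoff_add_mul (f : UnitAddCircle → ℝ) (α x : UnitAddCircle) (k m q : ℕ) :
    birkhoff f α x ((k + m) * q) = birkhoff f α x (k * q) +
      ∑ i ∈ Finset.range m, birkhoff f α (x + ((k + i) * q) • α) q := by
  induction m with
  | zero => simp
  | succ m ih =>
    rw [Finset.sum_range_succ, ← add_assoc (birkhoff f α x (k * q)), ← ih, ← birkhoff_add]
    congr 1
    ring

section

variable {ν : ℕ} {f : UnitAddCircle → ℝ} {γ : Fin ν → UnitAddCircle} {H : Fin ν → ℝ} {Λ : ℝ}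
  {p : ℤ} {q : ℕ} {α ε : ℝ} {i₀ : Fin ν}

lemma nsmul_coe_eq (hq : 0 < q) (j : ℕ) :
    j • (α : UnitAddCircle) = j • ((p / q : ℝ) : UnitAddCircle) +
      ((j * (q * α - p) / q : ℝ) : UnitAddCircle) := by
  have hq' : (0 : ℝ) < q := by exact_mod_cast hq
  rw [← coe_natCast_mul, ← coe_natCast_mul, ← AddCircle.coe_add]
  congr 1
  field_simp
  ring

lemma mul_nsmul_coe_eq (k : ℕ) :
    (k * q) • (α : UnitAddCircle) = ((k * (q * α - p) : ℝ) : UnitAddCircle) := by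
  rw [← coe_natCast_mul, coe_eq_coe_iff']
  exact ⟨k * p, by push_cast; ring⟩

lemma norm_coe_le (r : ℝ) : ‖(r : UnitAddCircle)‖ ≤ |r| := by
  rw [UnitAddCircle.norm_eq]
  simpa using round_le r 0

lemma near_singularity (hq : 0 < q) (hpq : IsCoprime p (q : ℤ))
    (hε : ∀ i, i ≠ i₀ → ε ≤ ‖q • (γ i₀ - γ i)‖) {j j' : ℕ} (hj : j < q) (hj' : j' < q) {i : Fin ν}
    {w : ℝ} (hw : |w| + |q * α - p| < min ε 1 / q)
    (h : γ i + j • (α : UnitAddCircle) = γ i₀ + j' • (α : UnitAddCircle) + (w : UnitAddCircle)) :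
    i = i₀ ∧ j = j' ∧ w = 0 := by
  have hq' : (0 : ℝ) < q := by exact_mod_cast hq
  set ρ : UnitAddCircle := ((p / q : ℝ) : UnitAddCircle) with hρ
  set w' : ℝ := w + ((j' : ℝ) - j) / q * (q * α - p) with hw'
  have h1 : γ i + j • ρ = γ i₀ + j' • ρ + (w' : UnitAddCircle) := by
    rw [nsmul_coe_eq (p := p) hq j, nsmul_coe_eq (p := p) hq j', ← hρ] at h
    have e : w' = w + j' * (q * α - p) / q - j * (q * α - p) / q := by rw [hw']; ring
    rw [e, AddCircle.coe_sub, AddCircle.coe_add]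
    rw [← add_assoc, ← eq_sub_iff_add_eq] at h
    rw [h]
    abel
  have hbd : |w'| < min ε 1 / q := by
    refine lt_of_le_of_lt ((abs_add_le _ _).trans ?_) hw
    rw [abs_mul]
    have : |((j' : ℝ) - j) / q| ≤ 1 := by
      rw [abs_div, abs_of_pos hq', div_le_one hq']
      have a1 : (j : ℝ) < q := by exact_mod_cast hj
      have a2 : (j' : ℝ) < q := by exact_mod_cast hj'
      have a3 : (0 : ℝ) ≤ j := Nat.cast_nonneg _
      have a4 : (0 : ℝ) ≤ j' := Nat.cast_nonneg _
      rw [abs_le]; constructor <;> linarith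
    have := mul_le_mul_of_nonneg_right this (abs_nonneg (q * α - p))
    linarith
  have hper : q • ρ = 0 := by
    rw [hρ, ← coe_natCast_mul, mul_div_cancel₀ _ hq'.ne', AddCircle.coe_eq_zero_iff]
    exact ⟨p, by simp⟩
  have hi : i = i₀ := by
    by_contra hne
    have h2 : q • (γ i₀ - γ i) = ((q * (-w') : ℝ) : UnitAddCircle) := by
      rw [coe_natCast_mul, AddCircle.coe_neg]
      have : γ i₀ - γ i = j • ρ - j' • ρ - (w' : UnitAddCircle) := by
        rw [← eq_sub_iff_add_eq] at h1
        rw [h1]; abel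
      rw [this, smul_sub, smul_sub, smul_comm q j, smul_comm q j', hper]
      simp
    have h3 := hε i hne
    rw [h2] at h3
    have h4 := h3.trans (norm_coe_le _)
    rw [abs_mul, abs_neg, abs_of_pos hq'] at h4
    have h5 := (lt_div_iff₀ hq').1 hbd
    linarith [min_le_left ε 1]
  subst hi
  rw [add_assoc, add_right_inj] at h1
  have h6 := nsmul_rational_eq_add hq hpq h1
    (hbd.trans_le (div_le_div_of_nonneg_right (min_le_right _ _) hq'.le))
  have hjj : j = j' := by
    obtain ⟨k, hk⟩ := h6.2
    have : k = 0 := by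
      by_contra hk0
      rcases lt_or_gt_of_ne hk0 with h | h <;> nlinarith
    subst this
    omega
  refine ⟨rfl, hjj, ?_⟩
  have := h6.1
  rw [hw', hjj] at this
  simpa using this

lemma JumpRegular.abs_crossing_sub_le (hf : JumpRegular f γ H Λ) {d u v ℓ : ℝ} (hd : d ≠ 0)
    (hu : 0 < u) (hv : 0 < v) (hul : u * |d| ≤ ℓ) (hvl : v * |d| ≤ ℓ)
    (hr : ∀ r : ℝ, |r| ≤ ℓ → r ≠ 0 → γ i₀ + (r : UnitAddCircle) ∉ range γ) :
    |f (γ i₀ + ((v * d : ℝ) : UnitAddCircle)) - f (γ i₀ + ((-u * d : ℝ) : UnitAddCircle)) +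
      SignType.sign d * H i₀| ≤ Λ * (2 * ℓ) := by
  have hd' := abs_pos.2 hd
  have hΛ := hf.nonneg
  rcases lt_or_gt_of_ne hd with h | h
  · have := hf.jump i₀ (v * |d|) (u * |d|) ℓ (by positivity) (by positivity) hvl hul hr
    rw [sign_neg h]
    rw [abs_of_neg h] at *
    simp only [SignType.coe_neg_one, neg_mul, one_mul]
    have e1 : -(v * -d) = v * d := by ring
    have e2 : u * -d = -(u * d) := by ring
    rw [e1, e2] at this
    rw [← sub_eq_add_neg]
    exact this.trans (mul_le_mul_of_nonneg_left (by linarith) hΛ)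
  · have := hf.jump i₀ (u * |d|) (v * |d|) ℓ (by positivity) (by positivity) hul hvl hr
    rw [sign_pos h]
    rw [abs_of_pos h] at *
    simp only [SignType.coe_one, neg_mul, one_mul]
    rw [← abs_neg]
    refine le_trans (le_of_eq ?_) (this.trans (mul_le_mul_of_nonneg_left (by linarith) hΛ))
    congr 1
    ring

lemma JumpRegular.abs_birkhoff_sub_add_le (hf : JumpRegular f γ H Λ) (hq : 0 < q)
    (hpq : IsCoprime p (q : ℤ)) (hε : ∀ i, i ≠ i₀ → ε ≤ ‖q • (γ i₀ - γ i)‖)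
    (hd : q * α - p ≠ 0) {x₀ : UnitAddCircle} {j : ℕ} (hj : j < q) {τ ℓ : ℝ}
    (hγ : γ i₀ = x₀ + j • (α : UnitAddCircle) + ((τ * (q * α - p) : ℝ) : UnitAddCircle))
    (hℓ : 2 * ℓ + |q * α - p| < min ε 1 / q) {k k' : ℕ} (hk : τ < k) (hk' : (k' : ℝ) < τ)
    (hkl : (k - k' : ℝ) * |q * α - p| ≤ ℓ) :
    |birkhoff f α (x₀ + (k * q) • (α : UnitAddCircle)) q -
      birkhoff f α (x₀ + (k' * q) • (α : UnitAddCircle)) q +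
        SignType.sign (q * α - p) * H i₀| ≤ Λ * ((q + 2) * ℓ) := by
  have hq' : (0 : ℝ) < q := by exact_mod_cast hq
  have hΛ := hf.nonneg
  set d : ℝ := q * α - p with hddef
  have hd' := abs_pos.2 hd
  have hy : ∀ (n : ℕ) (j' : ℕ), x₀ + (n * q) • (α : UnitAddCircle) + j' • (α : UnitAddCircle) +
      j • (α : UnitAddCircle) = γ i₀ + j' • (α : UnitAddCircle) +
        (((n - τ) * d : ℝ) : UnitAddCircle) := by
    intro n j'
    rw [hγ, mul_nsmul_coe_eq (p := p), ← hddef, sub_mul, AddCircle.coe_sub]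
    abel
  have hyj : ∀ n : ℕ, x₀ + (n * q) • (α : UnitAddCircle) + j • (α : UnitAddCircle) =
      γ i₀ + (((n - τ) * d : ℝ) : UnitAddCircle) := by
    intro n
    have := hy n j
    rw [add_right_comm (γ i₀)] at this
    exact add_right_cancel this
  have hul : (τ - k') * |d| ≤ ℓ := le_trans (by gcongr) hkl
  have hvl : (k - τ) * |d| ≤ ℓ := le_trans (by gcongr) hkl
  have hℓ0 : 0 ≤ ℓ := le_trans (by have := sub_pos.2 hk; positivity) hvl
  rw [birkhoff, birkhoff, ← Finset.sum_sub_distrib,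
    ← Finset.sum_erase_add _ _ (Finset.mem_range.2 hj), add_assoc]
  have hmain := hf.abs_crossing_sub_le (i₀ := i₀) hd (sub_pos.2 hk') (sub_pos.2 hk) hul hvl
    fun r hr hr0 hmem => by
      obtain ⟨i, hi⟩ := hmem
      refine hr0 (near_singularity (α := α) (w := r) hq hpq hε hj hj ?_ (i := i) ?_).2.2
      · rw [← hddef]; linarith
      · rw [hi]; abel
  have hother : |∑ x ∈ (Finset.range q).erase j,
      (f (x₀ + (k * q) • (α : UnitAddCircle) + x • (α : UnitAddCircle)) -
        f (x₀ + (k' * q) • (α : UnitAddCircle) + x • (α : UnitAddCircle)))| ≤ q * (Λ * ℓ) := by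
    refine (Finset.abs_sum_le_sum_abs _ _).trans ?_
    have : ∀ x ∈ (Finset.range q).erase j,
        |f (x₀ + (k * q) • (α : UnitAddCircle) + x • (α : UnitAddCircle)) -
        f (x₀ + (k' * q) • (α : UnitAddCircle) + x • (α : UnitAddCircle))| ≤ Λ * ℓ := by
      intro x hx
      rw [Finset.mem_erase, Finset.mem_range] at hx
      have e : x₀ + (k * q) • (α : UnitAddCircle) + x • (α : UnitAddCircle) =
          x₀ + (k' * q) • (α : UnitAddCircle) + x • (α : UnitAddCircle) +
            (((k - k') * d : ℝ) : UnitAddCircle) := by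
        have h1 := hy k x
        have h2 := hy k' x
        have e2 : (k - k') * d = (k - τ) * d - (k' - τ) * d := by ring
        rw [← add_left_inj (j • (α : UnitAddCircle)), h1,
          add_right_comm _ (((k - k') * d : ℝ) : UnitAddCircle), h2, e2, AddCircle.coe_sub]
        abel
      have habs : |(k - k') * d| ≤ ℓ := by
        rw [abs_mul, abs_of_pos (by linarith)]
        exact hkl
      rw [e]
      refine (hf.lip _ _ fun r hr hmem => ?_).trans (mul_le_mul_of_nonneg_left habs hΛ)
      obtain ⟨i, hi⟩ := hmem
      refine hx.1 (near_singularity (α := α) (w := (k' - τ) * d + r) hq hpq hε hj hx.2 ?_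
        (i := i) ?_).2.1.symm
      · rw [← hddef]
        have h1 : |(k' - τ) * d| ≤ ℓ := by
          rw [abs_mul, abs_of_neg (by linarith), neg_sub]
          exact hul
        have h2 := abs_add_le ((k' - τ) * d) r
        linarith
      · rw [hi, add_right_comm, hy, AddCircle.coe_add]
        abel
    refine (Finset.sum_le_sum this).trans ?_
    rw [Finset.sum_const, nsmul_eq_mul]
    refine mul_le_mul_of_nonneg_right ?_ (by positivity)
    have : ((Finset.range q).erase j).card ≤ q := by
      simpa using Finset.card_erase_le (s := Finset.range q) (a := j)
    exact_mod_cast this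
  rw [neg_sub] at hmain
  rw [hyj, hyj] at *
  refine (abs_add_le _ _).trans ((add_le_add hother hmain).trans (le_of_eq ?_))
  ring

end

lemma not_differentiableAt_of_second_difference {Z : ℝ → ℝ} {s c κ : ℝ} (hc : 0 < c)
    (hκ : 0 < κ) (h : ∀ r, 0 < r → r < κ → c * r ≤ |Z (s + r) - 2 * Z s + Z (s - r)|) :
    ¬ DifferentiableAt ℝ Z s := by
  intro hd
  have hd' := hd.hasDerivAt.isLittleO
  have h1 := (hd'.def (show (0 : ℝ) < c / 4 by positivity))
  rw [Metric.eventually_nhds_iff] at h1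
  obtain ⟨ε, hε, h1⟩ := h1
  set r := min ε κ / 2 with hr
  have hm : 0 < min ε κ := lt_min hε hκ
  have hr0 : 0 < r := by positivity
  have hrε : r < ε := by have := min_le_left ε κ; linarith
  have hrκ : r < κ := by have := min_le_right ε κ; linarith
  have a1 := h1 (y := s + r) (by rw [Real.dist_eq, add_sub_cancel_left, abs_of_pos hr0]; exact hrε)
  have a2 := h1 (y := s - r) (by
    rw [Real.dist_eq, sub_sub_cancel_left, abs_neg, abs_of_pos hr0]; exact hrε)
  have a3 := h r hr0 hrκ
  simp only [add_sub_cancel_left, sub_sub_cancel_left, Real.norm_eq_abs, abs_neg, abs_of_pos hr0,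
    smul_eq_mul] at a1 a2
  have e : Z (s + r) - 2 * Z s + Z (s - r) =
      (Z (s + r) - Z s - r * deriv Z s) + (Z (s - r) - Z s - -r * deriv Z s) := by ring
  rw [e] at a3
  have := (a3.trans (abs_add_le _ _)).trans (add_le_add a1 a2)
  nlinarith

lemma abs_birkhoff_sub_le {f : UnitAddCircle → ℝ} {α x : UnitAddCircle} {q : ℕ} (hq : 0 < q)
    {C b : ℝ} (hC : ∀ y, |birkhoff f α y q| ≤ C) (hb : ∀ r < q, ∀ y, |birkhoff f α y r| ≤ b)
    {N N' : ℕ} (hN : N ≤ N') :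
    |birkhoff f α x N' - birkhoff f α x N| ≤ C * ((N' - N : ℝ) / q) + b := by
  have hq' : (0 : ℝ) < q := by exact_mod_cast hq
  have hC0 : 0 ≤ C := (abs_nonneg _).trans (hC 0)
  obtain ⟨D, rfl⟩ := Nat.exists_eq_add_of_le hN
  have h1 : ∀ y, birkhoff f α y D = ∑ i ∈ Finset.range (D / q),
      birkhoff f α (y + ((0 + i) * q) • α) q + birkhoff f α (y + (D / q * q) • α) (D % q) := by
    intro y
    have h2 := birkhoff_add_mul f α y 0 (D / q) q
    have h0 : birkhoff f α y (0 * q) = 0 := by simp [birkhoff]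
    rw [h0, zero_add, zero_add] at h2
    rw [← h2, ← birkhoff_add]
    congr 1
    rw [mul_comm]
    exact (Nat.div_add_mod D q).symm
  rw [birkhoff_add, add_sub_cancel_left, h1]
  refine (abs_add_le _ _).trans (add_le_add ?_ (hb _ (Nat.mod_lt _ hq) _))
  refine (Finset.abs_sum_le_sum_abs _ _).trans ((Finset.sum_le_sum fun i _ => hC _).trans ?_)
  rw [Finset.sum_const, Finset.card_range, nsmul_eq_mul, mul_comm]
  refine mul_le_mul_of_nonneg_left ?_ hC0
  push_cast
  rw [add_sub_cancel_left]
  exact Nat.cast_div_le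

/-- `α` has a denominator `q` with an approximation error beating all Birkhoff sums up to time `q`
by the factor `K`, and which keeps the other singularities away from `γ i₀`. -/
def GoodScale {ν : ℕ} (f : UnitAddCircle → ℝ) (γ : Fin ν → UnitAddCircle) (i₀ : Fin ν)
    (α ε : ℝ) (K : ℕ) : Prop :=
  ∃ (p : ℤ) (q : ℕ), 0 < q ∧ IsCoprime p (q : ℤ) ∧ q * α - p ≠ 0 ∧
    K * (q * |q * α - p|) ≤ 1 ∧
    (∀ r < q, ∀ x, K * |birkhoff f α x r| * (q * |q * α - p|) ≤ 1) ∧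
    ∀ i, i ≠ i₀ → ε ≤ ‖q • (γ i₀ - γ i)‖

section

variable {ν : ℕ} {f : UnitAddCircle → ℝ} {γ : Fin ν → UnitAddCircle} {H : Fin ν → ℝ} {Λ : ℝ}
  {p : ℤ} {q : ℕ} {α ε : ℝ} {i₀ : Fin ν}

lemma JumpRegular.abs_second_difference_le (hf : JumpRegular f γ H Λ) (hq : 0 < q)
    (hpq : IsCoprime p (q : ℤ)) (hε : ∀ i, i ≠ i₀ → ε ≤ ‖q • (γ i₀ - γ i)‖)
    (hd : q * α - p ≠ 0) {x₀ : UnitAddCircle} {j : ℕ} (hj : j < q) {τ : ℝ}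
    (hγ : γ i₀ = x₀ + j • (α : UnitAddCircle) + ((τ * (q * α - p) : ℝ) : UnitAddCircle))
    {k m : ℕ} (hk : (k : ℝ) ≤ τ) (hk' : τ < k + 1) (hmk : m ≤ k)
    (hℓ : 2 * ((m + 1) * |q * α - p|) + |q * α - p| < min ε 1 / q) :
    |birkhoff f α x₀ ((k + 1 + m) * q) - birkhoff f α x₀ ((k + 1) * q) -
      birkhoff f α x₀ (k * q) + birkhoff f α x₀ ((k - m) * q) +
        m * (SignType.sign (q * α - p) * H i₀)| ≤
      m * (Λ * ((q + 2) * ((m + 1) * |q * α - p|))) := by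
  have h1 := birkhoff_add_mul f α x₀ (k + 1) m q
  have h2 := birkhoff_add_mul f α x₀ (k - m) m q
  rw [Nat.sub_add_cancel hmk] at h2
  have h3 : (m : ℝ) * (SignType.sign (q * α - p) * H i₀) =
      ∑ i ∈ Finset.range m, (SignType.sign (q * α - p) * H i₀) := by
    rw [Finset.sum_const, Finset.card_range, nsmul_eq_mul]
  have h4 : birkhoff f α x₀ ((k + 1 + m) * q) - birkhoff f α x₀ ((k + 1) * q) -
      birkhoff f α x₀ (k * q) + birkhoff f α x₀ ((k - m) * q) +
        m * (SignType.sign (q * α - p) * H i₀) = ∑ i ∈ Finset.range m,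
      (birkhoff f α (x₀ + ((k + 1 + i) * q) • (α : UnitAddCircle)) q -
        birkhoff f α (x₀ + ((k - m + i) * q) • (α : UnitAddCircle)) q +
          SignType.sign (q * α - p) * H i₀) := by
    rw [Finset.sum_add_distrib, Finset.sum_sub_distrib, ← h3, h1, h2]
    ring
  rw [h4]
  refine (Finset.abs_sum_le_sum_abs _ _).trans ?_
  have h5 : ∀ i ∈ Finset.range m,
      |birkhoff f α (x₀ + ((k + 1 + i) * q) • (α : UnitAddCircle)) q -
        birkhoff f α (x₀ + ((k - m + i) * q) • (α : UnitAddCircle)) q +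
          SignType.sign (q * α - p) * H i₀| ≤ Λ * ((q + 2) * ((m + 1) * |q * α - p|)) := by
    intro i hi
    have him := Finset.mem_range.1 hi
    refine hf.abs_birkhoff_sub_add_le hq hpq hε hd hj hγ hℓ ?_ ?_ ?_
    · push_cast
      have : (0 : ℝ) ≤ i := Nat.cast_nonneg _
      linarith
    · rw [Nat.cast_add, Nat.cast_sub hmk]
      have : (i : ℝ) < m := by exact_mod_cast him
      linarith
    · rw [Nat.cast_add (k - m), Nat.cast_sub hmk]
      push_cast
      refine le_of_eq ?_
      ring
  refine (Finset.sum_le_sum h5).trans (le_of_eq ?_)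
  rw [Finset.sum_const, Finset.card_range, nsmul_eq_mul]

lemma exists_hitting_time (hq : 0 < q) (hpq : IsCoprime p (q : ℤ)) (hd : q * α - p ≠ 0)
    (hT : 2 * (q * |q * α - p|) ≤ 1) (g x₀ : UnitAddCircle) :
    ∃ j < q, ∃ s : ℝ, 1 / 2 ≤ s ∧ s ≤ 3 ∧ g = x₀ + j • (α : UnitAddCircle) +
      ((s * (1 / (q * |q * α - p|)) * (q * α - p) : ℝ) : UnitAddCircle) := by
  have hq' : (0 : ℝ) < q := by exact_mod_cast hq
  set d : ℝ := q * α - p with hddef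
  have hd' := abs_pos.2 hd
  obtain ⟨σ, hσ, hσ1⟩ : ∃ σ : ℝ, d = σ * |d| ∧ |σ| = 1 := by
    rcases lt_or_gt_of_ne hd with h | h
    · exact ⟨-1, by rw [abs_of_neg h]; ring, by simp⟩
    · exact ⟨1, by rw [abs_of_pos h]; ring, by simp⟩
  have hσ2 : σ * σ = 1 := by rw [← abs_mul_abs_self, hσ1, one_mul]
  obtain ⟨j, hj, u, hu0, hu1, hu⟩ := exists_nsmul_rational_add hq hpq
    (g - x₀ - ((2 * σ / q : ℝ) : UnitAddCircle))
  have hjq : (j : ℝ) < q := by exact_mod_cast hj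
  have hj0 : (0 : ℝ) ≤ j := Nat.cast_nonneg _
  have hjd : j * |d| ≤ 1 / 2 := by
    have := mul_le_mul_of_nonneg_right hjq.le hd'.le
    linarith
  have hσu : |σ * (q * u)| ≤ 1 := by
    rw [abs_mul, hσ1, one_mul, abs_of_nonneg (by positivity), mul_comm]
    exact ((lt_div_iff₀ hq').1 hu1).le
  rw [abs_le] at hσu
  have hjd0 : 0 ≤ j * |d| := by positivity
  refine ⟨j, hj, 2 + σ * (q * u) - j * |d|, by linarith, by linarith, ?_⟩
  have e : (2 + σ * (q * u) - j * |d|) * (1 / (q * |d|)) * d = 2 * σ / q + u - j * d / q := by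
    have h1 : (1 / (q * |d|)) * d = σ / q := by
      rw [hσ, abs_mul, hσ1, one_mul, abs_abs]
      field_simp
    rw [mul_assoc, h1]
    have h2 : (j : ℝ) * d = j * (σ * |d|) := by rw [← hσ]
    rw [h2]
    field_simp
    linear_combination (q * u) * hσ2
  rw [e, nsmul_coe_eq (p := p) hq, ← hddef, AddCircle.coe_sub, AddCircle.coe_add]
  rw [sub_sub, sub_eq_iff_eq_add] at hu
  rw [hu]
  abel

theorem JumpRegular.not_satisfiesTDLT (hf : JumpRegular f γ H Λ) (hH : H i₀ ≠ 0) (hε : 0 < ε)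
    (hgood : ∀ K : ℕ, GoodScale f γ i₀ α ε K) (x₀ : UnitAddCircle) :
    ¬ SatisfiesTDLT f α x₀ := by
  classical
  rintro ⟨A, B, Ω, mΩ, P, Y, hB, -, hP, hY, hYne, hlim⟩
  choose p q hq hpq hd hK hb hsep using fun n : ℕ => hgood (n + 2)
  have hΛ := hf.nonneg
  have hq' : ∀ n, (0 : ℝ) < q n := fun n => by exact_mod_cast hq n
  have hq1 : ∀ n, (1 : ℝ) ≤ q n := fun n => by exact_mod_cast hq n
  set d : ℕ → ℝ := fun n => q n * α - p n with hddef
  have hd' : ∀ n, 0 < |d n| := fun n => abs_pos.2 (hd n)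
  set T : ℕ → ℝ := fun n => 1 / (q n * |d n|) with hTdef
  set L : ℕ → ℝ := fun n => T n * q n with hLdef
  have hT0 : ∀ n, 0 < T n := fun n => by have := hd' n; have := hq' n; positivity
  have hTd : ∀ n, T n * |d n| = 1 / q n := fun n => by
    have := (hd' n).ne'; have := (hq' n).ne'
    rw [hTdef]; dsimp only; field_simp
  have hTK : ∀ n : ℕ, (n : ℝ) + 2 ≤ T n := fun n => by
    rw [hTdef]
    dsimp only
    rw [le_div_iff₀ (by have := hd' n; have := hq' n; positivity)]
    have := hK n
    push_cast at this
    exact this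
  have hL0 : ∀ n, 0 < L n := fun n => mul_pos (hT0 n) (hq' n)
  have hTL : ∀ n, T n ≤ L n := fun n => le_mul_of_one_le_right (hT0 n).le (hq1 n)
  set U : Ultrafilter ℕ := hyperfilter ℕ with hUdef
  have hU : (U : Filter ℕ) ≤ atTop := Nat.cofinite_eq_atTop ▸ hyperfilter_le_cofinite
  have hTtop : Tendsto T U atTop := by
    refine Tendsto.mono_left (tendsto_atTop_mono (fun n => ?_) tendsto_natCast_atTop_atTop) hU
    linarith [hTK n]
  have hLtop : Tendsto L U atTop := tendsto_atTop_mono hTL hTtop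
  set C₀ : ℝ := 2 * Λ + 10 * ν * Λ with hC₀
  have hC₀0 : 0 ≤ C₀ := by positivity
  set C : NNReal := ⟨C₀, hC₀0⟩ with hCdef
  have hCC : (C : ℝ) = C₀ := rfl
  set e : ℕ → ℝ := fun n => (C₀ + 1) / (n + 2) with hedef
  have he : Tendsto e U (𝓝 0) := by
    refine Tendsto.mono_left ?_ hU
    exact (tendsto_const_nhds.div_atTop
      (tendsto_natCast_atTop_atTop.atTop_add tendsto_const_nhds))
  set S : ℕ → ℝ := fun N => birkhoff f α x₀ N with hSdef
  have hS0 : S 0 = 0 := by simp [hSdef, birkhoff]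
  have hDK : ∀ n y, |birkhoff f α y (q n)| ≤ C₀ := fun n y => by
    refine hf.abs_birkhoff_le (hq n) (hpq n) ?_ y
    have h1 : α - p n / q n = d n / q n := by
      have := (hq' n).ne'
      rw [hddef]; field_simp
    rw [h1, abs_div, abs_of_pos (hq' n), div_le_div_iff₀ (hq' n) (by have := hq' n; positivity)]
    have h2 : q n * |d n| ≤ 1 := by
      have h3 := hTK n
      have h4 : (1 : ℝ) ≤ T n := by have : (0 : ℝ) ≤ n := Nat.cast_nonneg _
                                    linarith
      have h5 := hTd n
      have h6 := mul_le_mul_of_nonneg_right h4 (hd' n).le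
      rw [h5, one_mul, le_div_iff₀ (hq' n)] at h6
      linarith
    have := mul_le_mul_of_nonneg_right h2 (hq' n).le
    nlinarith
  have hS : ∀ n s s', s ≤ s' →
      |S ⌊s' * L n⌋₊ / T n - S ⌊s * L n⌋₊ / T n| ≤ C * (s' - s) + e n := by
    intro n s s' hss
    have hbn : ∀ r < q n, ∀ y, |birkhoff f α y r| ≤ T n / (n + 2) := by
      intro r hr y
      have := hb n r hr y
      push_cast at this
      rw [hTdef]
      have h1 := hd' n
      have h2 := hq' n
      rw [div_div, le_div_iff₀ (by positivity)]
      rw [hddef] at h1 ⊢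
      dsimp only at *
      linarith
    have hfl : ⌊s * L n⌋₊ ≤ ⌊s' * L n⌋₊ :=
      Nat.floor_le_floor (mul_le_mul_of_nonneg_right hss (hL0 n).le)
    have h1 := abs_birkhoff_sub_le (x := x₀) (hq n) (hDK n) hbn hfl
    have h2 : (⌊s' * L n⌋₊ : ℝ) - ⌊s * L n⌋₊ ≤ (s' - s) * L n + 1 := by
      have h3 : s * L n < ⌊s * L n⌋₊ + 1 := Nat.lt_floor_add_one _
      have h4 : (0 : ℝ) ≤ ⌊s * L n⌋₊ := Nat.cast_nonneg _
      rcases le_total 0 (s' * L n) with h5 | h5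
      · have := Nat.floor_le h5
        linarith
      · rw [Nat.floor_of_nonpos h5]
        have : 0 ≤ (s' - s) * L n := mul_nonneg (sub_nonneg.2 hss) (hL0 n).le
        push_cast
        linarith
    rw [← sub_div, abs_div, abs_of_pos (hT0 n), div_le_iff₀ (hT0 n)]
    refine h1.trans ?_
    have h3 : ((⌊s' * L n⌋₊ : ℝ) - ⌊s * L n⌋₊) / q n ≤ (s' - s) * T n + 1 := by
      rw [div_le_iff₀ (hq' n)]
      refine h2.trans ?_
      rw [hLdef]
      nlinarith [hq1 n]
    have h4 := mul_le_mul_of_nonneg_left h3 hC₀0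
    have h5 : C₀ ≤ C₀ * (T n / (n + 2)) := by
      have : 1 ≤ T n / ((n : ℝ) + 2) := by
        rw [le_div_iff₀ (by positivity), one_mul]; exact hTK n
      nlinarith
    have h6 : (C * (s' - s) + e n) * T n =
        C₀ * ((s' - s) * T n) + C₀ * (T n / (n + 2)) + T n / (n + 2) := by
      rw [hedef, hCC]
      field_simp
      ring
    rw [h6]
    linarith
  have hex : ∀ s, ∃ z, Tendsto (fun n => S ⌊s * L n⌋₊ / T n) U (𝓝 z) := by
    intro s
    refine Ultrafilter.exists_tendsto_of_bounded (a := -(C₀ * |s| + (C₀ + 1)))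
      (b := C₀ * |s| + (C₀ + 1)) (Eventually.of_forall fun n => ?_)
    rw [mem_Icc, ← abs_le]
    have he1 : e n ≤ C₀ + 1 := div_le_self (by positivity) (by
      have : (0 : ℝ) ≤ n := Nat.cast_nonneg _
      linarith)
    rcases le_total 0 s with h | h
    · have := hS n 0 s h
      rw [zero_mul, Nat.floor_zero, hS0, zero_div, sub_zero, sub_zero, hCC] at this
      rw [abs_of_nonneg h]
      linarith
    · have := hS n s 0 h
      rw [zero_mul, Nat.floor_zero, hS0, zero_div, zero_sub, abs_neg, zero_sub, hCC] at this
      rw [abs_of_nonpos h]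
      linarith
  choose Z hZ using hex
  have hZ0 : Z 0 = 0 := by
    refine tendsto_nhds_unique (hZ 0) ?_
    simp only [zero_mul, Nat.floor_zero, hS0, zero_div]
    exact tendsto_const_nhds
  have hlip := lipschitzWith_of_limit he hS hZ
  have hmove : ∀ (x : ℕ → ℝ) (y : ℝ), Tendsto x U (𝓝 y) →
      Tendsto (fun n => S ⌊x n * L n⌋₊ / T n) U (𝓝 (Z y)) := by
    intro x y hxy
    have h1 : Tendsto (fun n => S ⌊x n * L n⌋₊ / T n - S ⌊y * L n⌋₊ / T n) U (𝓝 0) := by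
      refine squeeze_zero_norm (a := fun n => C * |x n - y| + e n) (fun n => ?_) ?_
      · rw [Real.norm_eq_abs]
        rcases le_total y (x n) with h | h
        · rw [abs_of_nonneg (sub_nonneg.2 h)]
          exact hS n _ _ h
        · rw [abs_of_nonpos (sub_nonpos.2 h), abs_sub_comm, neg_sub]
          exact hS n _ _ h
      · have h2 : Tendsto (fun n => |x n - y|) U (𝓝 0) := by
          have := (hxy.sub_const y).abs
          simpa using this
        simpa using (h2.const_mul (C : ℝ)).add he
    simpa using h1.add (hZ y)
  have hocc : ∀ {b : ℝ}, 0 < b → (∃ s, 0 ≤ s ∧ Z s ≠ 0) → DifferentiableAt ℝ Z b := by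
    intro b hb' hne
    obtain ⟨a₀, ha₀⟩ := exists_cdf_mem_Ioo hY hYne
    refine differentiableAt_of_occ_type hlip hZ0 (G := fun a => (P {ω | Y ω ≤ a}).toReal) ha₀
      (fun t ht htne => ?_) hne hb'
    exact exists_occ_type hT0 hL0 hLtop he hS hZ hZ0 (isDistribution_of_measurable hY) ha₀ hB
      (fun a M N => (birkhoff f α x₀ N - A M) / B M ≤ a) (fun a M N => Iff.rfl) hlim ht htne
  choose j hj s hs1 hs2 hs using fun n => exists_hitting_time (hq n) (hpq n) (hd n)
    (by
      have h1 := hK n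
      have h2 : 0 ≤ (n : ℝ) * (q n * |d n|) := by positivity
      push_cast at h1
      rw [hddef] at h2
      dsimp only at h2
      linarith) (γ i₀) x₀
  obtain ⟨s', hs'⟩ : ∃ s', Tendsto s U (𝓝 s') := Ultrafilter.exists_tendsto_of_bounded
    (Eventually.of_forall fun n => ⟨hs1 n, hs2 n⟩)
  have hs'1 : 1 / 2 ≤ s' := ge_of_tendsto' hs' hs1
  have hinv : Tendsto (fun n => 1 / T n) U (𝓝 0) := by
    simpa [Function.comp_def] using tendsto_inv_atTop_zero.comp hTtop
  have hfloor : ∀ (x : ℕ → ℝ) (y : ℝ), (∀ n, 0 ≤ x n) → Tendsto x U (𝓝 y) →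
      Tendsto (fun n => (⌊x n * T n⌋₊ : ℝ) / T n) U (𝓝 y) := by
    intro x y hx hxy
    have h1 : Tendsto (fun n => x n - 1 / T n) U (𝓝 y) := by simpa using hxy.sub hinv
    refine tendsto_of_tendsto_of_tendsto_of_le_of_le h1 hxy (fun n => ?_) fun n => ?_
    · have := Nat.lt_floor_add_one (x n * T n)
      dsimp only
      rw [sub_le_iff_le_add, ← add_div, le_div_iff₀ (hT0 n)]
      exact this.le
    · dsimp only
      rw [div_le_iff₀ (hT0 n)]
      exact Nat.floor_le (mul_nonneg (hx n) (hT0 n).le)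
  have hmult : ∀ n (k : ℕ), S ⌊((k : ℝ) / T n) * L n⌋₊ = S (k * q n) := by
    intro n k
    have : ((k : ℝ) / T n) * L n = ((k * q n : ℕ) : ℝ) := by
      have := (hT0 n).ne'
      rw [hLdef]; push_cast; field_simp
    rw [this, Nat.floor_natCast]
  have hsecond : ∀ h, 0 < h → h ≤ 1 / 2 → 5 * h < min ε 1 →
      h * (|H i₀| - 6 * Λ * h) ≤ |Z (s' + h) - 2 * Z s' + Z (s' - h)| := by
    intro h h0 h12 h5
    set k : ℕ → ℕ := fun n => ⌊s n * T n⌋₊ with hk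
    set m : ℕ → ℕ := fun n => ⌊h * T n⌋₊ with hm
    have hs0 : ∀ n, 0 ≤ s n := fun n => by linarith [hs1 n]
    have hkT : Tendsto (fun n => (k n : ℝ) / T n) U (𝓝 s') := hfloor s s' hs0 hs'
    have hmT : Tendsto (fun n => (m n : ℝ) / T n) U (𝓝 h) :=
      hfloor (fun _ => h) h (fun _ => h0.le) tendsto_const_nhds
    have hmk : ∀ n, m n ≤ k n := fun n => Nat.floor_le_floor
      (mul_le_mul_of_nonneg_right (h12.trans (hs1 n)) (hT0 n).le)
    have t1 : Tendsto (fun n => S ((k n + 1 + m n) * q n) / T n) U (𝓝 (Z (s' + h))) := by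
      have := hmove (fun n => ((k n + 1 + m n : ℕ) : ℝ) / T n) (s' + h) (by
        have := (hkT.add hinv).add hmT
        rw [add_zero] at this
        refine this.congr fun n => ?_
        push_cast
        ring)
      simpa only [hmult] using this
    have t2 : Tendsto (fun n => S ((k n + 1) * q n) / T n) U (𝓝 (Z s')) := by
      have := hmove (fun n => ((k n + 1 : ℕ) : ℝ) / T n) s' (by
        have := hkT.add hinv
        rw [add_zero] at this
        refine this.congr fun n => ?_
        push_cast
        ring)
      simpa only [hmult] using this
    have t3 : Tendsto (fun n => S (k n * q n) / T n) U (𝓝 (Z s')) := by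
      simpa only [hmult] using hmove (fun n => (k n : ℝ) / T n) s' hkT
    have t4 : Tendsto (fun n => S ((k n - m n) * q n) / T n) U (𝓝 (Z (s' - h))) := by
      have := hmove (fun n => ((k n - m n : ℕ) : ℝ) / T n) (s' - h) (by
        refine (hkT.sub hmT).congr fun n => ?_
        rw [Nat.cast_sub (hmk n)]
        ring)
      simpa only [hmult] using this
    have tl := (((t1.sub t2).sub t3).add t4).abs
    have tr : Tendsto (fun n => (m n : ℝ) / T n * (|H i₀| - 6 * Λ * h)) U
        (𝓝 (h * (|H i₀| - 6 * Λ * h))) := hmT.mul_const _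
    have e1 : Z (s' + h) - 2 * Z s' + Z (s' - h) = Z (s' + h) - Z s' - Z s' + Z (s' - h) := by
      ring
    rw [e1]
    refine le_of_tendsto_of_tendsto tr tl ?_
    filter_upwards [hinv.eventually (ge_mem_nhds h0)] with n hn
    have hmT' : (m n + 1) * |d n| ≤ 2 * h / q n := by
      have h1 : (m n : ℝ) ≤ h * T n := Nat.floor_le (mul_nonneg h0.le (hT0 n).le)
      have h2 : (1 : ℝ) ≤ h * T n := (div_le_iff₀ (hT0 n)).1 hn
      calc (m n + 1) * |d n| ≤ (2 * (h * T n)) * |d n| :=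
            mul_le_mul_of_nonneg_right (by linarith) (hd' n).le
        _ = 2 * h * (T n * |d n|) := by ring
        _ = 2 * h / q n := by rw [hTd]; ring
    have hdq : |d n| ≤ h / q n := by
      have h2 : (1 : ℝ) ≤ h * T n := (div_le_iff₀ (hT0 n)).1 hn
      calc |d n| ≤ (h * T n) * |d n| := le_mul_of_one_le_left (hd' n).le h2
        _ = h * (T n * |d n|) := by ring
        _ = h / q n := by rw [hTd]; ring
    have hmain := hf.abs_second_difference_le (hq n) (hpq n) (hsep n) (hd n) (x₀ := x₀) (hj n)
      (τ := s n * T n) (hs n) (k := k n) (m := m n)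
      (Nat.floor_le (mul_nonneg (hs0 n) (hT0 n).le)) (Nat.lt_floor_add_one _) (hmk n) (by
        have : 2 * ((m n + 1) * |d n|) + |d n| ≤ 5 * h / q n := by
          refine (add_le_add (mul_le_mul_of_nonneg_left hmT' zero_le_two) hdq).trans (le_of_eq ?_)
          ring
        exact this.trans_lt (div_lt_div_of_pos_right h5 (hq' n)))
    have hrhs : m n * (Λ * ((q n + 2) * ((m n + 1) * |q n * α - p n|))) ≤ m n * (6 * Λ * h) := by
      refine mul_le_mul_of_nonneg_left ?_ (Nat.cast_nonneg _)
      calc Λ * ((q n + 2) * ((m n + 1) * |q n * α - p n|)) ≤ Λ * ((3 * q n) * (2 * h / q n)) := by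
            refine mul_le_mul_of_nonneg_left (mul_le_mul (by linarith [hq1 n]) hmT' ?_ ?_) hΛ
            · positivity
            · have := hq' n; positivity
        _ = 6 * Λ * h := by
            have := (hq' n).ne'
            field_simp
            ring
    rw [← sub_div, ← sub_div, ← add_div, abs_div, abs_of_pos (hT0 n), div_mul_eq_mul_div]
    refine div_le_div_of_nonneg_right ?_ (hT0 n).le
    have habs : |(m n : ℝ) * (SignType.sign (q n * α - p n) * H i₀)| = m n * |H i₀| := by
      rw [abs_mul, abs_mul, Nat.abs_cast]
      have : |((SignType.sign (q n * α - p n) : SignType) : ℝ)| = 1 := by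
        rcases lt_or_gt_of_ne (hd n) with h | h
        · rw [sign_neg h]; simp
        · rw [sign_pos h]; simp
      rw [this, one_mul]
    have h7 := hmain.trans hrhs
    have h8 := abs_sub_abs_le_abs_sub ((m n : ℝ) * (SignType.sign (q n * α - p n) * H i₀))
      (-(S ((k n + 1 + m n) * q n) - S ((k n + 1) * q n) - S (k n * q n) +
        S ((k n - m n) * q n)))
    rw [sub_neg_eq_add, abs_neg, habs, add_comm ((m n : ℝ) * _)] at h8
    rw [mul_sub]
    linarith
  have hHpos : 0 < |H i₀| := abs_pos.2 hH
  set κ : ℝ := min (min (1 / 2) (min ε 1 / 5)) (|H i₀| / (12 * Λ + 1)) with hκ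
  have hκ0 : 0 < κ := by
    have : 0 < min ε 1 := lt_min hε one_pos
    refine lt_min (lt_min (by norm_num) (by positivity)) (by positivity)
  have hfin : ∀ r, 0 < r → r < κ → |H i₀| / 2 * r ≤ |Z (s' + r) - 2 * Z s' + Z (s' - r)| := by
    intro r hr0 hr
    have a1 : r < 1 / 2 := hr.trans_le ((min_le_left _ _).trans (min_le_left _ _))
    have a2 : r < min ε 1 / 5 := hr.trans_le ((min_le_left _ _).trans (min_le_right _ _))
    have a3 : r < |H i₀| / (12 * Λ + 1) := hr.trans_le (min_le_right _ _)
    rw [lt_div_iff₀ (by positivity)] at a3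
    refine le_trans ?_ (hsecond r hr0 a1.le (by linarith))
    nlinarith
  refine not_differentiableAt_of_second_difference (half_pos hHpos) hκ0 hfin (hocc (by linarith) ?_)
  by_contra hcon
  push Not at hcon
  have a1 : κ / 2 < 1 / 2 := by
    have : κ ≤ 1 / 2 := (min_le_left _ _).trans (min_le_left _ _)
    linarith
  have := hfin (κ / 2) (by linarith) (by linarith)
  rw [hcon _ (by linarith), hcon _ (by linarith), hcon _ (by linarith)] at this
  simp only [mul_zero, sub_zero, add_zero, abs_zero] at this
  nlinarith

end

/-- Denominators `(q_k, q_{k-1})` of the continued fraction with digits `w`, last digit first. -/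
def convDen : List ℕ → ℕ × ℕ
  | [] => (1, 0)
  | b :: w => (b * (convDen w).1 + (convDen w).2, (convDen w).1)

/-- Numerators `(p_k, p_{k-1})` of the continued fraction with digits `w`, last digit first. -/
def convNum : List ℕ → ℕ × ℕ
  | [] => (0, 1)
  | b :: w => (b * (convNum w).1 + (convNum w).2, (convNum w).1)

/-- The irrational numbers of the unit interval. -/
def irrUnit : Set ℝ := {x | Irrational x ∧ 0 < x ∧ x < 1}

/-- The first continued fraction digit of a number in the unit interval. -/
noncomputable def cfDigit (x : ℝ) : ℕ := ⌊x⁻¹⌋₊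

/-- The iterates of the Gauss map. -/
noncomputable def gaussIter : ℕ → ℝ → ℝ
  | 0, x => x
  | k + 1, x => Int.fract (gaussIter k x)⁻¹

/-- The first `k` continued fraction digits, last digit first. -/
noncomputable def cfWord : ℕ → ℝ → List ℕ
  | 0, _ => []
  | k + 1, x => cfDigit (gaussIter k x) :: cfWord k x

/-- The inverse branch of the iterated Gauss map attached to the digits `w`. -/
noncomputable def cfBranch (w : List ℕ) (y : ℝ) : ℝ :=
  ((convNum w).1 + (convNum w).2 * y) / ((convDen w).1 + (convDen w).2 * y)

lemma convDen_fst_pos {w : List ℕ} (hw : ∀ b ∈ w, 1 ≤ b) : 0 < (convDen w).1 := by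
  induction w with
  | nil => simp [convDen]
  | cons b w ih =>
    have := ih (fun c hc => hw c (List.mem_cons_of_mem _ hc))
    have hb := hw b List.mem_cons_self
    simp only [convDen]
    positivity

lemma convDen_snd_le {w : List ℕ} (hw : ∀ b ∈ w, 1 ≤ b) : (convDen w).2 ≤ (convDen w).1 := by
  cases w with
  | nil => simp [convDen]
  | cons b w =>
    have hb := hw b List.mem_cons_self
    simp only [convDen]
    nlinarith

lemma abs_conv_det (w : List ℕ) :
    |((convNum w).2 * (convDen w).1 - (convNum w).1 * (convDen w).2 : ℤ)| = 1 := by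
  induction w with
  | nil => simp [convDen, convNum]
  | cons b w ih =>
    rw [← ih, ← abs_neg]
    simp only [convDen, convNum]
    push_cast
    ring_nf

lemma isCoprime_conv (w : List ℕ) : IsCoprime ((convNum w).1 : ℤ) ((convDen w).1 : ℤ) := by
  rcases (abs_eq zero_le_one).1 (abs_conv_det w) with h | h
  · exact ⟨-(convDen w).2, (convNum w).2, by linarith⟩
  · exact ⟨(convDen w).2, -(convNum w).2, by linarith⟩

lemma coprime_convDen (w : List ℕ) : Nat.Coprime (convDen w).1 (convDen w).2 := by
  rw [← Nat.isCoprime_iff_coprime]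
  rcases (abs_eq zero_le_one).1 (abs_conv_det w) with h | h
  · exact ⟨(convNum w).2, -(convNum w).1, by linarith⟩
  · exact ⟨-(convNum w).2, (convNum w).1, by linarith⟩

lemma measurableSet_irrUnit : MeasurableSet irrUnit := by
  have h : irrUnit = {x | Irrational x} ∩ Ioo 0 1 := by ext x; simp [irrUnit]
  rw [h]
  refine MeasurableSet.inter ?_ measurableSet_Ioo
  have : {x : ℝ | Irrational x} = (range ((↑) : ℚ → ℝ))ᶜ := rfl
  rw [this]
  exact (countable_range _).measurableSet.compl

lemma volume_inter_irrUnit {s : Set ℝ} (hs : s ⊆ Ioo 0 1) : volume (s ∩ irrUnit) = volume s := by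
  refine measure_inter_conull' ?_
  refine measure_mono_null (t := range ((↑) : ℚ → ℝ)) ?_ ((countable_range _).measure_zero _)
  rintro x ⟨hx, hx'⟩
  by_contra h
  exact hx' ⟨h, hs hx⟩

lemma volume_irrUnit : volume irrUnit = 1 := by
  have h := volume_inter_irrUnit (s := Ioo 0 1) subset_rfl
  rw [inter_eq_right.2 (fun x hx => hx.2)] at h
  simpa using h

lemma cfDigit_pos {x : ℝ} (hx : x ∈ irrUnit) : 1 ≤ cfDigit x :=
  Nat.le_floor (by simpa using (one_le_inv₀ hx.2.1).2 hx.2.2.le)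

lemma fract_inv_mem {x : ℝ} (hx : x ∈ irrUnit) : Int.fract x⁻¹ ∈ irrUnit := by
  have h : Irrational (Int.fract x⁻¹) := (irrational_inv_iff.2 hx.1).sub_intCast _
  exact ⟨h, (Int.fract_nonneg _).lt_of_ne' h.ne_zero, Int.fract_lt_one _⟩

lemma inv_eq_digit_add {x : ℝ} (hx : x ∈ irrUnit) : x⁻¹ = cfDigit x + Int.fract x⁻¹ := by
  rw [cfDigit, natCast_floor_eq_intCast_floor (inv_pos.2 hx.2.1).le, Int.floor_add_fract]

lemma gaussIter_mem {x : ℝ} (hx : x ∈ irrUnit) : ∀ k, gaussIter k x ∈ irrUnit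
  | 0 => hx
  | k + 1 => fract_inv_mem (gaussIter_mem hx k)

lemma length_cfWord (x : ℝ) : ∀ k, (cfWord k x).length = k
  | 0 => rfl
  | k + 1 => by simp [cfWord, length_cfWord x k]

lemma one_le_of_mem_cfWord {x : ℝ} (hx : x ∈ irrUnit) : ∀ k, ∀ b ∈ cfWord k x, 1 ≤ b
  | 0 => by simp [cfWord]
  | k + 1 => by
    simp only [cfWord, List.mem_cons, forall_eq_or_imp]
    exact ⟨cfDigit_pos (gaussIter_mem hx k), one_le_of_mem_cfWord hx k⟩

lemma inv_natCast_add_mem {b : ℕ} (hb : 1 ≤ b) {y : ℝ} (hy : y ∈ irrUnit) :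
    (b + y : ℝ)⁻¹ ∈ irrUnit ∧ cfDigit (b + y : ℝ)⁻¹ = b ∧ Int.fract ((b + y : ℝ)⁻¹)⁻¹ = y := by
  have hb' : (1 : ℝ) ≤ b := by exact_mod_cast hb
  have hpos : 0 < (b + y : ℝ) := by linarith [hy.2.1]
  refine ⟨⟨irrational_inv_iff.2 (hy.1.natCast_add b), inv_pos.2 hpos,
    inv_lt_one_of_one_lt₀ (by linarith [hy.2.1])⟩, ?_, ?_⟩
  · rw [cfDigit, inv_inv, Nat.floor_eq_iff hpos.le]
    exact ⟨by linarith [hy.2.1], by linarith [hy.2.2]⟩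
  · rw [inv_inv, Int.fract_natCast_add, Int.fract_eq_self]
    exact ⟨hy.2.1.le, hy.2.2⟩

lemma cfBranch_den_pos {w : List ℕ} (hw : ∀ b ∈ w, 1 ≤ b) {y : ℝ} (hy : 0 ≤ y) :
    (0 : ℝ) < (convDen w).1 + (convDen w).2 * y := by
  have : (0 : ℝ) < (convDen w).1 := by exact_mod_cast convDen_fst_pos hw
  positivity

lemma cfBranch_cons {b : ℕ} {w : List ℕ} {y : ℝ} (hb : 1 ≤ b) (hy : 0 < y) :
    cfBranch (b :: w) y = cfBranch w (b + y : ℝ)⁻¹ := by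
  have hpos : (0 : ℝ) < b + y := by positivity
  simp only [cfBranch, convNum, convDen]
  rw [← mul_div_mul_right (_ + _ * (b + y : ℝ)⁻¹) _ hpos.ne', add_mul, add_mul, mul_assoc,
    mul_assoc, inv_mul_cancel₀ hpos.ne']
  push_cast
  congr 1 <;> ring

theorem cfWord_cylinder {w : List ℕ} (hw : ∀ b ∈ w, 1 ≤ b) {J : Set ℝ} (hJ : J ⊆ irrUnit) :
    {x ∈ irrUnit | cfWord w.length x = w ∧ gaussIter w.length x ∈ J} = cfBranch w '' J := by
  induction w generalizing J with
  | nil =>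
    have h : cfBranch [] = id := by ext y; simp [cfBranch, convNum, convDen]
    ext x
    simpa [cfWord, gaussIter, h] using fun hx => hJ hx
  | cons b w ih =>
    have hb := hw b List.mem_cons_self
    have hsub : (fun y : ℝ => (b + y)⁻¹) '' J ⊆ irrUnit := by
      rintro _ ⟨y, hy, rfl⟩
      exact (inv_natCast_add_mem hb (hJ hy)).1
    have h1 : cfBranch (b :: w) '' J = cfBranch w '' ((fun y : ℝ => (b + y)⁻¹) '' J) := by
      rw [image_image]
      exact image_congr fun y hy => cfBranch_cons hb (hJ hy).2.1
    rw [h1, ← ih (fun c hc => hw c (List.mem_cons_of_mem _ hc)) hsub]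
    ext x
    simp only [List.length_cons, cfWord, gaussIter, List.cons.injEq, mem_ofPred_eq, mem_image]
    refine and_congr_right fun hx => ?_
    have hg := gaussIter_mem hx w.length
    constructor
    · rintro ⟨⟨h2, h3⟩, h4⟩
      refine ⟨h3, _, h4, ?_⟩
      rw [← h2, ← inv_eq_digit_add hg, inv_inv]
    · rintro ⟨h3, y, hy, h4⟩
      have := inv_natCast_add_mem hb (hJ hy)
      rw [← h4]
      exact ⟨⟨this.2.1, h3⟩, by rw [this.2.2]; exact hy⟩

lemma hasDerivAt_cfBranch {w : List ℕ} (hw : ∀ b ∈ w, 1 ≤ b) {y : ℝ} (hy : 0 ≤ y) :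
    HasDerivAt (cfBranch w) (((convNum w).2 * (convDen w).1 - (convNum w).1 * (convDen w).2) /
      ((convDen w).1 + (convDen w).2 * y) ^ 2) y := by
  have h1 : HasDerivAt (fun y : ℝ => ((convNum w).1 + (convNum w).2 * y : ℝ)) (convNum w).2 y := by
    simpa using ((hasDerivAt_id y).const_mul ((convNum w).2 : ℝ)).const_add ((convNum w).1 : ℝ)
  have h2 : HasDerivAt (fun y : ℝ => ((convDen w).1 + (convDen w).2 * y : ℝ)) (convDen w).2 y := by
    simpa using ((hasDerivAt_id y).const_mul ((convDen w).2 : ℝ)).const_add ((convDen w).1 : ℝ)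
  refine (h1.div h2 (cfBranch_den_pos hw hy).ne').congr_deriv ?_
  congr 1
  ring

lemma injOn_cfBranch {w : List ℕ} (hw : ∀ b ∈ w, 1 ≤ b) : InjOn (cfBranch w) irrUnit := by
  intro x hx y hy h
  have hx' := cfBranch_den_pos hw hx.2.1.le
  have hy' := cfBranch_den_pos hw hy.2.1.le
  have hd : ((convNum w).2 * (convDen w).1 - (convNum w).1 * (convDen w).2 : ℝ) ≠ 0 := by
    have := abs_conv_det w
    intro h0
    have h0' : ((convNum w).2 * (convDen w).1 - (convNum w).1 * (convDen w).2 : ℤ) = 0 := by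
      exact_mod_cast h0
    rw [h0'] at this
    simp at this
  simp only [cfBranch] at h
  rw [div_eq_div_iff hx'.ne' hy'.ne'] at h
  refine sub_eq_zero.1 ((mul_eq_zero.1 ?_).resolve_left hd)
  linear_combination h

lemma volume_cfBranch_image {w : List ℕ} (hw : ∀ b ∈ w, 1 ≤ b) {J : Set ℝ} (hJ : J ⊆ irrUnit)
    (hm : MeasurableSet J) : volume (cfBranch w '' J) =
      ∫⁻ y in J, ENNReal.ofReal (1 / ((convDen w).1 + (convDen w).2 * y) ^ 2) := by
  have h := lintegral_image_eq_lintegral_abs_deriv_mul hm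
    (fun y hy => (hasDerivAt_cfBranch hw (hJ hy).2.1.le).hasDerivWithinAt)
    ((injOn_cfBranch hw).mono hJ) (fun _ => 1)
  simp only [mul_one, lintegral_const, one_mul, Measure.restrict_apply_univ] at h
  rw [h]
  have hd : |((convNum w).2 * (convDen w).1 - (convNum w).1 * (convDen w).2 : ℝ)| = 1 := by
    exact_mod_cast abs_conv_det w
  simp only [abs_div, hd, abs_pow, sq_abs]

lemma volume_cfBranch_image_le {w : List ℕ} (hw : ∀ b ∈ w, 1 ≤ b) {J : Set ℝ} (hJ : J ⊆ irrUnit)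
    (hm : MeasurableSet J) :
    volume (cfBranch w '' J) ≤ ENNReal.ofReal (1 / (convDen w).1 ^ 2) * volume J := by
  rw [volume_cfBranch_image hw hJ hm, ← setLIntegral_const]
  refine setLIntegral_mono measurable_const fun y hy => ENNReal.ofReal_le_ofReal ?_
  have : (0 : ℝ) < (convDen w).1 := by exact_mod_cast convDen_fst_pos hw
  have hy0 := (hJ hy).2.1.le
  gcongr
  have : 0 ≤ (convDen w).2 * y := by positivity
  linarith

lemma le_volume_cfBranch_image {w : List ℕ} (hw : ∀ b ∈ w, 1 ≤ b) {J : Set ℝ} (hJ : J ⊆ irrUnit)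
    (hm : MeasurableSet J) :
    ENNReal.ofReal (1 / (convDen w).1 ^ 2) * volume J ≤ 4 * volume (cfBranch w '' J) := by
  rw [volume_cfBranch_image hw hJ hm, ← setLIntegral_const, ← lintegral_const_mul' _ _ (by simp)]
  refine setLIntegral_mono' hm fun y hy => ?_
  have h0 : (0 : ℝ) < (convDen w).1 := by exact_mod_cast convDen_fst_pos hw
  have h1 : ((convDen w).2 : ℝ) ≤ (convDen w).1 := by exact_mod_cast convDen_snd_le hw
  obtain ⟨-, hy0, hy1⟩ := hJ hy
  have h4 : (4 : ENNReal) = ENNReal.ofReal 4 := by simp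
  rw [h4, ← ENNReal.ofReal_mul (by norm_num)]
  refine ENNReal.ofReal_le_ofReal ?_
  have h2 : (convDen w).2 * y ≤ (convDen w).1 := by nlinarith
  have h3 : 0 ≤ (convDen w).2 * y := by positivity
  rw [mul_one_div, div_le_div_iff₀ (by positivity) (by positivity)]
  nlinarith

lemma measurable_gaussIter : ∀ k, Measurable (gaussIter k)
  | 0 => measurable_id
  | k + 1 => ((measurable_gaussIter k).inv).fract

lemma measurableSet_cfWord_eq (w : List ℕ) (k : ℕ) : MeasurableSet {x | cfWord k x = w} := by
  induction k generalizing w with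
  | zero => simp [cfWord]
  | succ k ih =>
    cases w with
    | nil => simp [cfWord]
    | cons b w =>
      simp only [cfWord, List.cons.injEq]
      have hd : Measurable fun x => cfDigit (gaussIter k x) :=
        Nat.measurable_floor.comp (measurable_gaussIter k).inv
      exact (hd (measurableSet_singleton b)).inter (ih w)

lemma measurableSet_cfWord (S : Set (List ℕ)) (k : ℕ) : MeasurableSet {x | cfWord k x ∈ S} := by
  have : {x | cfWord k x ∈ S} = ⋃ w ∈ S, {x | cfWord k x = w} := by ext; simp
  rw [this]
  exact MeasurableSet.biUnion S.to_countable fun w _ => measurableSet_cfWord_eq w k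

lemma volume_cfWord_gaussIter_eq (k : ℕ) (S : Set (List ℕ)) (J : List ℕ → Set ℝ)
    (hm : ∀ w ∈ S, MeasurableSet (J w)) :
    volume {x ∈ irrUnit | cfWord k x ∈ S ∧ gaussIter k x ∈ J (cfWord k x)} =
      ∑' w : S, volume {x ∈ irrUnit | cfWord k x = w ∧ gaussIter k x ∈ J w} := by
  have : {x ∈ irrUnit | cfWord k x ∈ S ∧ gaussIter k x ∈ J (cfWord k x)} =
      ⋃ w ∈ S, {x ∈ irrUnit | cfWord k x = w ∧ gaussIter k x ∈ J w} := by
    ext x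
    simp only [mem_ofPred_eq, mem_iUnion, exists_prop]
    constructor
    · rintro ⟨h1, h2, h3⟩
      exact ⟨_, h2, h1, rfl, h3⟩
    · rintro ⟨w, h1, h2, rfl, h3⟩
      exact ⟨h2, h1, h3⟩
  rw [this, measure_biUnion S.to_countable]
  · intro u _ v _ huv
    refine disjoint_left.2 ?_
    rintro x ⟨_, h1, _⟩ ⟨_, h2, _⟩
    exact huv (h1.symm.trans h2)
  · exact fun w hw => measurableSet_irrUnit.inter
      ((measurableSet_cfWord_eq w k).inter (measurable_gaussIter k (hm w hw)))

lemma cylinder_eq_image (k : ℕ) (w : List ℕ) {J : Set ℝ} (hJ : J ⊆ irrUnit) :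
    {x ∈ irrUnit | cfWord k x = w ∧ gaussIter k x ∈ J} = ∅ ∧
      {x ∈ irrUnit | cfWord k x = w ∧ gaussIter k x ∈ irrUnit} = ∅ ∨
    (∀ b ∈ w, 1 ≤ b) ∧ {x ∈ irrUnit | cfWord k x = w ∧ gaussIter k x ∈ J} = cfBranch w '' J ∧
      {x ∈ irrUnit | cfWord k x = w ∧ gaussIter k x ∈ irrUnit} = cfBranch w '' irrUnit := by
  by_cases h : ∃ x ∈ irrUnit, cfWord k x = w
  · obtain ⟨x, hx, rfl⟩ := h
    have hw := one_le_of_mem_cfWord hx k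
    have h1 := cfWord_cylinder hw hJ
    have h2 := cfWord_cylinder hw (subset_refl irrUnit)
    rw [length_cfWord] at h1 h2
    exact Or.inr ⟨hw, h1, h2⟩
  · push Not at h
    left
    constructor <;>
    · refine eq_empty_of_forall_notMem ?_
      rintro x ⟨hx, h1, _⟩
      exact h x hx h1

lemma setOf_cfWord_eq (k : ℕ) (S : Set (List ℕ)) : {x ∈ irrUnit | cfWord k x ∈ S} =
    {x ∈ irrUnit | cfWord k x ∈ S ∧ gaussIter k x ∈ irrUnit} := by
  ext x
  simp only [mem_ofPred_eq]
  exact and_congr_right fun hx => by simp [gaussIter_mem hx k]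

theorem volume_gaussIter_preimage_le (k : ℕ) {J : Set ℝ} (hJ : J ⊆ irrUnit)
    (hm : MeasurableSet J) : volume {x ∈ irrUnit | gaussIter k x ∈ J} ≤ 4 * volume J := by
  have h1 := volume_cfWord_gaussIter_eq k univ (fun _ => J) (fun _ _ => hm)
  have h2 := volume_cfWord_gaussIter_eq k univ (fun _ => irrUnit) (fun _ _ => measurableSet_irrUnit)
  rw [← setOf_cfWord_eq] at h2
  simp only [mem_univ, true_and, and_true] at h1 h2
  have h3 : volume {x | x ∈ irrUnit} = 1 := volume_irrUnit
  rw [h3] at h2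
  calc volume {x ∈ irrUnit | gaussIter k x ∈ J} ≤ ∑' w : (univ : Set (List ℕ)), 4 * volume J *
        volume {x ∈ irrUnit | cfWord k x = w ∧ gaussIter k x ∈ irrUnit} := by
        rw [h1]
        refine ENNReal.tsum_le_tsum fun w => ?_
        rcases cylinder_eq_image k w hJ with ⟨h, -⟩ | ⟨hw, h, h'⟩
        · simp [h]
        · rw [h, h', mul_right_comm, mul_comm]
          refine (volume_cfBranch_image_le hw hJ hm).trans ?_
          rw [mul_comm]
          gcongr
          simpa [volume_irrUnit] using
            le_volume_cfBranch_image hw (subset_refl irrUnit) measurableSet_irrUnit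
    _ = 4 * volume J := by rw [ENNReal.tsum_mul_left, ← h2, mul_one]

theorem le_volume_cfWord_gaussIter (k : ℕ) (S : Set (List ℕ)) (J : List ℕ → Set ℝ)
    (hJ : ∀ w ∈ S, J w ⊆ irrUnit) (hm : ∀ w ∈ S, MeasurableSet (J w)) {c : ENNReal}
    (hc : ∀ w ∈ S, c ≤ volume (J w)) : c * volume {x ∈ irrUnit | cfWord k x ∈ S} ≤
      4 * volume {x ∈ irrUnit | cfWord k x ∈ S ∧ gaussIter k x ∈ J (cfWord k x)} := by
  rw [setOf_cfWord_eq, volume_cfWord_gaussIter_eq k S J hm,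
    volume_cfWord_gaussIter_eq k S (fun _ => irrUnit) (fun _ _ => measurableSet_irrUnit),
    ← ENNReal.tsum_mul_left, ← ENNReal.tsum_mul_left]
  refine ENNReal.tsum_le_tsum fun w => ?_
  rcases cylinder_eq_image k w (hJ w w.2) with ⟨-, h⟩ | ⟨hw, h, h'⟩
  · simp [h]
  · rw [h, h']
    refine le_trans ?_ (le_volume_cfBranch_image hw (hJ w w.2) (hm w w.2))
    rw [mul_comm]
    refine mul_le_mul' ?_ (hc w w.2)
    simpa [volume_irrUnit] using
      volume_cfBranch_image_le hw (subset_refl irrUnit) measurableSet_irrUnit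

lemma cfBranch_gaussIter {x : ℝ} (hx : x ∈ irrUnit) (k : ℕ) :
    cfBranch (cfWord k x) (gaussIter k x) = x := by
  have h := cfWord_cylinder (one_le_of_mem_cfWord hx k)
    (singleton_subset_iff.2 (gaussIter_mem hx k))
  rw [image_singleton, length_cfWord] at h
  have h' : x ∈ ({cfBranch (cfWord k x) (gaussIter k x)} : Set ℝ) :=
    h ▸ ⟨hx, rfl, mem_singleton _⟩
  exact h'.symm

lemma abs_convDen_mul_sub {x : ℝ} (hx : x ∈ irrUnit) (k : ℕ) :
    |((convDen (cfWord k x)).1 : ℕ) * x - ((convNum (cfWord k x)).1 : ℤ)| = gaussIter k x /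
      ((convDen (cfWord k x)).1 + (convDen (cfWord k x)).2 * gaussIter k x) := by
  have h := cfBranch_gaussIter hx k
  have hy := gaussIter_mem hx k
  have hpos := cfBranch_den_pos (one_le_of_mem_cfWord hx k) hy.2.1.le
  have hd := abs_conv_det (cfWord k x)
  generalize cfWord k x = w at *
  generalize gaussIter k x = y at *
  have hd' : |((convNum w).2 * (convDen w).1 - (convNum w).1 * (convDen w).2 : ℝ)| = 1 := by
    exact_mod_cast hd
  rw [cfBranch, div_eq_iff hpos.ne'] at h
  rw [eq_div_iff hpos.ne', ← abs_of_pos hpos, ← abs_mul]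
  have : (((convDen w).1 : ℕ) * x - ((convNum w).1 : ℤ)) *
      ((convDen w).1 + (convDen w).2 * y) =
      ((convNum w).2 * (convDen w).1 - (convNum w).1 * (convDen w).2) * y := by
    push_cast
    linear_combination -((convDen w).1 : ℝ) * h
  rw [this, abs_mul, hd', one_mul, abs_of_pos hy.2.1]

lemma convDen_mul_abs_le {x : ℝ} (hx : x ∈ irrUnit) (k : ℕ) :
    ((convDen (cfWord k x)).1 : ℕ) * |((convDen (cfWord k x)).1 : ℕ) * x -
      ((convNum (cfWord k x)).1 : ℤ)| ≤ gaussIter k x := by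
  have hw := one_le_of_mem_cfWord hx k
  have hy := (gaussIter_mem hx k).2.1
  have hpos := cfBranch_den_pos hw hy.le
  rw [abs_convDen_mul_sub hx k, mul_div_assoc', div_le_iff₀ hpos, mul_comm]
  refine mul_le_mul_of_nonneg_left ?_ hy.le
  have : 0 ≤ (convDen (cfWord k x)).2 * gaussIter k x := by positivity
  linarith

lemma abs_sub_div_le {x : ℝ} (hx : x ∈ irrUnit) (k : ℕ) :
    |x - ((convNum (cfWord k x)).1 : ℤ) / ((convDen (cfWord k x)).1 : ℕ)| ≤
      1 / (((convDen (cfWord k x)).1 : ℕ) : ℝ) ^ 2 := by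
  have hq : (0 : ℝ) < ((convDen (cfWord k x)).1 : ℕ) := by
    exact_mod_cast convDen_fst_pos (one_le_of_mem_cfWord hx k)
  have h1 := convDen_mul_abs_le hx k
  have h2 := (gaussIter_mem hx k).2.2
  have h3 : x - ((convNum (cfWord k x)).1 : ℤ) / ((convDen (cfWord k x)).1 : ℕ) =
      (((convDen (cfWord k x)).1 : ℕ) * x - ((convNum (cfWord k x)).1 : ℤ)) /
        ((convDen (cfWord k x)).1 : ℕ) := by
    field_simp
  rw [h3, abs_div, abs_of_pos hq, div_le_div_iff₀ hq (by positivity)]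
  nlinarith

lemma JumpRegular.abs_birkhoff_le_cfWord {ν : ℕ} {f : UnitAddCircle → ℝ}
    {γ : Fin ν → UnitAddCircle} {H : Fin ν → ℝ} {Λ : ℝ} (hf : JumpRegular f γ H Λ) {x : ℝ}
    (hx : x ∈ irrUnit) (k : ℕ) : ∀ r < (convDen (cfWord k x)).1, ∀ z,
      |birkhoff f x z r| ≤ 2 * (2 * Λ + 10 * ν * Λ) * (cfWord k x).sum := by
  have hC : 0 ≤ 2 * Λ + 10 * ν * Λ := by have := hf.nonneg; positivity
  induction k with
  | zero =>
    intro r hr z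
    have : r = 0 := by simpa [cfWord, convDen] using hr
    simp [this, birkhoff, cfWord]
  | succ k ih =>
    intro r hr z
    have hw := one_le_of_mem_cfWord hx k
    have hq := convDen_fst_pos hw
    have hq' : (0 : ℝ) < (convDen (cfWord k x)).1 := by exact_mod_cast hq
    have hQ := convDen_snd_le hw
    have h1 := abs_birkhoff_sub_le hq
      (fun y => hf.abs_birkhoff_le hq (isCoprime_conv _) (abs_sub_div_le hx k) y) ih
      (x := z) (Nat.zero_le r)
    have hb := cfDigit_pos (gaussIter_mem hx k)
    simp only [cfWord, convDen, List.sum_cons] at hr ⊢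
    set b := cfDigit (gaussIter k x)
    have hb' : (1 : ℝ) ≤ b := by exact_mod_cast hb
    have h0 : birkhoff f x z 0 = 0 := by simp [birkhoff]
    rw [h0, sub_zero, Nat.cast_zero, sub_zero] at h1
    have h2 : (r : ℝ) / (convDen (cfWord k x)).1 ≤ 2 * b := by
      rw [div_le_iff₀ hq']
      have : (r : ℝ) ≤ b * (convDen (cfWord k x)).1 + (convDen (cfWord k x)).2 := by
        exact_mod_cast hr.le
      have hQ' : ((convDen (cfWord k x)).2 : ℝ) ≤ (convDen (cfWord k x)).1 := by exact_mod_cast hQ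
      nlinarith
    have h3 := mul_le_mul_of_nonneg_left h2 hC
    rw [Nat.cast_add]
    linarith

theorem JumpRegular.goodScale {ν : ℕ} {f : UnitAddCircle → ℝ} {γ : Fin ν → UnitAddCircle}
    {H : Fin ν → ℝ} {Λ : ℝ} (hf : JumpRegular f γ H Λ) {i₀ : Fin ν} {ε : ℝ} {K : ℕ} {x : ℝ}
    (hx : x ∈ irrUnit) (k : ℕ)
    (hsep : ∀ i, i ≠ i₀ → ε ≤ ‖(convDen (cfWord k x)).1 • (γ i₀ - γ i)‖)
    (hK : K * (1 + 2 * (2 * Λ + 10 * ν * Λ) * (cfWord k x).sum) * gaussIter k x ≤ 1) :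
    GoodScale f γ i₀ x ε K := by
  have hw := one_le_of_mem_cfWord hx k
  have hy := (gaussIter_mem hx k).2.1
  have hC : 0 ≤ 2 * Λ + 10 * ν * Λ := by have := hf.nonneg; positivity
  have hT := convDen_mul_abs_le hx k
  have hV : 0 ≤ 2 * (2 * Λ + 10 * ν * Λ) * (cfWord k x).sum := by positivity
  refine ⟨(convNum (cfWord k x)).1, (convDen (cfWord k x)).1, convDen_fst_pos hw,
    isCoprime_conv _, ?_, ?_, ?_, hsep⟩
  · rw [← abs_pos, abs_convDen_mul_sub hx k]
    exact div_pos hy (cfBranch_den_pos hw hy.le)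
  · refine le_trans ?_ hK
    refine mul_le_mul ?_ hT (by positivity) (by positivity)
    nlinarith [(Nat.cast_nonneg K : (0 : ℝ) ≤ K)]
  · intro r hr z
    refine le_trans ?_ hK
    refine mul_le_mul ?_ hT (by positivity) (by positivity)
    refine mul_le_mul_of_nonneg_left ?_ (Nat.cast_nonneg K)
    linarith [hf.abs_birkhoff_le_cfWord hx k r hr z]

lemma exists_coprime_mul_add {q q' : ℕ} (h : Nat.Coprime q q') {W : ℕ} (hW : 0 < W) :
    ∃ b, 1 ≤ b ∧ b ≤ W ∧ Nat.Coprime (b * q + q') W := by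
  set s := W.primeFactors.filter fun p => ¬ p ∣ q' with hs
  have hp : ∀ p ∈ s, p.Prime := fun p hp =>
    Nat.prime_of_mem_primeFactors (Finset.mem_of_mem_filter p hp)
  refine ⟨∏ p ∈ s, p, Finset.prod_pos fun p hps => (hp p hps).pos, ?_, ?_⟩
  · refine Nat.le_of_dvd hW ?_
    exact (Finset.prod_dvd_prod_of_subset _ _ _ (Finset.filter_subset _ _)).trans
      (Nat.prod_primeFactors_dvd W)
  · refine Nat.coprime_of_dvd fun p hpp h1 h2 => ?_
    by_cases hpq : p ∣ q'
    · have h3 : p ∣ (∏ p ∈ s, p) * q := (Nat.dvd_add_left hpq).1 h1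
      rcases hpp.dvd_mul.1 h3 with h4 | h4
      · obtain ⟨r, hr, hpr⟩ := (hpp.prime.dvd_finsetProd_iff _).1 h4
        have : p = r := (Nat.prime_dvd_prime_iff_eq hpp (hp r hr)).1 hpr
        rw [hs, Finset.mem_filter, ← this] at hr
        exact hr.2 hpq
      · exact Nat.not_coprime_of_dvd_of_dvd hpp.one_lt h4 hpq h
    · have h3 : p ∈ s := by
        rw [hs, Finset.mem_filter, Nat.mem_primeFactors]
        exact ⟨⟨hpp, h2, hW.ne'⟩, hpq⟩
      exact hpq ((Nat.dvd_add_right ((Finset.dvd_prod_of_mem _ h3).mul_right q)).1 h1)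

/-- Lebesgue measure on the irrational numbers of the unit interval. -/
noncomputable def irrMeasure : Measure ℝ := volume.restrict irrUnit

instance : IsProbabilityMeasure irrMeasure :=
  ⟨by rw [irrMeasure, Measure.restrict_apply_univ, volume_irrUnit]⟩

lemma irrMeasure_apply (s : Set ℝ) : irrMeasure s = volume (s ∩ irrUnit) :=
  Measure.restrict_apply' measurableSet_irrUnit

lemma irrMeasure_eq_restrict_Ioo : irrMeasure = volume.restrict (Ioo 0 1) := by
  refine Measure.restrict_congr_set ?_
  have h : irrUnit ⊆ Ioo 0 1 := fun x hx => hx.2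
  refine (ae_eq_of_subset_of_measure_ge h ?_ measurableSet_irrUnit.nullMeasurableSet
    (by simp))
  rw [volume_irrUnit]
  simp

lemma irrMeasure_of_subset {s : Set ℝ} (hs : s ⊆ Ioo 0 1) : irrMeasure s = volume s := by
  rw [irrMeasure_apply, volume_inter_irrUnit hs]

lemma ae_mem_irrUnit : ∀ᵐ x ∂irrMeasure, x ∈ irrUnit := ae_restrict_mem measurableSet_irrUnit

lemma irrMeasure_gaussIter_preimage_le (k : ℕ) {J : Set ℝ} (hm : MeasurableSet J) :
    irrMeasure (gaussIter k ⁻¹' J) ≤ 4 * irrMeasure J := by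
  rw [irrMeasure_apply, irrMeasure_apply]
  refine le_trans (measure_mono ?_) (volume_gaussIter_preimage_le k
    (inter_subset_right (s := J)) (hm.inter measurableSet_irrUnit))
  rintro x ⟨h1, h2⟩
  exact ⟨h2, h1, gaussIter_mem h2 k⟩

lemma map_gaussIter_le (k : ℕ) : irrMeasure.map (gaussIter k) ≤ (4 : ENNReal) • irrMeasure := by
  refine Measure.le_iff.2 fun s hs => ?_
  rw [Measure.map_apply (measurable_gaussIter k) hs]
  exact irrMeasure_gaussIter_preimage_le k hs

lemma irrMeasure_real_mono {s t : Set ℝ} (h : ∀ x ∈ irrUnit, x ∈ s → x ∈ t) :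
    irrMeasure.real s ≤ irrMeasure.real t :=
  ENNReal.toReal_mono (measure_ne_top _ _) (measure_mono_ae (ae_mem_irrUnit.mono h))

lemma irrMeasure_real_gaussIter_le_le (k : ℕ) {s : ℝ} (hs : 0 ≤ s) :
    irrMeasure.real {x | gaussIter k x ≤ s} ≤ 4 * s := by
  refine ENNReal.toReal_le_of_le_ofReal (by positivity) ?_
  refine (irrMeasure_gaussIter_preimage_le k (measurableSet_Iic (a := s))).trans ?_
  rw [ENNReal.ofReal_mul (by norm_num), irrMeasure_apply]
  have : volume (Iic s ∩ irrUnit) ≤ ENNReal.ofReal s := by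
    refine (measure_mono (t := Ioc 0 s) ?_).trans (by simp)
    rintro x ⟨h1, h2⟩
    exact ⟨h2.2.1, h1⟩
  simpa using mul_le_mul_right this 4

lemma le_irrMeasure_cfWord_gaussIter (k : ℕ) (S : Set (List ℕ)) (J : List ℕ → Set ℝ)
    (hm : ∀ w ∈ S, MeasurableSet (J w)) {c : ℝ} (hc0 : 0 ≤ c)
    (hc : ∀ w ∈ S, c ≤ irrMeasure.real (J w)) : c * irrMeasure.real {x | cfWord k x ∈ S} ≤
      4 * irrMeasure.real {x | cfWord k x ∈ S ∧ gaussIter k x ∈ J (cfWord k x)} := by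
  have h := le_volume_cfWord_gaussIter k S (fun w => J w ∩ irrUnit)
    (fun w _ => inter_subset_right) (fun w hw => (hm w hw).inter measurableSet_irrUnit)
    (c := ENNReal.ofReal c) (fun w hw => by
      rw [← irrMeasure_apply]
      exact (ENNReal.ofReal_le_ofReal (hc w hw)).trans (by rw [ofReal_measureReal]))
  have h1 : {x ∈ irrUnit | cfWord k x ∈ S} = {x | cfWord k x ∈ S} ∩ irrUnit := by
    ext x; simp [and_comm]
  have h2 : {x ∈ irrUnit | cfWord k x ∈ S ∧ gaussIter k x ∈ J (cfWord k x) ∩ irrUnit} =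
      {x | cfWord k x ∈ S ∧ gaussIter k x ∈ J (cfWord k x)} ∩ irrUnit := by
    ext x
    simp only [mem_ofPred_eq, mem_inter_iff]
    constructor
    · tauto
    · rintro ⟨⟨h3, h4⟩, h5⟩
      exact ⟨h5, h3, h4, gaussIter_mem h5 k⟩
  rw [h1, h2, ← irrMeasure_apply, ← irrMeasure_apply] at h
  have h3 := ENNReal.toReal_mono (by finiteness) h
  rwa [ENNReal.toReal_mul, ENNReal.toReal_mul, ENNReal.toReal_ofReal hc0] at h3

lemma irrMeasure_real_sum_gaussIter_ge_le {g : ℝ → ℝ} (hg : Measurable g)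
    (hg0 : ∀ x ∈ irrUnit, 0 ≤ g x) (hgi : IntervalIntegrable g volume 0 1) (k : ℕ) {L : ℝ}
    (hL : 0 < L) : irrMeasure.real {x | L ≤ ∑ i ∈ Finset.range k, g (gaussIter i x)} ≤
      4 * k * (∫ x in (0 : ℝ)..1, g x) / L := by
  have hgi' : Integrable g irrMeasure := by
    rw [irrMeasure_eq_restrict_Ioo]
    exact (intervalIntegrable_iff_integrableOn_Ioo_of_le zero_le_one).1 hgi
  have hI : ∫ x in (0 : ℝ)..1, g x = ∫ x, g x ∂irrMeasure := by
    rw [intervalIntegral.integral_of_le zero_le_one, integral_Ioc_eq_integral_Ioo,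
      irrMeasure_eq_restrict_Ioo]
  have hg0' : 0 ≤ᵐ[irrMeasure] g := ae_mem_irrUnit.mono hg0
  have hI0 : 0 ≤ ∫ x, g x ∂irrMeasure := integral_nonneg_of_ae hg0'
  have h1 : ∀ i, ∫⁻ x, ENNReal.ofReal (g (gaussIter i x)) ∂irrMeasure ≤
      ENNReal.ofReal (4 * ∫ x, g x ∂irrMeasure) := fun i => by
    rw [← lintegral_map (f := fun x => ENNReal.ofReal (g x)) hg.ennreal_ofReal
      (measurable_gaussIter i)]
    refine (lintegral_mono' (map_gaussIter_le i) le_rfl).trans (le_of_eq ?_)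
    rw [lintegral_smul_measure, ← ofReal_integral_eq_lintegral_ofReal hgi' hg0',
      ENNReal.ofReal_mul (by norm_num)]
    simp
  have hmeas : ∀ i, Measurable fun x => ENNReal.ofReal (g (gaussIter i x)) :=
    fun i => (hg.comp (measurable_gaussIter i)).ennreal_ofReal
  have h2 := mul_meas_ge_le_lintegral (μ := irrMeasure)
    (Finset.measurable_fun_sum (Finset.range k) fun i _ => hmeas i) (ENNReal.ofReal L)
  rw [lintegral_finsetSum _ (fun i _ => hmeas i)] at h2
  have h3 := h2.trans (Finset.sum_le_sum fun i _ => h1 i)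
  rw [Finset.sum_const, Finset.card_range, nsmul_eq_mul, ← ENNReal.ofReal_natCast,
    ← ENNReal.ofReal_mul (Nat.cast_nonneg k)] at h3
  have h4 : irrMeasure {x | L ≤ ∑ i ∈ Finset.range k, g (gaussIter i x)} ≤
      irrMeasure {x | ENNReal.ofReal L ≤ ∑ i ∈ Finset.range k,
        ENNReal.ofReal (g (gaussIter i x))} := by
    refine measure_mono_ae (ae_mem_irrUnit.mono fun x hx h => ?_)
    have h' : L ≤ ∑ i ∈ Finset.range k, g (gaussIter i x) := h
    change ENNReal.ofReal L ≤ _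
    rw [← ENNReal.ofReal_sum_of_nonneg fun i _ => hg0 _ (gaussIter_mem hx i)]
    exact ENNReal.ofReal_le_ofReal h'
  have h5 := (mul_le_mul_right h4 (ENNReal.ofReal L)).trans h3
  have h6 := ENNReal.toReal_mono (by finiteness) h5
  rw [ENNReal.toReal_mul, ENNReal.toReal_ofReal hL.le, ENNReal.toReal_ofReal (by positivity)] at h6
  rw [hI, le_div_iff₀ hL, mul_comm]
  exact h6.trans (le_of_eq (by ring))

lemma sum_cfWord_le {x : ℝ} (hx : x ∈ irrUnit) (k : ℕ) :
    ((cfWord k x).sum : ℝ) ≤ ∑ i ∈ Finset.range k, (gaussIter i x)⁻¹ := by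
  induction k with
  | zero => simp [cfWord]
  | succ k ih =>
    rw [Finset.sum_range_succ, cfWord, List.sum_cons, Nat.cast_add, add_comm]
    refine add_le_add ih (Nat.floor_le ?_)
    exact (inv_pos.2 (gaussIter_mem hx k).2.1).le

lemma log_convDen_le {x : ℝ} (hx : x ∈ irrUnit) (k : ℕ) :
    Real.log (convDen (cfWord k x)).1 ≤
      ∑ i ∈ Finset.range k, (Real.log 2 - Real.log (gaussIter i x)) := by
  induction k with
  | zero => simp [cfWord, convDen]
  | succ k ih =>
    have hw := one_le_of_mem_cfWord hx k
    have hq : (0 : ℝ) < (convDen (cfWord k x)).1 := by exact_mod_cast convDen_fst_pos hw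
    have hq1 : (0 : ℝ) < (convDen (cfWord (k + 1) x)).1 := by
      exact_mod_cast convDen_fst_pos (one_le_of_mem_cfWord hx (k + 1))
    have hy := gaussIter_mem hx k
    have hQ : ((convDen (cfWord k x)).2 : ℝ) ≤ (convDen (cfWord k x)).1 := by
      exact_mod_cast convDen_snd_le hw
    rw [Finset.sum_range_succ, ← Real.log_div two_ne_zero hy.2.1.ne']
    refine le_trans ?_ (add_le_add_left ih _)
    rw [← Real.log_mul hq.ne' (div_pos two_pos hy.2.1).ne']
    refine Real.log_le_log hq1 ?_
    simp only [cfWord, convDen]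
    push_cast
    have h1 : (cfDigit (gaussIter k x) : ℝ) ≤ (gaussIter k x)⁻¹ :=
      Nat.floor_le (inv_pos.2 hy.2.1).le
    have h2 : 1 ≤ (gaussIter k x)⁻¹ := (one_le_inv₀ hy.2.1).2 hy.2.2.le
    rw [div_eq_mul_inv]
    nlinarith

lemma irrMeasure_real_log_convDen_ge_le (k : ℕ) {L : ℝ} (hL : 0 < L) :
    irrMeasure.real {x | L ≤ Real.log (convDen (cfWord k x)).1} ≤ 8 * k / L := by
  have h := irrMeasure_real_sum_gaussIter_ge_le (g := fun y => Real.log 2 - Real.log y)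
    (measurable_const.sub Real.measurable_log)
    (fun x hx => sub_nonneg.2 (Real.log_le_log hx.2.1 (by linarith [hx.2.2])))
    (intervalIntegrable_const.sub intervalIntegral.intervalIntegrable_log') k hL
  have hI : ∫ y in (0 : ℝ)..1, (Real.log 2 - Real.log y) = Real.log 2 + 1 := by
    rw [intervalIntegral.integral_sub intervalIntegrable_const
      intervalIntegral.intervalIntegrable_log', integral_log]
    simp
  rw [hI] at h
  refine le_trans (irrMeasure_real_mono ?_) (h.trans ?_)
  · exact fun x hx h1 => le_trans h1 (log_convDen_le hx k)
  · refine div_le_div_of_nonneg_right ?_ hL.le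
    have := Real.log_two_lt_d9
    nlinarith [(Nat.cast_nonneg k : (0 : ℝ) ≤ k)]

lemma irrMeasure_real_sum_cfWord_ge_le (k : ℕ) {L s : ℝ} (hL : 0 < L) (hs : 0 < s) (hs1 : s ≤ 1) :
    irrMeasure.real {x | L ≤ (cfWord k x).sum} ≤ k * (4 * s) + 4 * k * Real.log s⁻¹ / L := by
  have h_int : IntervalIntegrable (fun y : ℝ => (Ioc s 1).indicator (fun y => y⁻¹) y) volume 0 1 ∧
      ∫ y in (0 : ℝ)..1, (Ioc s 1).indicator (fun y => y⁻¹) y = Real.log s⁻¹ := by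
    have h1 : IntegrableOn (fun y : ℝ => y⁻¹) (Ioc s 1) := by
      rw [← intervalIntegrable_iff_integrableOn_Ioc_of_le hs1]
      refine (intervalIntegrable_inv_iff).2 (Or.inr ?_)
      rw [uIcc_of_le hs1]
      exact fun h => absurd h.1 (not_le.2 hs)
    constructor
    · rw [intervalIntegrable_iff_integrableOn_Ioc_of_le zero_le_one]
      exact ((integrable_indicator_iff measurableSet_Ioc).2 h1).integrableOn
    · rw [intervalIntegral.integral_of_le zero_le_one, integral_indicator measurableSet_Ioc,
        Measure.restrict_restrict measurableSet_Ioc, Ioc_inter_Ioc, max_eq_left hs.le, min_self,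
        ← intervalIntegral.integral_of_le hs1, integral_inv_of_pos hs one_pos, one_div]
  have h := irrMeasure_real_sum_gaussIter_ge_le
    (g := fun y : ℝ => (Ioc s 1).indicator (fun y => y⁻¹) y)
    (measurable_inv.indicator measurableSet_Ioc)
    (fun x hx => indicator_nonneg (fun y hy => inv_nonneg.2 (hs.le.trans hy.1.le)) x)
    h_int.1 k hL
  rw [h_int.2] at h
  have h2 : irrMeasure.real (⋃ i ∈ Finset.range k, {x | gaussIter i x ≤ s}) ≤ k * (4 * s) := by
    refine (measureReal_biUnion_finset_le _ _).trans ?_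
    exact (Finset.sum_le_card_nsmul _ _ (4 * s)
      fun i _ => irrMeasure_real_gaussIter_le_le i hs.le).trans (by simp)
  refine le_trans (le_trans (irrMeasure_real_mono (t := (⋃ i ∈ Finset.range k,
    {x | gaussIter i x ≤ s}) ∪ {x | L ≤ ∑ i ∈ Finset.range k,
      (Ioc s 1).indicator (fun y => y⁻¹) (gaussIter i x)}) ?_) (measureReal_union_le _ _))
    (add_le_add h2 h)
  refine fun x hx h1 => ?_
  by_cases h3 : ∃ i < k, gaussIter i x ≤ s
  · obtain ⟨i, hi, h3⟩ := h3
    left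
    exact mem_biUnion (x := i) (by simpa using hi) h3
  · push Not at h3
    right
    refine le_trans h1 ((sum_cfWord_le hx k).trans (le_of_eq (Finset.sum_congr rfl fun i hi => ?_)))
    rw [indicator_of_mem]
    exact ⟨h3 i (Finset.mem_range.1 hi), (gaussIter_mem hx i).2.2.le⟩

lemma exists_forall_irrMeasure_real_sum_cfWord_ge_le {η : ℝ} (hη : 0 < η) :
    ∃ Λ : ℕ, 1 ≤ Λ ∧ ∀ j k : ℕ, k ≤ 2 ^ (j + 1) →
      irrMeasure.real {x | Λ * 2 ^ j * (j + 1) ≤ (cfWord k x).sum} ≤ η := by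
  set η' := min η 1 with hη'
  have h0 : 0 < η' := lt_min hη one_pos
  set D := Real.log (16 / η') + 1 with hD
  have hD1 : 1 ≤ D := by
    have : 0 ≤ Real.log (16 / η') := Real.log_nonneg (by
      rw [le_div_iff₀ h0]; linarith [min_le_right η 1])
    linarith
  refine ⟨⌈16 * D / η'⌉₊, ?_, fun j k hk => ?_⟩
  · exact Nat.one_le_ceil_iff.2 (by positivity)
  have hΛ : 16 * D / η' ≤ (⌈16 * D / η'⌉₊ : ℝ) := Nat.le_ceil _
  generalize ⌈16 * D / η'⌉₊ = Λ at *
  have hΛ0 : (0 : ℝ) < Λ := lt_of_lt_of_le (by positivity) hΛ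
  have hk' : (k : ℝ) ≤ 2 * 2 ^ j := by
    rw [← pow_succ']
    exact_mod_cast hk
  have h2 : (1 : ℝ) ≤ 2 ^ j := one_le_pow₀ one_le_two
  have hs1 : η' / (16 * 2 ^ j) ≤ 1 := by
    rw [div_le_one (by positivity)]
    linarith [min_le_right η 1]
  have h := irrMeasure_real_sum_cfWord_ge_le k (L := Λ * 2 ^ j * (j + 1))
    (s := η' / (16 * 2 ^ j)) (by positivity) (by positivity) hs1
  have hcast : {x | Λ * 2 ^ j * (j + 1) ≤ (cfWord k x).sum} =
      {x | (Λ * 2 ^ j * (j + 1) : ℝ) ≤ (cfWord k x).sum} := by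
    ext x
    simp only [mem_ofPred_eq]
    exact_mod_cast Iff.rfl
  rw [hcast]
  refine h.trans (le_trans (b := η' / 2 + η' / 2) (add_le_add ?_ ?_)
    (by linarith [min_le_left η 1]))
  · calc k * (4 * (η' / (16 * 2 ^ j))) ≤ (2 * 2 ^ j) * (4 * (η' / (16 * 2 ^ j))) := by gcongr
      _ = η' / 2 := by field_simp; norm_num
  · have hlog : Real.log (η' / (16 * 2 ^ j))⁻¹ ≤ (j + 1) * D := by
      have : (η' / (16 * 2 ^ j))⁻¹ = 16 / η' * 2 ^ j := by field_simp
      rw [this, Real.log_mul (by positivity) (by positivity), Real.log_pow]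
      have hl := Real.log_two_lt_d9
      have hj : (0 : ℝ) ≤ j := Nat.cast_nonneg j
      nlinarith
    calc 4 * k * Real.log (η' / (16 * 2 ^ j))⁻¹ / (Λ * 2 ^ j * (j + 1))
        ≤ 4 * (2 * 2 ^ j) * ((j + 1) * D) / (Λ * 2 ^ j * (j + 1)) := by
          have hlog0 : 0 ≤ Real.log (η' / (16 * 2 ^ j))⁻¹ :=
            Real.log_nonneg ((one_le_inv₀ (by positivity)).2 hs1)
          gcongr
      _ = 8 * D / Λ := by field_simp; norm_num
      _ ≤ η' / 2 := by
          rw [div_le_div_iff₀ hΛ0 two_pos]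
          rw [div_le_iff₀ h0] at hΛ
          linarith

lemma convDen_cfWord_strictMonoOn {x : ℝ} (hx : x ∈ irrUnit) :
    StrictMono fun k => (convDen (cfWord (k + 1) x)).1 := by
  refine strictMono_nat_of_lt_succ fun k => ?_
  have h1 := cfDigit_pos (gaussIter_mem hx (k + 1))
  have h2 := convDen_fst_pos (one_le_of_mem_cfWord hx k)
  have h3 : (convDen (cfWord (k + 1 + 1) x)).1 = cfDigit (gaussIter (k + 1) x) *
    (convDen (cfWord (k + 1) x)).1 + (convDen (cfWord k x)).1 := rfl
  change (convDen (cfWord (k + 1) x)).1 < (convDen (cfWord (k + 1 + 1) x)).1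
  rw [h3]
  nlinarith

lemma sum_irrMeasure_real_convDen_eq_le (s : Finset ℕ) (hs : ∀ k ∈ s, 1 ≤ k) {q : ℕ}
    (hq : 1 ≤ q) :
    ∑ k ∈ s, irrMeasure.real {x | (convDen (cfWord k x)).1 = q} ≤ 4 / q := by
  have hq' : (1 : ℝ) ≤ q := by exact_mod_cast hq
  have hm : ∀ k, MeasurableSet {x | (convDen (cfWord k x)).1 = q} := fun k =>
    measurableSet_cfWord {w | (convDen w).1 = q} k
  have h1 : ∑ k ∈ s, irrMeasure.real {x | (convDen (cfWord k x)).1 = q} =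
      irrMeasure.real (⋃ k ∈ s, {x | (convDen (cfWord k x)).1 = q} ∩ irrUnit) := by
    rw [measureReal_biUnion_finset]
    · refine Finset.sum_congr rfl fun k _ => ?_
      rw [measureReal_def, measureReal_def, irrMeasure_apply, irrMeasure_apply, inter_assoc,
        inter_self]
    · intro k hk l hl hkl
      refine disjoint_left.2 ?_
      rintro x ⟨h1, hx⟩ ⟨h2, -⟩
      obtain ⟨k, rfl⟩ := Nat.exists_eq_add_of_le' (hs k hk)
      obtain ⟨l, rfl⟩ := Nat.exists_eq_add_of_le' (hs l hl)
      refine hkl ?_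
      rw [(convDen_cfWord_strictMonoOn hx).injective (h1.trans h2.symm)]
    · exact fun k _ => (hm k).inter measurableSet_irrUnit
  rw [h1]
  have h2 : irrMeasure.real (⋃ k ∈ s, {x | (convDen (cfWord k x)).1 = q} ∩ irrUnit) ≤
      irrMeasure.real (⋃ p ∈ Finset.range (q + 1),
        Icc ((p / q : ℝ) - 1 / q ^ 2) (p / q + 1 / q ^ 2)) := by
    refine irrMeasure_real_mono fun x hx h => ?_
    obtain ⟨k, hk, h3, -⟩ := mem_iUnion₂.1 h
    have h4 := abs_sub_div_le hx k
    have h5 := convDen_mul_abs_le hx k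
    have h6 := (gaussIter_mem hx k).2.2
    have h3' : (convDen (cfWord k x)).1 = q := h3
    rw [h3'] at h4 h5
    refine mem_biUnion (x := (convNum (cfWord k x)).1) ?_ ?_
    · have h7 : ((convNum (cfWord k x)).1 : ℝ) < (q + 1 : ℕ) := by
        have h8 : |q * x - ((convNum (cfWord k x)).1 : ℤ)| < 1 := by
          have := abs_nonneg (q * x - ((convNum (cfWord k x)).1 : ℤ))
          nlinarith
        have h9 := (abs_lt.1 h8).1
        have h10 : (q : ℝ) * x ≤ q := mul_le_of_le_one_right (by positivity) hx.2.2.le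
        push_cast at h9 ⊢
        linarith
      have h11 : (convNum (cfWord k x)).1 < q + 1 := by exact_mod_cast h7
      simpa using h11
    · have := abs_le.1 h4
      push_cast at this
      exact ⟨by linarith [this.1], by linarith [this.2]⟩
  refine h2.trans ((measureReal_biUnion_finset_le _ _).trans
    ((Finset.sum_le_card_nsmul _ _ (2 / q ^ 2 : ℝ) fun p _ => ?_).trans ?_))
  · refine ENNReal.toReal_le_of_le_ofReal (by positivity) ?_
    rw [irrMeasure_apply]
    refine (measure_mono inter_subset_left).trans ?_
    rw [Real.volume_Icc]
    refine ENNReal.ofReal_le_ofReal (le_of_eq ?_)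
    ring
  · rw [Finset.card_range, nsmul_eq_mul, mul_div_assoc', div_le_div_iff₀ (by positivity)
      (by positivity)]
    push_cast
    nlinarith [mul_nonneg (by positivity : (0 : ℝ) ≤ q) (sub_nonneg.2 hq')]

lemma sum_irrMeasure_real_convDen_mem_le {B : Set ℕ} {δ : ℝ} (hδ : 0 < δ)
    (hB : ∀ Q : ℕ, 1 ≤ Q →
      ∑ q ∈ Finset.Icc 1 Q, B.indicator (fun q => (1 / q : ℝ)) q ≤ δ * (1 + Real.log Q))
    {D : ℝ} (hD : 0 < D) (j : ℕ) :
    ∑ k ∈ Finset.Ico (2 ^ j) (2 ^ (j + 1)), irrMeasure.real {x | (convDen (cfWord k x)).1 ∈ B} ≤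
      2 ^ j * (8 / D + 8 * δ * (1 + D)) := by
  set L : ℝ := D * (2 * 2 ^ j) with hL
  have hL0 : 0 < L := by positivity
  have h2 : (1 : ℝ) ≤ 2 ^ j := one_le_pow₀ one_le_two
  set Q := ⌊Real.exp L⌋₊ with hQ
  have hQ1 : 1 ≤ Q := Nat.le_floor (by simpa using Real.one_le_exp hL0.le)
  have hQL : Real.log Q ≤ L := by
    rw [Real.log_le_iff_le_exp (by exact_mod_cast hQ1)]
    exact Nat.floor_le (Real.exp_pos L).le
  have h3 : ∀ k ∈ Finset.Ico (2 ^ j) (2 ^ (j + 1)),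
      irrMeasure.real {x | (convDen (cfWord k x)).1 ∈ B} ≤ 8 / D +
        ∑ q ∈ Finset.Icc 1 Q, B.indicator
          (fun q => irrMeasure.real {x | (convDen (cfWord k x)).1 = q}) q := by
    intro k hk
    have hk' : (k : ℝ) ≤ 2 * 2 ^ j := by
      rw [← pow_succ']
      exact_mod_cast (Finset.mem_Ico.1 hk).2.le
    have h4 := irrMeasure_real_log_convDen_ge_le k hL0
    have h5 : 8 * k / L ≤ 8 / D := by
      rw [div_le_div_iff₀ hL0 hD, hL]
      nlinarith
    have h6 : irrMeasure.real (⋃ q ∈ Finset.Icc 1 Q,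
        {x | (convDen (cfWord k x)).1 = q ∧ q ∈ B}) ≤ ∑ q ∈ Finset.Icc 1 Q, B.indicator
          (fun q => irrMeasure.real {x | (convDen (cfWord k x)).1 = q}) q := by
      refine (measureReal_biUnion_finset_le _ _).trans (Finset.sum_le_sum fun q _ => ?_)
      by_cases hqB : q ∈ B <;> simp [hqB]
    refine le_trans (le_trans (irrMeasure_real_mono (t :=
      {x | L ≤ Real.log (convDen (cfWord k x)).1} ∪ ⋃ q ∈ Finset.Icc 1 Q,
        {x | (convDen (cfWord k x)).1 = q ∧ q ∈ B}) ?_) (measureReal_union_le _ _))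
      (add_le_add (h4.trans h5) h6)
    intro x hx hxB
    by_cases hlog : L ≤ Real.log (convDen (cfWord k x)).1
    · exact Or.inl hlog
    · right
      have hpos := convDen_fst_pos (one_le_of_mem_cfWord hx k)
      refine mem_biUnion (x := (convDen (cfWord k x)).1) ?_ ⟨rfl, hxB⟩
      refine Finset.mem_coe.2 (Finset.mem_Icc.2 ⟨hpos, Nat.le_floor ?_⟩)
      rw [← Real.log_le_iff_le_exp (by exact_mod_cast hpos)]
      exact (not_le.1 hlog).le
  refine (Finset.sum_le_sum h3).trans ?_
  rw [Finset.sum_add_distrib, Finset.sum_const, Nat.card_Ico, Finset.sum_comm, nsmul_eq_mul]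
  have hcard : ((2 ^ (j + 1) - 2 ^ j : ℕ) : ℝ) = 2 ^ j := by
    rw [pow_succ, mul_two, Nat.add_sub_cancel]
    push_cast
    rfl
  have h7 : ∑ q ∈ Finset.Icc 1 Q, ∑ k ∈ Finset.Ico (2 ^ j) (2 ^ (j + 1)), B.indicator
      (fun q => irrMeasure.real {x | (convDen (cfWord k x)).1 = q}) q ≤
      4 * ∑ q ∈ Finset.Icc 1 Q, B.indicator (fun q => (1 / q : ℝ)) q := by
    rw [Finset.mul_sum]
    refine Finset.sum_le_sum fun q hq => ?_
    by_cases hqB : q ∈ B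
    · simp only [hqB, indicator_of_mem]
      refine (sum_irrMeasure_real_convDen_eq_le _ (fun k hk => ?_)
        (Finset.mem_Icc.1 hq).1).trans (le_of_eq (by ring))
      exact Nat.one_le_two_pow.trans (Finset.mem_Ico.1 hk).1
    · simp [hqB]
  rw [hcard, mul_add]
  refine add_le_add le_rfl (h7.trans ((mul_le_mul_of_nonneg_left (hB Q hQ1) (by norm_num)).trans ?_))
  have h8 : 1 + Real.log Q ≤ (1 + D) * (2 * 2 ^ j) := by nlinarith
  nlinarith [mul_le_mul_of_nonneg_left h8 hδ.le]

lemma le_irrMeasure_real_coprime (k : ℕ) (S : Set (List ℕ)) {W : ℕ} (hW : 0 < W) :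
    1 / (W * (W + 1)) * irrMeasure.real {x | cfWord k x ∈ S} ≤
      4 * irrMeasure.real {x | cfWord k x ∈ S ∧
        Nat.Coprime (convDen (cfWord (k + 1) x)).1 W} := by
  choose b hb1 hbW hb using fun w => exists_coprime_mul_add (coprime_convDen w) hW
  refine (le_irrMeasure_cfWord_gaussIter k S (fun w => Ioo (1 / (b w + 1) : ℝ) (1 / b w))
    (fun _ _ => measurableSet_Ioo) (by positivity) fun w _ => ?_).trans ?_
  · have hb0 : (0 : ℝ) < b w := by exact_mod_cast hb1 w
    have hb0' : (1 : ℝ) ≤ b w := by exact_mod_cast hb1 w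
    have hbW' : (b w : ℝ) ≤ W := by exact_mod_cast hbW w
    rw [measureReal_def, irrMeasure_of_subset, Real.volume_Ioo, ENNReal.toReal_ofReal]
    · rw [div_sub_div _ _ hb0.ne' (by positivity)]
      rw [one_mul, mul_one, add_sub_cancel_left]
      gcongr
    · rw [sub_nonneg]
      gcongr
      linarith
    · refine Ioo_subset_Ioo (by positivity) ?_
      rw [div_le_one hb0]
      exact hb0'
  · refine mul_le_mul_of_nonneg_left (irrMeasure_real_mono fun x hx h => ⟨h.1, ?_⟩) (by norm_num)
    obtain ⟨h1, h2⟩ := h.2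
    set w := cfWord k x
    have hb0 : (0 : ℝ) < b w := by exact_mod_cast hb1 w
    have hy := (gaussIter_mem hx k).2.1
    have hd : cfDigit (gaussIter k x) = b w := by
      rw [cfDigit, Nat.floor_eq_iff (inv_pos.2 hy).le]
      rw [one_div] at h1 h2
      exact ⟨((lt_inv_comm₀ hy hb0).1 h2).le, (inv_lt_comm₀ (by positivity) hy).1 h1⟩
    change Nat.Coprime (cfDigit (gaussIter k x) * (convDen w).1 + (convDen w).2) W
    rw [hd]
    exact hb w

lemma mul_le_of_dyadic_block_decay {a b : ℕ → ℝ} (ha0 : ∀ k, 0 ≤ a k) (ha1 : ∀ k, a k ≤ 1)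
    (hanti : Antitone a) {c η M : ℝ} (hM : 0 ≤ M)
    (h : ∀ j : ℕ, ∀ k ∈ Finset.Ico (2 ^ j) (2 ^ (j + 1)),
      c - η - b k - (a (k - 1) - a k) ≤ M * 2 ^ j * (j + 1) * (a k - a (k + 1)))
    (hb : ∀ j, ∑ k ∈ Finset.Ico (2 ^ j) (2 ^ (j + 1)), b k ≤ 2 ^ j * η) : c ≤ 2 * η := by
  by_contra! hc
  have hblock : ∀ j : ℕ, (c - 2 * η) * (1 / (j + 1)) ≤
      M * (a (2 ^ j) - a (2 ^ (j + 1))) + (a (2 ^ j - 1) - a (2 ^ (j + 1) - 1)) := by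
    intro j
    have h1 := Finset.sum_le_sum (h j)
    have hle : 2 ^ j ≤ 2 ^ (j + 1) := Nat.pow_le_pow_right two_pos (Nat.le_succ j)
    have hcard : ((2 ^ (j + 1) - 2 ^ j : ℕ) : ℝ) = 2 ^ j := by
      rw [pow_succ, mul_two, Nat.add_sub_cancel]
      push_cast
      rfl
    have t1 : ∑ k ∈ Finset.Ico (2 ^ j) (2 ^ (j + 1)), (a k - a (k + 1)) =
        a (2 ^ j) - a (2 ^ (j + 1)) := by
      have hs := Finset.sum_Ico_sub (fun k => -a k) hle
      simp only [neg_sub_neg] at hs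
      exact hs
    have t2 : ∑ k ∈ Finset.Ico (2 ^ j) (2 ^ (j + 1)), (a (k - 1) - a k) =
        a (2 ^ j - 1) - a (2 ^ (j + 1) - 1) := by
      have hs := Finset.sum_Ico_sub (fun k => -a (k - 1)) hle
      simp only [neg_sub_neg, Nat.add_sub_cancel] at hs
      exact hs
    rw [Finset.sum_sub_distrib, Finset.sum_sub_distrib, ← Finset.mul_sum, t1, t2, Finset.sum_const,
      Nat.card_Ico, nsmul_eq_mul, hcard] at h1
    have h2 := hb j
    have hp1 : (1 : ℝ) ≤ 2 ^ j := one_le_pow₀ one_le_two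
    have hp : (0 : ℝ) < 2 ^ j := by positivity
    have hj : (0 : ℝ) ≤ j := Nat.cast_nonneg j
    set d := a (2 ^ j - 1) - a (2 ^ (j + 1) - 1)
    have hd : 0 ≤ d := sub_nonneg.2 (hanti (Nat.sub_le_sub_right hle 1))
    rw [mul_one_div, div_le_iff₀ (by positivity)]
    refine le_of_mul_le_mul_left ?_ hp
    have h3 : d ≤ 2 ^ j * (d * (j + 1)) := by
      nlinarith [mul_nonneg hd hj, mul_nonneg (mul_nonneg hd hj) hp.le]
    linarith
  have hsum : ∀ n : ℕ, (c - 2 * η) * ∑ j ∈ Finset.range n, (1 / (j + 1) : ℝ) ≤ M + 1 := by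
    intro n
    rw [Finset.mul_sum]
    refine (Finset.sum_le_sum fun j _ => hblock j).trans ?_
    rw [Finset.sum_add_distrib, ← Finset.mul_sum, Finset.sum_range_sub' (fun j => a (2 ^ j)),
      Finset.sum_range_sub' (fun j => a (2 ^ j - 1))]
    have h1 := ha0 (2 ^ n)
    have h2 := ha1 (2 ^ 0)
    have h3 := ha0 (2 ^ n - 1)
    have h4 := ha1 (2 ^ 0 - 1)
    nlinarith
  have ht := Real.tendsto_sum_range_one_div_nat_succ_atTop.const_mul_atTop (sub_pos.2 hc)
  obtain ⟨n, hn⟩ := (ht.eventually_gt_atTop (M + 1)).exists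
  exact absurd (hsum n) (not_le.2 hn)

/-- The last digit of `w` is large with respect to the earlier ones, whose continued fraction has a
denominator coprime to `W` and outside of `B`. -/
def IsGoodWord (W : ℕ) (B : Set ℕ) (K : ℕ) : List ℕ → Prop
  | [] => False
  | b :: w => Nat.Coprime (convDen w).1 W ∧ (convDen w).1 ∉ B ∧ K * (1 + w.sum) ≤ b

/-- No initial segment of `w` is good. -/
def HasNoGoodPrefix (W : ℕ) (B : Set ℕ) (K : ℕ) : List ℕ → Prop
  | [] => True
  | b :: w => ¬ IsGoodWord W B K (b :: w) ∧ HasNoGoodPrefix W B K w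

lemma hasNoGoodPrefix_cfWord_succ {W : ℕ} {B : Set ℕ} {K k : ℕ} {x : ℝ} :
    HasNoGoodPrefix W B K (cfWord (k + 1) x) ↔
      ¬ IsGoodWord W B K (cfWord (k + 1) x) ∧ HasNoGoodPrefix W B K (cfWord k x) := Iff.rfl

lemma irrMeasure_real_hasNoGoodPrefix_sub {W : ℕ} {B : Set ℕ} {K : ℕ} (k : ℕ) :
    irrMeasure.real {x | HasNoGoodPrefix W B K (cfWord k x)} -
      irrMeasure.real {x | HasNoGoodPrefix W B K (cfWord (k + 1) x)} =
    irrMeasure.real {x | HasNoGoodPrefix W B K (cfWord k x) ∧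
      IsGoodWord W B K (cfWord (k + 1) x)} := by
  rw [← measureReal_sdiff (μ := irrMeasure) (s₁ := {x | HasNoGoodPrefix W B K (cfWord k x)})
    (s₂ := {x | HasNoGoodPrefix W B K (cfWord (k + 1) x)}) (fun x hx => (hasNoGoodPrefix_cfWord_succ.1 hx).2)
    (measurableSet_cfWord {w | HasNoGoodPrefix W B K w} (k + 1))]
  congr 1
  ext x
  simp only [Set.mem_sdiff, mem_ofPred_eq, hasNoGoodPrefix_cfWord_succ]
  tauto

lemma irrMeasure_real_hasNoGoodPrefix_block {W : ℕ} (hW : 0 < W) {B : Set ℕ} {K Λ : ℕ}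
    (hK : 1 ≤ K) (hΛ : 1 ≤ Λ) {η : ℝ} {j k : ℕ} (hk : 1 ≤ k)
    (hη : irrMeasure.real {x | Λ * 2 ^ j * (j + 1) ≤ (cfWord k x).sum} ≤ η) :
    1 / (4 * (W * (W + 1))) * irrMeasure.real {x | HasNoGoodPrefix W B K (cfWord (k - 1) x)} -
        η - irrMeasure.real {x | (convDen (cfWord k x)).1 ∈ B} -
      (irrMeasure.real {x | HasNoGoodPrefix W B K (cfWord (k - 1) x)} -
        irrMeasure.real {x | HasNoGoodPrefix W B K (cfWord k x)}) ≤
      4 * K * Λ * 2 ^ j * (j + 1) *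
        (irrMeasure.real {x | HasNoGoodPrefix W B K (cfWord k x)} -
          irrMeasure.real {x | HasNoGoodPrefix W B K (cfWord (k + 1) x)}) := by
  obtain ⟨k, rfl⟩ := Nat.exists_eq_add_of_le' hk
  rw [Nat.add_sub_cancel, irrMeasure_real_hasNoGoodPrefix_sub, irrMeasure_real_hasNoGoodPrefix_sub]
  have h1 := le_irrMeasure_real_coprime k {w | HasNoGoodPrefix W B K w} hW
  set L := Λ * 2 ^ j * (j + 1) with hL
  have hL1 : 1 ≤ L := Nat.mul_pos (Nat.mul_pos hΛ (by positivity)) (by positivity)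
  have hKL : 1 ≤ K * L := Nat.mul_pos hK hL1
  have hKL' : (1 : ℝ) ≤ (K * L : ℕ) := by exact_mod_cast hKL
  set S : Set (List ℕ) := {w | HasNoGoodPrefix W B K w ∧ Nat.Coprime (convDen w).1 W ∧
    (convDen w).1 ∉ B ∧ w.sum < L} with hS
  have h2 := le_irrMeasure_cfWord_gaussIter (k + 1) S (fun _ => Ioo 0 (1 / (K * L : ℕ)))
    (fun _ _ => measurableSet_Ioo) (c := 1 / (K * L : ℕ)) (by positivity) (fun _ _ => by
      rw [measureReal_def, irrMeasure_of_subset, Real.volume_Ioo, sub_zero,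
        ENNReal.toReal_ofReal (by positivity)]
      exact Ioo_subset_Ioo le_rfl ((div_le_one (by positivity)).2 hKL'))
  have h3 : irrMeasure.real {x | cfWord (k + 1) x ∈ S ∧
      gaussIter (k + 1) x ∈ Ioo (0 : ℝ) (1 / (K * L : ℕ))} ≤
      irrMeasure.real {x | HasNoGoodPrefix W B K (cfWord (k + 1) x) ∧
        IsGoodWord W B K (cfWord (k + 1 + 1) x)} := by
    refine irrMeasure_real_mono fun x hx h => ?_
    obtain ⟨⟨h4, h5, h6, h7⟩, h8, h9⟩ := h
    refine ⟨h4, h5, h6, ?_⟩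
    refine le_trans (Nat.mul_le_mul_left K (by omega : 1 + (cfWord (k + 1) x).sum ≤ L)) ?_
    refine Nat.le_floor ?_
    rw [one_div] at h9
    exact ((lt_inv_comm₀ h8 (by positivity)).1 h9).le
  have h4 : irrMeasure.real {x | cfWord k x ∈ {w | HasNoGoodPrefix W B K w} ∧
      Nat.Coprime (convDen (cfWord (k + 1) x)).1 W} ≤
      irrMeasure.real {x | cfWord (k + 1) x ∈ S} + η +
        irrMeasure.real {x | (convDen (cfWord (k + 1) x)).1 ∈ B} +
        irrMeasure.real {x | HasNoGoodPrefix W B K (cfWord k x) ∧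
          IsGoodWord W B K (cfWord (k + 1) x)} := by
    refine le_trans (irrMeasure_real_mono (t := (({x | cfWord (k + 1) x ∈ S} ∪
      {x | L ≤ (cfWord (k + 1) x).sum}) ∪ {x | (convDen (cfWord (k + 1) x)).1 ∈ B}) ∪
      {x | HasNoGoodPrefix W B K (cfWord k x) ∧ IsGoodWord W B K (cfWord (k + 1) x)}) ?_) ?_
    · intro x _ hx
      simp only [mem_union, mem_ofPred_eq, hS, hasNoGoodPrefix_cfWord_succ] at hx ⊢
      have := lt_or_ge (cfWord (k + 1) x).sum L
      tauto
    · refine (measureReal_union_le _ _).trans (add_le_add ?_ le_rfl)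
      refine (measureReal_union_le _ _).trans (add_le_add ?_ le_rfl)
      exact (measureReal_union_le _ _).trans (add_le_add le_rfl hη)
  have h5 : irrMeasure.real {x | cfWord (k + 1) x ∈ S} ≤ 4 * (K * L : ℕ) *
      irrMeasure.real {x | HasNoGoodPrefix W B K (cfWord (k + 1) x) ∧
        IsGoodWord W B K (cfWord (k + 1 + 1) x)} := by
    rw [one_div_mul_eq_div, div_le_iff₀ (by positivity)] at h2
    refine h2.trans (le_trans (mul_le_mul_of_nonneg_right
      (mul_le_mul_of_nonneg_left h3 (by norm_num)) (by positivity)) (le_of_eq (by ring)))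
  have h6 : (4 * (K * L : ℕ) : ℝ) = 4 * K * Λ * 2 ^ j * (j + 1) := by
    rw [hL]
    push_cast
    ring
  rw [h6] at h5
  have h7 : (1 : ℝ) / (4 * (W * (W + 1))) * irrMeasure.real {x | HasNoGoodPrefix W B K (cfWord k x)}
      ≤ irrMeasure.real {x | cfWord k x ∈ {w | HasNoGoodPrefix W B K w} ∧
      Nat.Coprime (convDen (cfWord (k + 1) x)).1 W} := by
    have : (1 : ℝ) / (4 * (W * (W + 1))) = 1 / (W * (W + 1)) / 4 := by
      rw [div_div, mul_comm]
    rw [this]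
    simp only [mem_ofPred_eq] at h1 ⊢
    linarith
  linarith

theorem irrMeasure_real_forall_hasNoGoodPrefix_le {W : ℕ} (hW : 0 < W) {η : ℝ} (hη : 0 < η) :
    ∃ δ : ℝ, 0 < δ ∧ ∀ B : Set ℕ, (∀ Q : ℕ, 1 ≤ Q →
      ∑ q ∈ Finset.Icc 1 Q, B.indicator (fun q => (1 / q : ℝ)) q ≤ δ * (1 + Real.log Q)) →
      ∀ K : ℕ, 1 ≤ K → 1 / (4 * (W * (W + 1))) *
        irrMeasure.real {x | ∀ k, HasNoGoodPrefix W B K (cfWord k x)} ≤ 2 * η := by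
  obtain ⟨Λ, hΛ, hV⟩ := exists_forall_irrMeasure_real_sum_cfWord_ge_le hη
  refine ⟨η / (16 * (1 + 16 / η)), by positivity, fun B hB K hK => ?_⟩
  set a : ℕ → ℝ := fun k => irrMeasure.real {x | HasNoGoodPrefix W B K (cfWord k x)} with ha
  refine mul_le_of_dyadic_block_decay (a := a) (M := 4 * K * Λ)
    (b := fun k => irrMeasure.real {x | (convDen (cfWord k x)).1 ∈ B})
    (fun _ => measureReal_nonneg) (fun _ => measureReal_le_one)
    (antitone_nat_of_succ_le fun k => irrMeasure_real_mono fun x _ h =>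
      (hasNoGoodPrefix_cfWord_succ.1 h).2) (by positivity) (fun j k hk => ?_) (fun j => ?_)
  · rw [Finset.mem_Ico] at hk
    refine le_trans ?_ (irrMeasure_real_hasNoGoodPrefix_block hW hK hΛ
      (Nat.one_le_two_pow.trans hk.1) (hV j k hk.2.le))
    have h1 : irrMeasure.real {x | ∀ k, HasNoGoodPrefix W B K (cfWord k x)} ≤ a (k - 1) :=
      irrMeasure_real_mono fun x _ h => h _
    have h2 := mul_le_mul_of_nonneg_left h1
      (by positivity : (0 : ℝ) ≤ 1 / (4 * (W * (W + 1))))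
    simp only [ha] at h2 ⊢
    linarith
  · refine (sum_irrMeasure_real_convDen_mem_le (by positivity) hB (D := 16 / η)
      (by positivity) j).trans (mul_le_mul_of_nonneg_left (le_of_eq ?_) (by positivity))
    field_simp
    norm_num

theorem ae_exists_forall_isGoodWord {W : ℕ} (hW : 0 < W) (B : ℕ → Set ℕ)
    (hB : ∀ δ : ℝ, 0 < δ → ∃ n, ∀ Q : ℕ, 1 ≤ Q →
      ∑ q ∈ Finset.Icc 1 Q, (B n).indicator (fun q => (1 / q : ℝ)) q ≤ δ * (1 + Real.log Q)) :
    ∀ᵐ x ∂irrMeasure, ∃ n, ∀ K, ∃ k, IsGoodWord W (B n) K (cfWord (k + 1) x) := by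
  set N : ℕ → ℕ → Set ℝ := fun n K => {x | ∀ k, HasNoGoodPrefix W (B n) K (cfWord k x)} with hN
  have hmono : ∀ n, Monotone (N n) := by
    intro n K K' hKK x hx k
    induction k with
    | zero => trivial
    | succ k ih =>
      refine ⟨fun hg => (hx (k + 1)).1 ⟨hg.1, hg.2.1, le_trans ?_ hg.2.2⟩, ih⟩
      exact Nat.mul_le_mul_right _ hKK
  have hle : ∀ η : ℝ, 0 < η → ∃ n, irrMeasure (⋃ K, N n K) ≤ ENNReal.ofReal η := by
    intro η hη
    obtain ⟨δ, hδ, h⟩ := irrMeasure_real_forall_hasNoGoodPrefix_le hW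
      (η := 1 / (4 * (W * (W + 1))) * η / 2) (by positivity)
    obtain ⟨n, hn⟩ := hB δ hδ
    refine ⟨n, ?_⟩
    rw [(hmono n).measure_iUnion]
    refine iSup_le fun K => (measure_mono (hmono n (Nat.le_add_right K 1))).trans ?_
    have h1 := h (B n) hn (K + 1) (Nat.le_add_left 1 K)
    rw [mul_div_cancel₀ _ two_ne_zero] at h1
    have h2 := le_of_mul_le_mul_left h1 (by positivity)
    rw [← ofReal_measureReal (μ := irrMeasure)]
    exact ENNReal.ofReal_le_ofReal h2
  have hnull : irrMeasure (⋂ n, ⋃ K, N n K) = 0 := by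
    refine le_antisymm (ENNReal.le_of_forall_pos_le_add fun ε hε _ => ?_) zero_le
    obtain ⟨n, hn⟩ := hle ε hε
    rw [zero_add, ← ENNReal.ofReal_coe_nnreal]
    exact (measure_mono (iInter_subset _ n)).trans hn
  refine (measure_eq_zero_iff_ae_notMem.1 hnull).mono fun x hx => ?_
  simp only [mem_iInter, mem_iUnion, not_forall, not_exists] at hx
  obtain ⟨n, hn⟩ := hx
  refine ⟨n, fun K => ?_⟩
  by_contra! hK
  refine hn K fun k => ?_
  induction k with
  | zero => trivial
  | succ k ih => exact ⟨hK k, ih⟩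

lemma sum_indicator_one_div_le_of_separated {A : Set ℕ} {R : ℕ} (hR : 0 < R)
    (h1 : ∀ q ∈ A, 1 ≤ q → R ≤ q)
    (h2 : ∀ q ∈ A, ∀ q' ∈ A, 1 ≤ q → q < q' → R ≤ q' - q) (Q : ℕ) :
    ∑ q ∈ Finset.Icc 1 Q, A.indicator (fun q => (1 / q : ℝ)) q ≤ (1 + Real.log Q) / R := by
  classical
  have hR' : (0 : ℝ) < R := by exact_mod_cast hR
  rw [le_div_iff₀ hR']
  simp only [Set.indicator_apply]
  rw [← Finset.sum_filter, Finset.sum_mul]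
  set F := (Finset.Icc 1 Q).filter (· ∈ A) with hF
  have hmem : ∀ q ∈ F, 1 ≤ q ∧ q ≤ Q ∧ q ∈ A ∧ R ≤ q := by
    intro q hq
    simp only [hF, Finset.mem_filter, Finset.mem_Icc] at hq
    exact ⟨hq.1.1, hq.1.2, hq.2, h1 q hq.2 hq.1.1⟩
  have hterm : ∀ q ∈ F, (1 / q : ℝ) * R ≤ ∑ s ∈ Finset.Ioc (q - R) q, (s : ℝ)⁻¹ := by
    intro q hq
    obtain ⟨h3, h4, h5, h6⟩ := hmem q hq
    have := Finset.card_nsmul_le_sum (Finset.Ioc (q - R) q) (fun s : ℕ => (s : ℝ)⁻¹) (1 / q : ℝ)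
      (fun s hs => by
        rw [Finset.mem_Ioc] at hs
        rw [one_div]
        have : (0 : ℝ) < s := by exact_mod_cast (by omega : 0 < s)
        exact inv_anti₀ this (by exact_mod_cast hs.2))
    rw [Nat.card_Ioc, Nat.sub_sub_self h6, nsmul_eq_mul, mul_comm] at this
    exact this
  refine (Finset.sum_le_sum hterm).trans ?_
  rw [← Finset.sum_biUnion]
  · refine le_trans (Finset.sum_le_sum_of_subset_of_nonneg (t := Finset.Icc 1 Q) ?_ ?_) ?_
    · intro s hs
      simp only [Finset.mem_biUnion, Finset.mem_Ioc] at hs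
      obtain ⟨q, hq, h3, h4⟩ := hs
      have := hmem q hq
      rw [Finset.mem_Icc]
      omega
    · intros
      positivity
    · have := harmonic_le_one_add_log Q
      simpa [harmonic_eq_sum_Icc] using this
  · have key : ∀ q ∈ F, ∀ q' ∈ F, q < q' →
        Disjoint (Finset.Ioc (q - R) q) (Finset.Ioc (q' - R) q') := by
      intro q hq q' hq' hlt
      have h3 := hmem q hq
      have h4 := hmem q' hq'
      have h5 := h2 q h3.2.2.1 q' h4.2.2.1 h3.1 hlt
      rw [Finset.disjoint_left]
      intro s hs hs'
      rw [Finset.mem_Ioc] at hs hs'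
      omega
    intro q hq q' hq' hne
    rcases lt_or_gt_of_ne hne with h | h
    · exact key q hq q' hq' h
    · exact (key q' hq' q hq h).symm

lemma exists_pos_le_norm_nsmul {G : Type*} [NormedAddCommGroup G] {δ : G} {R : ℕ}
    (h : ∀ r, 1 ≤ r → r < R → r • δ ≠ 0) :
    ∃ ε : ℝ, 0 < ε ∧ ∀ r, 1 ≤ r → r < R → 2 * ε ≤ ‖r • δ‖ := by
  rcases (Finset.Ico 1 R).eq_empty_or_nonempty with h0 | h0
  · refine ⟨1, one_pos, fun r h1 h2 => ?_⟩
    have : r ∈ Finset.Ico 1 R := Finset.mem_Ico.2 ⟨h1, h2⟩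
    simp [h0] at this
  · obtain ⟨r, hr, hmin⟩ := Finset.exists_min_image _ (fun r => ‖r • δ‖) h0
    rw [Finset.mem_Ico] at hr
    have := norm_pos_iff.2 (h r hr.1 hr.2)
    refine ⟨‖r • δ‖ / 2, by positivity, fun s h1 h2 => ?_⟩
    have := hmin s (Finset.mem_Ico.2 ⟨h1, h2⟩)
    linarith

lemma exists_sum_indicator_norm_nsmul_le {G : Type*} [NormedAddCommGroup G] {δ : G} (hδ : δ ≠ 0)
    {W : ℕ} (hW : addOrderOf δ = 0 ∨ addOrderOf δ ∣ W) {η : ℝ} (hη : 0 < η) :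
    ∃ ε : ℝ, 0 < ε ∧ ∀ Q : ℕ, ∑ q ∈ Finset.Icc 1 Q,
      {q : ℕ | q.Coprime W ∧ ‖q • δ‖ < ε}.indicator (fun q => (1 / q : ℝ)) q ≤
        η * (1 + Real.log Q) := by
  have hnn : ∀ Q : ℕ, 0 ≤ 1 + Real.log Q := fun Q => by
    have := Real.log_natCast_nonneg Q
    linarith
  rcases Nat.eq_zero_or_pos (addOrderOf δ) with h0 | h0
  · obtain ⟨R, hR⟩ := exists_nat_gt (1 / η)
    have hR0 : (0 : ℝ) < R := lt_trans (by positivity) hR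
    obtain ⟨ε, hε, hmin⟩ := exists_pos_le_norm_nsmul (δ := δ) (R := R) (fun r h1 _ h => by
      have := addOrderOf_dvd_of_nsmul_eq_zero h
      rw [h0, zero_dvd_iff] at this
      omega)
    refine ⟨ε, hε, fun Q => ?_⟩
    refine (sum_indicator_one_div_le_of_separated (R := R) (by exact_mod_cast hR0) ?_ ?_ Q).trans ?_
    · rintro q ⟨-, h2⟩ h3
      by_contra! h4
      have := hmin q h3 h4
      linarith
    · rintro q ⟨-, h2⟩ q' ⟨-, h2'⟩ h3 h4
      by_contra! h5
      have h6 := hmin (q' - q) (by omega) h5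
      have h7 : (q' - q) • δ = q' • δ - q • δ := by
        rw [eq_sub_iff_add_eq, ← add_nsmul, Nat.sub_add_cancel h4.le]
      have h8 := norm_sub_le (q' • δ) (q • δ)
      rw [h7] at h6
      linarith
    · rw [div_le_iff₀ hR0]
      have : 1 ≤ η * R := by
        rw [div_lt_iff₀ hη] at hR
        linarith
      nlinarith [hnn Q]
  · have hdvd : addOrderOf δ ∣ W := hW.resolve_left h0.ne'
    obtain ⟨ε, hε, hmin⟩ := exists_pos_le_norm_nsmul (δ := δ) (R := addOrderOf δ)
      (fun r h1 h2 h => absurd (Nat.le_of_dvd h1 (addOrderOf_dvd_of_nsmul_eq_zero h)) (by omega))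
    refine ⟨ε, hε, fun Q => ?_⟩
    have hempty : {q : ℕ | q.Coprime W ∧ ‖q • δ‖ < ε} = ∅ := by
      refine Set.eq_empty_of_forall_notMem ?_
      rintro q ⟨h1, h2⟩
      have h3 : q % addOrderOf δ ≠ 0 := by
        intro h
        have h4 := Nat.Coprime.eq_one_of_dvd
          ((h1.coprime_dvd_right hdvd).symm) (Nat.dvd_of_mod_eq_zero h)
        exact hδ (AddMonoid.addOrderOf_eq_one_iff.1 h4)
      have h5 := hmin _ (Nat.one_le_iff_ne_zero.2 h3) (Nat.mod_lt _ h0)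
      rw [mod_addOrderOf_nsmul] at h5
      linarith
    rw [hempty]
    simp only [Set.indicator_empty, Finset.sum_const_zero]
    exact mul_nonneg hη.le (hnn Q)

lemma exists_sum_indicator_exists_norm_nsmul_le {G : Type*} [NormedAddCommGroup G] {ν : ℕ}
    {δ : Fin ν → G} {W : ℕ} (hW : ∀ i, addOrderOf (δ i) = 0 ∨ addOrderOf (δ i) ∣ W)
    {η : ℝ} (hη : 0 < η) :
    ∃ n : ℕ, ∀ Q : ℕ, ∑ q ∈ Finset.Icc 1 Q,
      {q : ℕ | q.Coprime W ∧ ∃ i, δ i ≠ 0 ∧ ‖q • δ i‖ < 1 / ((n : ℝ) + 1)}.indicator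
        (fun q => (1 / q : ℝ)) q ≤ η * (1 + Real.log Q) := by
  classical
  have hη' : 0 < η / (ν + 1) := by positivity
  have hex : ∀ i, ∃ ε : ℝ, 0 < ε ∧ (δ i ≠ 0 → ∀ Q : ℕ, ∑ q ∈ Finset.Icc 1 Q,
      {q : ℕ | q.Coprime W ∧ ‖q • δ i‖ < ε}.indicator (fun q => (1 / q : ℝ)) q ≤
        η / (ν + 1) * (1 + Real.log Q)) := by
    intro i
    by_cases h : δ i = 0
    · exact ⟨1, one_pos, fun h' => absurd h h'⟩
    · obtain ⟨ε, h1, h2⟩ := exists_sum_indicator_norm_nsmul_le h (hW i) hη'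
      exact ⟨ε, h1, fun _ => h2⟩
  choose ε hε hsum using hex
  have hev : ∀ᶠ n : ℕ in atTop, ∀ i, 1 / ((n : ℝ) + 1) < ε i :=
    eventually_all.2 fun i => tendsto_one_div_add_atTop_nhds_zero_nat.eventually_lt_const (hε i)
  obtain ⟨n, hn⟩ := hev.exists
  refine ⟨n, fun Q => ?_⟩
  have hnn : 0 ≤ 1 + Real.log Q := by
    have := Real.log_natCast_nonneg Q
    linarith
  have hle : ∀ q ∈ Finset.Icc 1 Q,
      {q : ℕ | q.Coprime W ∧ ∃ i, δ i ≠ 0 ∧ ‖q • δ i‖ < 1 / ((n : ℝ) + 1)}.indicator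
        (fun q => (1 / q : ℝ)) q ≤
      ∑ i ∈ Finset.univ.filter (fun i => δ i ≠ 0),
        {q : ℕ | q.Coprime W ∧ ‖q • δ i‖ < ε i}.indicator (fun q => (1 / q : ℝ)) q := by
    intro q _
    have hnonneg : ∀ i, 0 ≤ {q : ℕ | q.Coprime W ∧ ‖q • δ i‖ < ε i}.indicator
        (fun q => (1 / q : ℝ)) q := fun i =>
      Set.indicator_nonneg (fun q _ => by positivity) q
    refine Set.indicator_le' (g := fun q => ∑ i ∈ Finset.univ.filter (fun i => δ i ≠ 0),
        {q : ℕ | q.Coprime W ∧ ‖q • δ i‖ < ε i}.indicator (fun q => (1 / q : ℝ)) q) ?_ ?_ q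
    · rintro q ⟨h1, i, h2, h3⟩
      refine le_trans ?_ (Finset.single_le_sum (fun j _ => Set.indicator_nonneg
        (s := {q : ℕ | q.Coprime W ∧ ‖q • δ j‖ < ε j}) (fun q _ => by positivity) q)
        (Finset.mem_filter.2 ⟨Finset.mem_univ i, h2⟩))
      rw [Set.indicator_of_mem]
      exact ⟨h1, h3.trans (hn i)⟩
    · intro q _
      exact Finset.sum_nonneg fun j _ => Set.indicator_nonneg (fun q _ => by positivity) q
  refine (Finset.sum_le_sum hle).trans ?_
  rw [Finset.sum_comm]
  refine (Finset.sum_le_card_nsmul _ _ _ fun i hi => hsum i (Finset.mem_filter.1 hi).2 Q).trans ?_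
  rw [nsmul_eq_mul]
  have hcard : ((Finset.univ.filter (fun i => δ i ≠ 0)).card : ℝ) ≤ ν + 1 := by
    have := (Finset.card_filter_le (Finset.univ : Finset (Fin ν)) (fun i => δ i ≠ 0))
    rw [Finset.card_fin] at this
    have : ((Finset.univ.filter (fun i => δ i ≠ 0)).card : ℝ) ≤ ν := by exact_mod_cast this
    linarith
  refine (mul_le_mul_of_nonneg_right hcard (by positivity)).trans_eq ?_
  field_simp

lemma ae_unitAddCircle_of_ae_Ioo {P : UnitAddCircle → Prop}
    (h : ∀ᵐ x : ℝ ∂(volume.restrict (Ioo (0 : ℝ) 1)), P (x : UnitAddCircle)) :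
    ∀ᵐ α ∂(volume : Measure UnitAddCircle), P α := by
  have h1 : ∀ᵐ x : ℝ ∂(volume.restrict (Ioc (0 : ℝ) (0 + 1))), P (x : UnitAddCircle) := by
    rw [zero_add, ← Measure.restrict_congr_set Ioo_ae_eq_Ioc]
    exact h
  rw [ae_restrict_iff_subtype measurableSet_Ioc] at h1
  have h3 := (AddCircle.measurePreserving_equivIoc (T := 1) (a := 0)).quasiMeasurePreserving.ae h1
  filter_upwards [h3] with α hα
  have : (((AddCircle.equivIoc 1 0 α : ℝ)) : UnitAddCircle) = α :=
    (AddCircle.equivIoc 1 0).symm_apply_apply α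
  rwa [this] at hα

theorem JumpRegular.ae_not_satisfiesTDLT {ν : ℕ} {f : UnitAddCircle → ℝ}
    {γ : Fin ν → UnitAddCircle} {H : Fin ν → ℝ} {Λ : ℝ} (hf : JumpRegular f γ H Λ) {i₀ : Fin ν}
    (hH : H i₀ ≠ 0) :
    ∀ᵐ x : ℝ ∂irrMeasure, ∀ x₀, ¬ SatisfiesTDLT f (x : UnitAddCircle) x₀ := by
  set W : ℕ := ∏ i, if addOrderOf (γ i₀ - γ i) = 0 then 1 else addOrderOf (γ i₀ - γ i) with hWdef
  have hW : 0 < W := Finset.prod_pos fun i _ => by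
    split_ifs with h
    · exact one_pos
    · exact Nat.pos_of_ne_zero h
  have hdvd : ∀ i, addOrderOf (γ i₀ - γ i) = 0 ∨ addOrderOf (γ i₀ - γ i) ∣ W := fun i => by
    by_cases h : addOrderOf (γ i₀ - γ i) = 0
    · exact Or.inl h
    · refine Or.inr ?_
      have := Finset.dvd_prod_of_mem
        (fun i => if addOrderOf (γ i₀ - γ i) = 0 then 1 else addOrderOf (γ i₀ - γ i))
        (Finset.mem_univ i)
      simpa only [if_neg h] using this
  have hae := ae_exists_forall_isGoodWord hW
    (fun n => {q : ℕ | q.Coprime W ∧ ∃ i, γ i₀ - γ i ≠ 0 ∧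
      ‖q • (γ i₀ - γ i)‖ < 1 / ((n : ℝ) + 1)}) (fun δ hδ => by
      obtain ⟨n, hn⟩ := exists_sum_indicator_exists_norm_nsmul_le hdvd hδ
      exact ⟨n, fun Q _ => hn Q⟩)
  filter_upwards [hae, ae_mem_irrUnit] with x hx hirr x₀
  obtain ⟨n, hn⟩ := hx
  refine hf.not_satisfiesTDLT (ε := 1 / ((n : ℝ) + 1)) hH (by positivity) (fun K => ?_) x₀
  set C : ℝ := 2 * (2 * Λ + 10 * ν * Λ) with hC
  obtain ⟨k, hcop, hB, hk⟩ := hn (K * (1 + ⌈C⌉₊))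
  refine hf.goodScale hirr k (fun i hi => ?_) ?_
  · by_contra! h
    exact hB ⟨hcop, i, sub_ne_zero.2 fun h' => hi (hf.injective h').symm, h⟩
  · have hy := gaussIter_mem hirr k
    set y := gaussIter k x with hydef
    set V := (cfWord k x).sum with hV
    have hy0 : 0 < y := hy.2.1
    have hb : (cfDigit y : ℝ) * y ≤ 1 := by
      have : (cfDigit y : ℝ) ≤ y⁻¹ := Nat.floor_le (by positivity)
      calc (cfDigit y : ℝ) * y ≤ y⁻¹ * y := by gcongr
        _ = 1 := inv_mul_cancel₀ hy0.ne'
    refine le_trans (mul_le_mul_of_nonneg_right ?_ hy0.le) hb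
    have hk' : (K * (1 + ⌈C⌉₊) * (1 + V) : ℝ) ≤ cfDigit y := by exact_mod_cast hk
    refine le_trans ?_ hk'
    rw [mul_assoc (K : ℝ)]
    refine mul_le_mul_of_nonneg_left ?_ (Nat.cast_nonneg K)
    have h1 : C ≤ ⌈C⌉₊ := Nat.le_ceil C
    have h2 : (0 : ℝ) ≤ V := Nat.cast_nonneg V
    have h3 : (0 : ℝ) ≤ ⌈C⌉₊ := Nat.cast_nonneg _
    nlinarith [mul_le_mul_of_nonneg_right h1 h2]

/-- For a piecewise smooth `f`, for a.e. `α` and every `x₀`, no temporal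
distributional limit theorem holds for `S_N(f, α, x₀)`. -/
theorem no_TDLT_piecewise_smooth {ν : ℕ} (f : UnitAddCircle → ℝ)
    (γ : Fin ν → UnitAddCircle) (H : Fin ν → ℝ) (hf : IsPiecewiseSmooth f γ H) :
    ∀ᵐ α ∂(volume : Measure UnitAddCircle), ∀ x₀ : UnitAddCircle,
      ¬ SatisfiesTDLT f α x₀ := by
  obtain ⟨Λ, hΛ⟩ := hf.exists_jumpRegular
  obtain ⟨i₀, hi₀⟩ := hf.exists_jump_ne
  refine ae_unitAddCircle_of_ae_Ioo ?_
  rw [← irrMeasure_eq_restrict_Ioo]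
  exact hΛ.ae_not_satisfiesTDLT hi₀
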